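/- Every graph with maximum degree 4 on n vertices and with m edges admits a 1-bend RAC drawing of O(n²) area in which at least m/8 of the edges are drawn as single straight-line segments (without a bend). -/

import Mathlib

open scoped Classical

noncomputable section

/-- A point of the Euclidean plane. -/
abbrev Pt : Type := ℝ × ℝ

/-- The segments with endpoints `a, b` and `c, d` are orthogonal:
their direction vectors have zero inner product. -/
def SegOrth (a b c d : Pt) : Prop :=
  (b.1 - a.1) * (d.1 - c.1) + (b.2 - a.2) * (d.2 - c.2) = 0

/-- The degree of a vertex in a simple graph. -/
def vdeg {V : Type*} (G : SimpleGraph V) (v : V) : ℕ := (G.neighborSet v).ncard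

/-- `M` is a matching in `G`: a set of edges of `G` that are pairwise non-adjacent. -/
def IsMatchingOn {V : Type*} (G : SimpleGraph V) (M : Set (Sym2 V)) : Prop :=
  M ⊆ G.edgeSet ∧ ∀ e ∈ M, ∀ f ∈ M, e ≠ f → ∀ v : V, v ∈ e → v ∉ f

/-- `G` is `k`-edge-colorable: its edge set is partitioned into `k` matchings. -/
def EdgeColorable {V : Type*} (G : SimpleGraph V) (k : ℕ) : Prop :=
  ∃ M : Fin k → Set (Sym2 V),
    (∀ i, IsMatchingOn G (M i)) ∧
    (∀ i j, i ≠ j → Disjoint (M i) (M j)) ∧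
    (⋃ i, M i) = G.edgeSet

/-- `p` is a straight-line RAC drawing of `G`: vertices are at pairwise distinct points,
each edge is the closed segment between its endpoints, no edge passes through another
vertex, edges sharing an endpoint meet only there, and any two edges with no common
endpoint that intersect do so orthogonally. -/
structure IsRACDrawing {V : Type*} (G : SimpleGraph V) (p : V → Pt) : Prop where
  inj : Function.Injective p
  vertex_off : ∀ u v w : V, G.Adj u v → w ≠ u → w ≠ v →
    p w ∉ segment ℝ (p u) (p v)
  shared : ∀ u v w : V, G.Adj u v → G.Adj u w → v ≠ w →
    segment ℝ (p u) (p v) ∩ segment ℝ (p u) (p w) ⊆ {p u}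
  rac : ∀ u v u' v' : V, G.Adj u v → G.Adj u' v' →
    u ≠ u' → u ≠ v' → v ≠ u' → v ≠ v' →
    (segment ℝ (p u) (p v) ∩ segment ℝ (p u') (p v')).Nonempty →
    SegOrth (p u) (p v) (p u') (p v')

/-- All points of `P` are integer grid points lying in an axis-aligned square
of side length `side`. -/
def InGridSquare (side : ℝ) (P : Set Pt) : Prop :=
  (∀ q ∈ P, ∃ a b : ℤ, q = ((a : ℝ), (b : ℝ))) ∧
  ∃ x0 y0 : ℝ, ∀ q ∈ P, x0 ≤ q.1 ∧ q.1 ≤ x0 + side ∧ y0 ≤ q.2 ∧ q.2 ≤ y0 + side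

/-- The list of consecutive segments (as pairs of endpoints) of a polyline given
by its list of points. -/
def polySegs (l : List Pt) : List (Pt × Pt) := l.zip l.tail

/-- The set of plane points covered by a polyline given by its list of points. -/
def polySet (l : List Pt) : Set Pt := ⋃ s ∈ polySegs l, segment ℝ s.1 s.2

/-- `p, poly` is a `k`-bend RAC drawing of `G`: each edge `e` is drawn as the polyline
through the list of points `poly e` (at most `k + 1` segments, i.e. at most `k + 2`
points) joining the two endpoints of `e`; no edge passes through another vertex; edges
sharing an endpoint meet only at that endpoint; any two distinct edges intersect in
finitely many points; and wherever segments of two distinct edges meet (other than at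
the point of a common endvertex) the two segments are orthogonal. -/
structure IsBendRACDrawing {V : Type*} (k : ℕ) (G : SimpleGraph V)
    (p : V → Pt) (poly : Sym2 V → List Pt) : Prop where
  inj : Function.Injective p
  ends : ∀ e ∈ G.edgeSet, ∃ u v : V, e = s(u, v) ∧
    (poly e).head? = some (p u) ∧ (poly e).getLast? = some (p v)
  nsegs : ∀ e ∈ G.edgeSet, 2 ≤ (poly e).length ∧ (poly e).length ≤ k + 2
  vertex_off : ∀ e ∈ G.edgeSet, ∀ w : V, w ∉ e → p w ∉ polySet (poly e)
  shared : ∀ e ∈ G.edgeSet, ∀ e' ∈ G.edgeSet, e ≠ e' → ∀ w : V, w ∈ e → w ∈ e' →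
    polySet (poly e) ∩ polySet (poly e') ⊆ {p w}
  fin_inter : ∀ e ∈ G.edgeSet, ∀ e' ∈ G.edgeSet, e ≠ e' →
    (polySet (poly e) ∩ polySet (poly e')).Finite
  rac : ∀ e ∈ G.edgeSet, ∀ e' ∈ G.edgeSet, e ≠ e' →
    ∀ s ∈ polySegs (poly e), ∀ s' ∈ polySegs (poly e'),
    ∀ x : Pt, x ∈ segment ℝ s.1 s.2 → x ∈ segment ℝ s'.1 s'.2 →
    (∀ w : V, w ∈ e → w ∈ e' → x ≠ p w) →
    SegOrth s.1 s.2 s'.1 s'.2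

/-- All vertex points and bend points of a polyline drawing. -/
def drawingPoints {V : Type*} (G : SimpleGraph V) (p : V → Pt)
    (poly : Sym2 V → List Pt) : Set Pt :=
  Set.range p ∪ {q | ∃ e ∈ G.edgeSet, q ∈ poly e}

/-- `F` is (the edge set of) a 2-factor of `G`: a spanning subgraph in which every
vertex has degree exactly 2. -/
def Is2Factor {V : Type*} (G : SimpleGraph V) (F : Set (Sym2 V)) : Prop :=
  F ⊆ G.edgeSet ∧ ∀ v : V, {e ∈ F | v ∈ e}.ncard = 2

/-- The connected components of the (2-regular) spanning subgraph with edge set `F`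
that are odd cycles, i.e. have an odd number of vertices. -/
def oddComps {V : Type*} (F : Set (Sym2 V)) :
    Set ((SimpleGraph.fromEdgeSet F).ConnectedComponent) :=
  {C | Odd C.supp.ncard}

/-- `G` has oddness `k`: the minimum over all 2-factors of the number of odd-cycle
components equals `k` (in particular a 2-factor exists). -/
def HasOddness {V : Type*} (G : SimpleGraph V) (k : ℕ) : Prop :=
  (∃ F, Is2Factor G F ∧ (oddComps F).ncard = k) ∧
  (∀ F, Is2Factor G F → k ≤ (oddComps F).ncard)

/-- `G` has no cut-edge. -/
def Bridgeless {V : Type*} (G : SimpleGraph V) : Prop := ∀ e, ¬ G.IsBridge e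

section
/-! ### Combinatorial edges -/
/-- Shapes of edges. -/
inductive Ed (W : Type) where
  | S (u v : W) : Ed W
  | L (u v : W) : Ed W
  | H (u v : W) (e : ℤ) : Ed W
  | V (u v : W) (e : ℤ) : Ed W

namespace Ed
variable {W : Type}

def hor : Ed W → Option (W × W × ℤ)
  | S _ _ => none
  | L u v => some (u, v, 0)
  | H u v e => some (u, v, e)
  | V _ _ _ => none

def ver : Ed W → Option (W × W × ℤ)
  | S _ _ => none
  | L u v => some (v, u, 0)
  | H _ _ _ => none
  | V u v e => some (u, v, e)

def steep : Ed W → Option (W × W × ℤ)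
  | H u v e => some (u, v, e)
  | _ => none

def shal : Ed W → Option (W × W × ℤ)
  | V u v e => some (u, v, e)
  | _ => none

def str : Ed W → Option (W × W)
  | S u v => some (u, v)
  | _ => none

def ends : Ed W → Sym2 W
  | S u v => s(u, v)
  | L u v => s(u, v)
  | H u v _ => s(u, v)
  | V u v _ => s(u, v)

def isS : Ed W → Prop
  | S _ _ => True
  | _ => False
end Ed

def Opp {W : Type} (X : W → ℤ) (c d d' : W) : Prop :=
  (X d < X c ∧ X c < X d') ∨ (X d' < X c ∧ X c < X d)

def Avoid (p q s e : ℤ) : Prop :=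
  (e = 1 ∧ ((p ≤ s ∧ q ≤ s) ∨ (s + 1 ≤ p ∧ s + 1 ≤ q))) ∨
  (e = -1 ∧ ((s ≤ p ∧ s ≤ q) ∨ (p ≤ s - 1 ∧ q ≤ s - 1)))

def Out (a p q : ℤ) : Prop := (a < p ∧ a < q) ∨ (p < a ∧ q < a)

def Btwn (p a q : ℤ) : Prop := (p < a ∧ a < q) ∨ (q < a ∧ a < p)

/-- Compatibility of two edges; `X`, `Y` are only used through the induced orders. -/
structure Compat {W : Type} (X Y : W → ℤ) (e e' : Ed W) : Prop where
  c1 : ∀ c d δ d' δ', e.hor = some (c, d, δ) → e'.hor = some (c, d', δ') → Opp X c d d'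
  c2 : ∀ c d δ d' δ', e.ver = some (c, d, δ) → e'.ver = some (c, d', δ') → Opp Y c d d'
  c3 : ∀ u v ε c d δ, e.steep = some (u, v, ε) → e'.hor = some (c, d, δ) →
    Btwn (Y u) (Y c) (Y v) → Avoid (4 * X c) (4 * X d + δ) (4 * X v) ε
  c4 : ∀ u v ε c d δ, e.shal = some (u, v, ε) → e'.ver = some (c, d, δ) →
    Btwn (X u) (X c) (X v) → Avoid (4 * Y c) (4 * Y d + δ) (4 * Y v) ε
  c5 : ∀ u v ε u' v' ε', e.steep = some (u, v, ε) → e'.shal = some (u', v', ε') → v ≠ v' →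
    Out (X v) (X u') (X v') ∨ Out (Y v') (Y u) (Y v)
  c6 : ∀ c d δ c' d' δ', (∃ w, w ∈ e.ends ∧ w ∈ e'.ends) → e.hor = some (c, d, δ) →
    e'.ver = some (c', d', δ') → c ≠ c' →
    Out (4 * X c') (4 * X c) (4 * X d + δ) ∨ Out (4 * Y c) (4 * Y c') (4 * Y d' + δ')

def Valid {W : Type} (X Y : W → ℤ) : Ed W → Prop
  | .S u v => u ≠ v ∧ ∀ w, ¬ Btwn (X u) (X w) (X v) ∧ ¬ Btwn (Y u) (Y w) (Y v)
  | .L u v => u ≠ v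
  | .H u v e => u ≠ v ∧ (e = 1 ∨ e = -1)
  | .V u v e => u ≠ v ∧ (e = 1 ∨ e = -1)

/-- Grid position of a vertex. -/
def vpt {W : Type} (x y : W → ℤ) (w : W) : Pt := (4 * (x w : ℝ), 4 * (y w : ℝ))

/-- the points of the polyline -/
def pts {W : Type} (x y : W → ℤ) : Ed W → List Pt
  | .S u v => [vpt x y u, vpt x y v]
  | .L u v => [vpt x y u, (4 * (x v : ℝ), 4 * (y u : ℝ)), vpt x y v]
  | .H u v e => [vpt x y u, (4 * (x v : ℝ) + (e : ℝ), 4 * (y u : ℝ)), vpt x y v]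
  | .V u v e => [vpt x y u, (4 * (x u : ℝ), 4 * (y v : ℝ) + (e : ℝ)), vpt x y v]

/-! ### parts -/
inductive Kind | hor | ver | steep | shal | str

/-- `q` lies on a part of given kind of `e` -/
def OnHor {W : Type} (x y : W → ℤ) (e : Ed W) (q : Pt) : Prop :=
  ∃ c d δ, e.hor = some (c, d, δ) ∧ q.2 = 4 * (y c : ℝ) ∧
    ∃ s : ℝ, 0 ≤ s ∧ s ≤ 1 ∧ q.1 = 4 * (x c : ℝ) + s * (4 * (x d : ℝ) + δ - 4 * (x c : ℝ))
def OnVer {W : Type} (x y : W → ℤ) (e : Ed W) (q : Pt) : Prop :=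
  ∃ c d δ, e.ver = some (c, d, δ) ∧ q.1 = 4 * (x c : ℝ) ∧
    ∃ s : ℝ, 0 ≤ s ∧ s ≤ 1 ∧ q.2 = 4 * (y c : ℝ) + s * (4 * (y d : ℝ) + δ - 4 * (y c : ℝ))
def OnSteep {W : Type} (x y : W → ℤ) (e : Ed W) (q : Pt) : Prop :=
  ∃ u v ε, e.steep = some (u, v, ε) ∧ ∃ s : ℝ, 0 ≤ s ∧ s ≤ 1 ∧
    q.1 = 4 * (x v : ℝ) + ε * s ∧ q.2 = 4 * (y v : ℝ) + s * (4 * (y u : ℝ) - 4 * (y v : ℝ))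
def OnShal {W : Type} (x y : W → ℤ) (e : Ed W) (q : Pt) : Prop :=
  ∃ u v ε, e.shal = some (u, v, ε) ∧ ∃ s : ℝ, 0 ≤ s ∧ s ≤ 1 ∧
    q.2 = 4 * (y v : ℝ) + ε * s ∧ q.1 = 4 * (x v : ℝ) + s * (4 * (x u : ℝ) - 4 * (x v : ℝ))
def OnStr {W : Type} (x y : W → ℤ) (e : Ed W) (q : Pt) : Prop :=
  ∃ u v, e.str = some (u, v) ∧ ∃ s : ℝ, 0 ≤ s ∧ s ≤ 1 ∧
    q.1 = 4 * (x u : ℝ) + s * (4 * (x v : ℝ) - 4 * (x u : ℝ)) ∧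
    q.2 = 4 * (y u : ℝ) + s * (4 * (y v : ℝ) - 4 * (y u : ℝ))

/-- a segment that is a part of `e`, with its type -/
def SegHor (s : Pt × Pt) : Prop := s.1.2 = s.2.2
def SegVer (s : Pt × Pt) : Prop := s.1.1 = s.2.1

lemma mem_seg {a b q : Pt} (h : q ∈ segment ℝ a b) :
    ∃ s : ℝ, 0 ≤ s ∧ s ≤ 1 ∧ q.1 = a.1 + s * (b.1 - a.1) ∧ q.2 = a.2 + s * (b.2 - a.2) := by
  rw [segment_eq_image'] at h
  obtain ⟨s, ⟨h0, h1⟩, rfl⟩ := h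
  exact ⟨s, h0, h1, by simp, by simp⟩

/-- classification of points on segments -/
lemma classify {W : Type} (x y : W → ℤ) (e : Ed W) (s : Pt × Pt) (hs : s ∈ polySegs (pts x y e))
    (q : Pt) (hq : q ∈ segment ℝ s.1 s.2) :
    (OnHor x y e q ∧ SegHor s) ∨ (OnVer x y e q ∧ SegVer s) ∨ OnSteep x y e q ∨
      OnShal x y e q ∨ OnStr x y e q := by
  obtain ⟨t, h0, h1, e1, e2⟩ := mem_seg hq
  cases e with
  | S u v =>
    simp [polySegs, pts, vpt] at hs
    subst hs
    right; right; right; right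
    exact ⟨u, v, rfl, t, h0, h1, by simpa using e1, by simpa using e2⟩
  | L u v =>
    simp [polySegs, pts, vpt] at hs
    rcases hs with rfl | rfl
    · left
      refine ⟨⟨u, v, 0, rfl, by simpa using e2, t, h0, h1, by simpa using e1⟩, rfl⟩
    · right; left
      refine ⟨⟨v, u, 0, rfl, by simpa using e1, 1 - t, by linarith, by linarith, ?_⟩, rfl⟩
      simp at e2; push_cast; rw [e2]; ring
  | H u v e =>
    simp [polySegs, pts, vpt] at hs
    rcases hs with rfl | rfl
    · left
      refine ⟨⟨u, v, e, rfl, by simpa using e2, t, h0, h1, by simpa using e1⟩, rfl⟩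
    · right; right; left
      refine ⟨u, v, e, rfl, 1 - t, by linarith, by linarith, ?_, ?_⟩
      · simp at e1; rw [e1]; ring
      · simp at e2; rw [e2]; ring
  | V u v e =>
    simp [polySegs, pts, vpt] at hs
    rcases hs with rfl | rfl
    · right; left
      refine ⟨⟨u, v, e, rfl, by simpa using e1, t, h0, h1, by simpa using e2⟩, rfl⟩
    · right; right; right; left
      refine ⟨u, v, e, rfl, 1 - t, by linarith, by linarith, ?_, ?_⟩
      · simp at e2; rw [e2]; ring
      · simp at e1; rw [e1]; ring
end

section
/-! ### numeric lemmas -/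
lemma int_lt_real {a b : ℤ} (h : a < b) : (a : ℝ) + 1 ≤ b := by exact_mod_cast h

lemma near_eq {a b : ℤ} {t : ℝ} (h : 4 * (a : ℝ) = 4 * b + t) (h1 : -1 ≤ t) (h2 : t ≤ 1) :
    a = b := by
  rcases lt_trichotomy a b with h' | h' | h'
  · have := int_lt_real h'; linarith
  · exact h'
  · have := int_lt_real h'; linarith

lemma real_eq {a b : ℤ} (h : 4 * (a : ℝ) = 4 * b) : a = b :=
  near_eq (t := 0) (by linarith) (by norm_num) (by norm_num)

lemma eps_real {e : ℤ} (h : e = 1 ∨ e = -1) : (e : ℝ) = 1 ∨ (e : ℝ) = -1 := by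
  rcases h with rfl | rfl <;> simp

lemma num_hh {a b b' : ℤ} {δ δ' : ℝ} (hd : -1 ≤ δ ∧ δ ≤ 1) (hd' : -1 ≤ δ' ∧ δ' ≤ 1)
    (h : (b < a ∧ a < b') ∨ (b' < a ∧ a < b)) {s s' q : ℝ} (hs : 0 ≤ s) (hs' : 0 ≤ s')
    (e1 : q = 4 * (a : ℝ) + s * (4 * (b : ℝ) + δ - 4 * a))
    (e2 : q = 4 * (a : ℝ) + s' * (4 * (b' : ℝ) + δ' - 4 * a)) : q = 4 * a := by
  rcases h with ⟨h1, h2⟩ | ⟨h1, h2⟩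
  · have := int_lt_real h1; have := int_lt_real h2
    nlinarith
  · have := int_lt_real h1; have := int_lt_real h2
    nlinarith

/-- steep part against horizontal part -/
lemma num_steep_hor {yu yv yc xv xc xd xu ε δ : ℤ} (hε : ε = 1 ∨ ε = -1)
    (hδ : (-1 : ℝ) ≤ δ ∧ (δ : ℝ) ≤ 1)
    (hav : (yu < yc ∧ yc < yv) ∨ (yv < yc ∧ yc < yu) →
      Avoid (4 * xc) (4 * xd + δ) (4 * xv) ε)
    (h1 : yc = yu → xc = xu ∧ ((xv < xu ∧ xu < xd) ∨ (xd < xu ∧ xu < xv)))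
    {s t q1 q2 : ℝ} (s0 : 0 ≤ s) (s1 : s ≤ 1) (t0 : 0 ≤ t) (t1 : t ≤ 1)
    (e1 : q1 = 4 * (xv : ℝ) + ε * s) (e2 : q2 = 4 * (yv : ℝ) + s * (4 * (yu : ℝ) - 4 * yv))
    (e3 : q2 = 4 * (yc : ℝ)) (e4 : q1 = 4 * (xc : ℝ) + t * (4 * (xd : ℝ) + δ - 4 * xc)) :
    s = 0 ∨ yu = yv := by
  by_contra hcon
  push Not at hcon
  obtain ⟨hs, huv⟩ := hcon
  have spos : 0 < s := lt_of_le_of_ne s0 (Ne.symm hs)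
  by_cases hcu : yc = yu
  · obtain ⟨rfl, h⟩ := h1 hcu
    have he := eps_real hε
    rcases h with ⟨h2, h3⟩ | ⟨h2, h3⟩
    · have := int_lt_real h2; have := int_lt_real h3
      have : 0 ≤ t * (4 * (xd : ℝ) + δ - 4 * xc) := mul_nonneg t0 (by linarith)
      rcases he with he | he <;> rw [he] at e1 <;> linarith
    · have := int_lt_real h2; have := int_lt_real h3
      have : 0 ≤ t * (4 * (xc : ℝ) - (4 * (xd : ℝ) + δ)) := mul_nonneg t0 (by linarith)
      rcases he with he | he <;> rw [he] at e1 <;> linarith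
  · have slt : s < 1 := by
      rcases lt_or_eq_of_le s1 with h | h
      · exact h
      · exfalso; subst h; apply hcu; apply real_eq; linarith
    have hb : (yu < yc ∧ yc < yv) ∨ (yv < yc ∧ yc < yu) := by
      rcases lt_or_gt_of_ne huv with h | h
      · left
        have := int_lt_real h
        constructor
        · have : (yu : ℝ) < yc := by nlinarith
          exact_mod_cast this
        · have : (yc : ℝ) < yv := by nlinarith
          exact_mod_cast this
      · right
        have := int_lt_real h
        constructor
        · have : (yv : ℝ) < yc := by nlinarith
          exact_mod_cast this
        · have : (yc : ℝ) < yu := by nlinarith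
          exact_mod_cast this
    have hconv : ∀ m M : ℝ, m ≤ 4 * (xc : ℝ) → m ≤ 4 * (xd : ℝ) + δ → m ≤ q1 := by
      intro m M h1 h2; nlinarith
    have hconv' : ∀ m M : ℝ, 4 * (xc : ℝ) ≤ m → 4 * (xd : ℝ) + δ ≤ m → q1 ≤ m := by
      intro m M h1 h2; nlinarith
    rcases hav hb with ⟨rfl, ⟨a1, a2⟩ | ⟨a1, a2⟩⟩ | ⟨rfl, ⟨a1, a2⟩ | ⟨a1, a2⟩⟩
    · have := hconv' (4 * xv) 0 (by exact_mod_cast a1) (by exact_mod_cast a2)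
      push_cast at e1; linarith
    · have := hconv (4 * xv + 1) 0 (by exact_mod_cast a1) (by exact_mod_cast a2)
      push_cast at e1; linarith
    · have := hconv (4 * xv) 0 (by exact_mod_cast a1) (by exact_mod_cast a2)
      push_cast at e1; linarith
    · have := hconv' (4 * xv - 1) 0 (by exact_mod_cast a1) (by exact_mod_cast a2)
      push_cast at e1; linarith

lemma num_steep_near {ε : ℤ} (hε : ε = 1 ∨ ε = -1) {s : ℝ} (s0 : 0 ≤ s) (s1 : s ≤ 1) :
    -1 ≤ (ε : ℝ) * s ∧ (ε : ℝ) * s ≤ 1 := by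
  rcases eps_real hε with h | h <;> rw [h] <;> constructor <;> linarith

lemma num_eps_zero {ε : ℤ} (hε : ε = 1 ∨ ε = -1) {s : ℝ} (h : (ε : ℝ) * s = 0) : s = 0 := by
  rcases eps_real hε with h' | h' <;> rw [h'] at h <;> linarith

lemma num_steep_steep {ε ε' a b c : ℤ} (hε : ε = 1 ∨ ε = -1) (hε' : ε' = 1 ∨ ε' = -1) {s s' : ℝ}
    (s0 : 0 ≤ s) (s0' : 0 ≤ s') (h : (ε : ℝ) * s = ε' * s')
    (h2 : s * (4 * (a : ℝ) - 4 * b) = s' * (4 * (c : ℝ) - 4 * b)) : s = 0 ∨ a = c := by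
  have hs : s = s' := by
    rcases eps_real hε with h1 | h1 <;> rcases eps_real hε' with h3 | h3 <;>
      rw [h1, h3] at h <;> linarith
  subst hs
  by_cases h0 : s = 0
  · exact Or.inl h0
  · right
    have := mul_left_cancel₀ h0 h2
    apply real_eq; linarith

lemma num_steep_shal_same {ε ε' xu xv yu yv : ℤ} (hε : ε = 1 ∨ ε = -1) (hε' : ε' = 1 ∨ ε' = -1)
    {s s' : ℝ} (s0 : 0 ≤ s) (s0' : 0 ≤ s') (hy : yu ≠ yv)
    (h1 : (ε : ℝ) * s = s' * (4 * (xu : ℝ) - 4 * xv)) (hx : xu ≠ xv)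
    (h2 : s * (4 * (yu : ℝ) - 4 * yv) = ε' * s') : s = 0 := by
  have A : 4 * s' ≤ s := by
    rcases lt_or_gt_of_ne hx with h | h <;> have := int_lt_real h <;>
    rcases eps_real hε with h' | h' <;> rw [h'] at h1 <;> nlinarith
  have B : 4 * s ≤ s' := by
    rcases lt_or_gt_of_ne hy with h | h <;> have := int_lt_real h <;>
    rcases eps_real hε' with h' | h' <;> rw [h'] at h2 <;> nlinarith
  linarith

lemma num_out {ε a b c : ℤ} (hε : ε = 1 ∨ ε = -1) {s s' : ℝ} (s0 : 0 ≤ s) (s1 : s ≤ 1)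
    (s0' : 0 ≤ s') (s1' : s' ≤ 1) (ho : Out a b c)
    (h : 4 * (a : ℝ) + ε * s = 4 * (c : ℝ) + s' * (4 * (b : ℝ) - 4 * c)) : False := by
  obtain ⟨n1, n2⟩ := num_steep_near hε s0 s1
  rcases ho with ⟨h1, h2⟩ | ⟨h1, h2⟩ <;> have := int_lt_real h1 <;> have := int_lt_real h2 <;>
    nlinarith

/-- unit step against a grid coordinate -/
lemma num_str {a b c : ℤ} (hab : a = b + 1 ∨ b = a + 1) {s : ℝ} (s0 : 0 ≤ s) (s1 : s ≤ 1)
    (h : 4 * (c : ℝ) = 4 * (a : ℝ) + s * (4 * (b : ℝ) - 4 * a)) :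
    (c = a ∧ s = 0) ∨ (c = b ∧ s = 1) := by
  rcases hab with h' | h'
  · have e : (a : ℝ) = b + 1 := by exact_mod_cast h'
    have l1 : (c : ℝ) ≤ a := by nlinarith
    have l2 : (b : ℝ) ≤ c := by nlinarith
    have l1' : c ≤ a := by exact_mod_cast l1
    have l2' : b ≤ c := by exact_mod_cast l2
    have : c = a ∨ c = b := by omega
    rcases this with rfl | rfl
    · left; refine ⟨rfl, ?_⟩; nlinarith
    · right; refine ⟨rfl, ?_⟩; nlinarith
  · have e : (b : ℝ) = a + 1 := by exact_mod_cast h'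
    have l1 : (c : ℝ) ≤ b := by nlinarith
    have l2 : (a : ℝ) ≤ c := by nlinarith
    have l1' : c ≤ b := by exact_mod_cast l1
    have l2' : a ≤ c := by exact_mod_cast l2
    have : c = a ∨ c = b := by omega
    rcases this with rfl | rfl
    · left; refine ⟨rfl, ?_⟩; nlinarith
    · right; refine ⟨rfl, ?_⟩; nlinarith

lemma num_str_near {a b c : ℤ} (hab : a = b + 1 ∨ b = a + 1) {s t : ℝ} (s0 : 0 ≤ s) (s1 : s ≤ 1)
    (ht : -1 ≤ t) (ht' : t ≤ 1)
    (h : 4 * (c : ℝ) + t = 4 * (a : ℝ) + s * (4 * (b : ℝ) - 4 * a)) : c = a ∨ c = b := by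
  rcases hab with h' | h'
  · have e : (a : ℝ) = b + 1 := by exact_mod_cast h'
    have l1 : (c : ℝ) < a + 1 := by nlinarith
    have l2 : (b : ℝ) < c + 1 := by nlinarith
    have l1' : c < a + 1 := by exact_mod_cast l1
    have l2' : b < c + 1 := by exact_mod_cast l2
    omega
  · have e : (b : ℝ) = a + 1 := by exact_mod_cast h'
    have l1 : (c : ℝ) < b + 1 := by nlinarith
    have l2 : (a : ℝ) < c + 1 := by nlinarith
    have l1' : c < b + 1 := by exact_mod_cast l1
    have l2' : a < c + 1 := by exact_mod_cast l2
    omega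

/-- unit diagonal against a steep part starting at the same vertex -/
lemma num_str_steep {ax bx ay by' uy ε : ℤ} (hx : ax = bx + 1 ∨ bx = ax + 1)
    (hy : ay = by' + 1 ∨ by' = ay + 1) (hε : ε = 1 ∨ ε = -1) (hu : uy ≠ ay) {s t : ℝ}
    (s0 : 0 ≤ s) (t0 : 0 ≤ t)
    (h1 : (ε : ℝ) * t = s * (4 * (bx : ℝ) - 4 * ax))
    (h2 : t * (4 * (uy : ℝ) - 4 * ay) = s * (4 * (by' : ℝ) - 4 * ay)) : t = 0 := by
  have A : 4 * s = t := by
    rcases hx with h | h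
    · have e : (ax : ℝ) = bx + 1 := by exact_mod_cast h
      rw [e] at h1
      rcases eps_real hε with h' | h' <;> rw [h'] at h1 <;> linarith
    · have e : (bx : ℝ) = ax + 1 := by exact_mod_cast h
      rw [e] at h1
      rcases eps_real hε with h' | h' <;> rw [h'] at h1 <;> linarith
  have B : 4 * t ≤ 4 * s := by
    rcases lt_or_gt_of_ne hu with h | h <;> have := int_lt_real h <;>
    rcases hy with h' | h'
    · have e : (ay : ℝ) = by' + 1 := by exact_mod_cast h'
      nlinarith
    · have e : (by' : ℝ) = ay + 1 := by exact_mod_cast h'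
      nlinarith
    · have e : (ay : ℝ) = by' + 1 := by exact_mod_cast h'
      nlinarith
    · have e : (by' : ℝ) = ay + 1 := by exact_mod_cast h'
      nlinarith
  linarith
end

section
variable {W : Type}

def Unit4 (x y : W → ℤ) (e : Ed W) : Prop := ∀ u v, e.str = some (u, v) →
  (x u = x v + 1 ∨ x v = x u + 1) ∧ (y u = y v + 1 ∨ y v = y u + 1)

lemma hor_facts {x y : W → ℤ} {e : Ed W} (hv : Valid x y e) {c d δ} (h : e.hor = some (c, d, δ)) :
    c ∈ e.ends ∧ (-1 : ℝ) ≤ δ ∧ (δ : ℝ) ≤ 1 := by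
  cases e <;> simp [Ed.hor, Ed.ends, Valid] at *
  · obtain ⟨rfl, rfl, rfl⟩ := h; simp
  · obtain ⟨rfl, rfl, rfl⟩ := h; rcases hv.2 with h | h <;> rw [h] <;> simp

lemma ver_facts {x y : W → ℤ} {e : Ed W} (hv : Valid x y e) {c d δ} (h : e.ver = some (c, d, δ)) :
    c ∈ e.ends ∧ (-1 : ℝ) ≤ δ ∧ (δ : ℝ) ≤ 1 := by
  cases e <;> simp [Ed.ver, Ed.ends, Valid] at *
  · obtain ⟨rfl, rfl, rfl⟩ := h; simp
  · obtain ⟨rfl, rfl, rfl⟩ := h; rcases hv.2 with h | h <;> rw [h] <;> simp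

lemma steep_facts {x y : W → ℤ} {e : Ed W} (hv : Valid x y e) {u v ε}
    (h : e.steep = some (u, v, ε)) :
    e.hor = some (u, v, ε) ∧ (ε = 1 ∨ ε = -1) ∧ u ≠ v ∧ e.ends = s(u, v) := by
  cases e <;> simp [Ed.steep, Ed.hor, Ed.ends, Valid] at *
  obtain ⟨rfl, rfl, rfl⟩ := h; simp [hv]

lemma shal_facts {x y : W → ℤ} {e : Ed W} (hv : Valid x y e) {u v ε}
    (h : e.shal = some (u, v, ε)) :
    e.ver = some (u, v, ε) ∧ (ε = 1 ∨ ε = -1) ∧ u ≠ v ∧ e.ends = s(u, v) := by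
  cases e <;> simp [Ed.shal, Ed.ver, Ed.ends, Valid] at *
  obtain ⟨rfl, rfl, rfl⟩ := h; simp [hv]

lemma str_facts {e : Ed W} {u v} (h : e.str = some (u, v)) : e.ends = s(u, v) := by
  cases e <;> simp [Ed.str, Ed.ends] at *
  obtain ⟨rfl, rfl⟩ := h; simp

def Meet (x y : W → ℤ) (e e' : Ed W) (q : Pt) : Prop :=
  ∃ w, w ∈ e.ends ∧ w ∈ e'.ends ∧ q = vpt x y w

lemma Meet.symm {x y : W → ℤ} {e e' : Ed W} {q : Pt} (h : Meet x y e e' q) : Meet x y e' e q := by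
  obtain ⟨w, h1, h2, h3⟩ := h; exact ⟨w, h2, h1, h3⟩

/-- all that is known about two distinct edges -/
structure PairOK (x y : W → ℤ) (e e' : Ed W) : Prop where
  hx : Function.Injective x
  hy : Function.Injective y
  v : Valid x y e
  v' : Valid x y e'
  s : Unit4 x y e
  s' : Unit4 x y e'
  ne : e.ends ≠ e'.ends
  c : Compat x y e e'
  c' : Compat x y e' e

lemma PairOK.symm {x y : W → ℤ} {e e' : Ed W} (h : PairOK x y e e') : PairOK x y e' e :=
  ⟨h.hx, h.hy, h.v', h.v, h.s', h.s, h.ne.symm, h.c', h.c⟩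

variable {x y : W → ℤ} {e e' : Ed W} {q : Pt}

lemma vpt_ext {w : W} (h1 : q.1 = 4 * (x w : ℝ)) (h2 : q.2 = 4 * (y w : ℝ)) : q = vpt x y w :=
  Prod.ext h1 h2

lemma p_hh (h : PairOK x y e e') (a : OnHor x y e q) (b : OnHor x y e' q) : Meet x y e e' q := by
  obtain ⟨c, d, δ, hc, e2, s, s0, s1, e1⟩ := a
  obtain ⟨c', d', δ', hc', e2', s', s0', s1', e1'⟩ := b
  have : c = c' := h.hy (real_eq (by rw [← e2, ← e2']))
  subst this
  have f := hor_facts h.v hc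
  have f' := hor_facts h.v' hc'
  exact ⟨c, f.1, f'.1, vpt_ext (num_hh f.2 f'.2 (h.c.c1 _ _ _ _ _ hc hc') s0 s0' e1 e1') e2⟩

lemma p_vv (h : PairOK x y e e') (a : OnVer x y e q) (b : OnVer x y e' q) : Meet x y e e' q := by
  obtain ⟨c, d, δ, hc, e2, s, s0, s1, e1⟩ := a
  obtain ⟨c', d', δ', hc', e2', s', s0', s1', e1'⟩ := b
  have : c = c' := h.hx (real_eq (by rw [← e2, ← e2']))
  subst this
  have f := ver_facts h.v hc
  have f' := ver_facts h.v' hc'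
  exact ⟨c, f.1, f'.1, vpt_ext e2 (num_hh f.2 f'.2 (h.c.c2 _ _ _ _ _ hc hc') s0 s0' e1 e1')⟩

lemma num_out_seg {a b c δ : ℤ} (ho : Out (4 * a) (4 * b) (4 * c + δ)) {s : ℝ} (s0 : 0 ≤ s)
    (s1 : s ≤ 1) (h : 4 * (a : ℝ) = 4 * (b : ℝ) + s * (4 * (c : ℝ) + δ - 4 * b)) : False := by
  rcases ho with ⟨h1, h2⟩ | ⟨h1, h2⟩
  · have := int_lt_real h1; have := int_lt_real h2
    push_cast at *
    nlinarith
  · have := int_lt_real h1; have := int_lt_real h2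
    push_cast at *
    nlinarith

lemma p_hv (h : PairOK x y e e') (a : OnHor x y e q) (b : OnVer x y e' q) :
    Meet x y e e' q ∨ ¬ ∃ w, w ∈ e.ends ∧ w ∈ e'.ends := by
  obtain ⟨c, d, δ, hc, e2, s, s0, s1, e1⟩ := a
  obtain ⟨c', d', δ', hc', e2', s', s0', s1', e1'⟩ := b
  have f := hor_facts h.v hc
  have f' := ver_facts h.v' hc'
  by_cases hw : ∃ w, w ∈ e.ends ∧ w ∈ e'.ends
  · left
    by_cases hcc : c = c'
    · subst hcc
      exact ⟨c, f.1, f'.1, vpt_ext e2' e2⟩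
    · exfalso
      rcases h.c.c6 _ _ _ _ _ _ hw hc hc' hcc with ho | ho
      · exact num_out_seg ho s0 s1 (by rw [← e2', e1])
      · exact num_out_seg ho s0' s1' (by rw [← e2, e1'])
  · exact Or.inr hw

lemma p_th (h : PairOK x y e e') (a : OnSteep x y e q) (b : OnHor x y e' q) :
    Meet x y e e' q := by
  obtain ⟨u, v, ε, hc, s, s0, s1, e1, e2⟩ := a
  obtain ⟨c', d', δ', hc', e2', s', s0', s1', e1'⟩ := b
  obtain ⟨fh, fε, fne, fe⟩ := steep_facts h.v hc
  have f' := hor_facts h.v' hc'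
  have key := num_steep_hor (yu := y u) (yv := y v) (yc := y c') (xv := x v) (xc := x c')
    (xd := x d') (xu := x u) fε f'.2 (h.c.c3 _ _ _ _ _ _ hc hc') (by
      intro hyy
      have := h.hy hyy
      subst this
      exact ⟨rfl, h.c.c1 _ _ _ _ _ fh hc'⟩) s0 s1 s0' s1' e1 e2 e2' e1'
  have s00 : s = 0 := key.resolve_right (fun h' => fne (h.hy h'))
  subst s00
  have : c' = v := h.hy (real_eq (by rw [← e2', e2]; ring))
  subst this
  exact ⟨c', by rw [fe]; simp, f'.1, vpt_ext (by rw [e1]; ring) e2'⟩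

lemma p_sv (h : PairOK x y e e') (a : OnShal x y e q) (b : OnVer x y e' q) :
    Meet x y e e' q := by
  obtain ⟨u, v, ε, hc, s, s0, s1, e1, e2⟩ := a
  obtain ⟨c', d', δ', hc', e2', s', s0', s1', e1'⟩ := b
  obtain ⟨fh, fε, fne, fe⟩ := shal_facts h.v hc
  have f' := ver_facts h.v' hc'
  have key := num_steep_hor (yu := x u) (yv := x v) (yc := x c') (xv := y v) (xc := y c')
    (xd := y d') (xu := y u) fε f'.2 (h.c.c4 _ _ _ _ _ _ hc hc') (by
      intro hyy
      have := h.hx hyy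
      subst this
      exact ⟨rfl, h.c.c2 _ _ _ _ _ fh hc'⟩) s0 s1 s0' s1' e1 e2 e2' e1'
  have s00 : s = 0 := key.resolve_right (fun h' => fne (h.hx h'))
  subst s00
  have : c' = v := h.hx (real_eq (by rw [← e2', e2]; ring))
  subst this
  exact ⟨c', by rw [fe]; simp, f'.1, vpt_ext e2' (by rw [e1]; ring)⟩

lemma p_tv (h : PairOK x y e e') (a : OnSteep x y e q) (b : OnVer x y e' q) :
    Meet x y e e' q := by
  obtain ⟨u, v, ε, hc, s, s0, s1, e1, e2⟩ := a
  obtain ⟨c', d', δ', hc', e2', s', s0', s1', e1'⟩ := b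
  obtain ⟨fh, fε, fne, fe⟩ := steep_facts h.v hc
  have f' := ver_facts h.v' hc'
  have n := num_steep_near fε s0 s1
  have h1 : 4 * (x c' : ℝ) = 4 * (x v : ℝ) + ε * s := by rw [← e2', e1]
  have : c' = v := h.hx (near_eq h1 n.1 n.2)
  subst this
  have : s = 0 := num_eps_zero fε (by linarith)
  subst this
  exact ⟨c', by rw [fe]; simp, f'.1, vpt_ext e2' (by rw [e2]; ring)⟩

lemma p_sh (h : PairOK x y e e') (a : OnShal x y e q) (b : OnHor x y e' q) :
    Meet x y e e' q := by
  obtain ⟨u, v, ε, hc, s, s0, s1, e1, e2⟩ := a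
  obtain ⟨c', d', δ', hc', e2', s', s0', s1', e1'⟩ := b
  obtain ⟨fh, fε, fne, fe⟩ := shal_facts h.v hc
  have f' := hor_facts h.v' hc'
  have n := num_steep_near fε s0 s1
  have h1 : 4 * (y c' : ℝ) = 4 * (y v : ℝ) + ε * s := by rw [← e2', e1]
  have : c' = v := h.hy (near_eq h1 n.1 n.2)
  subst this
  have : s = 0 := num_eps_zero fε (by linarith)
  subst this
  exact ⟨c', by rw [fe]; simp, f'.1, vpt_ext (by rw [e2]; ring) e2'⟩

lemma p_tt (h : PairOK x y e e') (a : OnSteep x y e q) (b : OnSteep x y e' q) :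
    Meet x y e e' q := by
  obtain ⟨u, v, ε, hc, s, s0, s1, e1, e2⟩ := a
  obtain ⟨u', v', ε', hc', s', s0', s1', e1', e2'⟩ := b
  obtain ⟨fh, fε, fne, fe⟩ := steep_facts h.v hc
  obtain ⟨fh', fε', fne', fe'⟩ := steep_facts h.v' hc'
  have n := num_steep_near fε s0 s1
  have n' := num_steep_near fε' s0' s1'
  have : v = v' := by
    by_contra hvv
    have : x v ≠ x v' := fun hh => hvv (h.hx hh)
    rcases lt_or_gt_of_ne this with hh | hh <;> have := int_lt_real hh <;> linarith
  subst this
  rcases num_steep_steep (a := y u) (b := y v) (c := y u') fε fε' s0 s0' (by linarith) (by linarith)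
    with hh | hh
  · subst hh
    exact ⟨v, by rw [fe]; simp, by rw [fe']; simp, vpt_ext (by rw [e1]; ring) (by rw [e2]; ring)⟩
  · exact absurd (by rw [fe, fe', h.hy hh]) h.ne

lemma p_ss (h : PairOK x y e e') (a : OnShal x y e q) (b : OnShal x y e' q) :
    Meet x y e e' q := by
  obtain ⟨u, v, ε, hc, s, s0, s1, e1, e2⟩ := a
  obtain ⟨u', v', ε', hc', s', s0', s1', e1', e2'⟩ := b
  obtain ⟨fh, fε, fne, fe⟩ := shal_facts h.v hc
  obtain ⟨fh', fε', fne', fe'⟩ := shal_facts h.v' hc'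
  have n := num_steep_near fε s0 s1
  have n' := num_steep_near fε' s0' s1'
  have : v = v' := by
    by_contra hvv
    have : y v ≠ y v' := fun hh => hvv (h.hy hh)
    rcases lt_or_gt_of_ne this with hh | hh <;> have := int_lt_real hh <;> linarith
  subst this
  rcases num_steep_steep (a := x u) (b := x v) (c := x u') fε fε' s0 s0' (by linarith) (by linarith)
    with hh | hh
  · subst hh
    exact ⟨v, by rw [fe]; simp, by rw [fe']; simp, vpt_ext (by rw [e2]; ring) (by rw [e1]; ring)⟩
  · exact absurd (by rw [fe, fe', h.hx hh]) h.ne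

lemma p_ts (h : PairOK x y e e') (a : OnSteep x y e q) (b : OnShal x y e' q) :
    Meet x y e e' q := by
  obtain ⟨u, v, ε, hc, s, s0, s1, e1, e2⟩ := a
  obtain ⟨u', v', ε', hc', s', s0', s1', e1', e2'⟩ := b
  obtain ⟨fh, fε, fne, fe⟩ := steep_facts h.v hc
  obtain ⟨fh', fε', fne', fe'⟩ := shal_facts h.v' hc'
  by_cases hvv : v = v'
  · subst hvv
    have : s = 0 := num_steep_shal_same (xu := x u') (xv := x v) (yu := y u) (yv := y v) fε fε'
      s0 s0' (fun hh => fne (h.hy hh)) (by linarith) (fun hh => fne' (h.hx hh)) (by linarith)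
    subst this
    exact ⟨v, by rw [fe]; simp, by rw [fe']; simp, vpt_ext (by rw [e1]; ring) (by rw [e2]; ring)⟩
  · exfalso
    rcases h.c.c5 _ _ _ _ _ _ hc hc' hvv with ho | ho
    · exact num_out fε s0 s1 s0' s1' ho (by rw [← e1, e2'])
    · exact num_out fε' s0' s1' s0 s1 ho (by rw [← e1', e2])

lemma p_rh (h : PairOK x y e e') (a : OnStr x y e q) (b : OnHor x y e' q) :
    Meet x y e e' q := by
  obtain ⟨u, v, hc, s, s0, s1, e1, e2⟩ := a
  obtain ⟨c', d', δ', hc', e2', s', s0', s1', e1'⟩ := b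
  have fe := str_facts hc
  have f' := hor_facts h.v' hc'
  obtain ⟨ux, uy⟩ := h.s _ _ hc
  rcases num_str uy s0 s1 (by rw [← e2', e2]) with ⟨h1, h2⟩ | ⟨h1, h2⟩
  · have := h.hy h1; subst this; subst h2
    exact ⟨c', by rw [fe]; simp, f'.1, vpt_ext (by rw [e1]; ring) e2'⟩
  · have := h.hy h1; subst this; subst h2
    exact ⟨c', by rw [fe]; simp, f'.1, vpt_ext (by rw [e1]; ring) e2'⟩

lemma p_rv (h : PairOK x y e e') (a : OnStr x y e q) (b : OnVer x y e' q) :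
    Meet x y e e' q := by
  obtain ⟨u, v, hc, s, s0, s1, e1, e2⟩ := a
  obtain ⟨c', d', δ', hc', e2', s', s0', s1', e1'⟩ := b
  have fe := str_facts hc
  have f' := ver_facts h.v' hc'
  obtain ⟨ux, uy⟩ := h.s _ _ hc
  rcases num_str ux s0 s1 (by rw [← e2', e1]) with ⟨h1, h2⟩ | ⟨h1, h2⟩
  · have := h.hx h1; subst this; subst h2
    exact ⟨c', by rw [fe]; simp, f'.1, vpt_ext e2' (by rw [e2]; ring)⟩
  · have := h.hx h1; subst this; subst h2
    exact ⟨c', by rw [fe]; simp, f'.1, vpt_ext e2' (by rw [e2]; ring)⟩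

lemma p_rt (h : PairOK x y e e') (a : OnStr x y e q) (b : OnSteep x y e' q) :
    Meet x y e e' q := by
  obtain ⟨u, v, hc, s, s0, s1, e1, e2⟩ := a
  obtain ⟨u', v', ε', hc', s', s0', s1', e1', e2'⟩ := b
  obtain ⟨fh', fε', fne', fe'⟩ := steep_facts h.v' hc'
  have fe := str_facts hc
  obtain ⟨ux, uy⟩ := h.s _ _ hc
  have n' := num_steep_near fε' s0' s1'
  rcases num_str_near ux s0 s1 n'.1 n'.2 (by rw [← e1', e1]) with h1 | h1
  · have := h.hx h1; subst this
    have : s' = 0 := num_str_steep ux uy fε' (fun hh => fne' (h.hy hh)) s0 s0' (by linarith)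
      (by linarith)
    subst this
    exact ⟨v', by rw [fe]; simp, by rw [fe']; simp, vpt_ext (by rw [e1']; ring)
      (by rw [e2']; ring)⟩
  · have := h.hx h1; subst this
    have : s' = 0 := num_str_steep ux.symm uy.symm fε' (fun hh => fne' (h.hy hh))
      (s := 1 - s) (by linarith) s0' (by linarith) (by linarith)
    subst this
    exact ⟨v', by rw [fe]; simp, by rw [fe']; simp, vpt_ext (by rw [e1']; ring)
      (by rw [e2']; ring)⟩

lemma p_rs (h : PairOK x y e e') (a : OnStr x y e q) (b : OnShal x y e' q) :
    Meet x y e e' q := by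
  obtain ⟨u, v, hc, s, s0, s1, e1, e2⟩ := a
  obtain ⟨u', v', ε', hc', s', s0', s1', e1', e2'⟩ := b
  obtain ⟨fh', fε', fne', fe'⟩ := shal_facts h.v' hc'
  have fe := str_facts hc
  obtain ⟨ux, uy⟩ := h.s _ _ hc
  have n' := num_steep_near fε' s0' s1'
  rcases num_str_near uy s0 s1 n'.1 n'.2 (by rw [← e1', e2]) with h1 | h1
  · have := h.hy h1; subst this
    have : s' = 0 := num_str_steep uy ux fε' (fun hh => fne' (h.hx hh)) s0 s0' (by linarith)
      (by linarith)
    subst this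
    exact ⟨v', by rw [fe]; simp, by rw [fe']; simp, vpt_ext (by rw [e2']; ring)
      (by rw [e1']; ring)⟩
  · have := h.hy h1; subst this
    have : s' = 0 := num_str_steep uy.symm ux.symm fε' (fun hh => fne' (h.hx hh))
      (s := 1 - s) (by linarith) s0' (by linarith) (by linarith)
    subst this
    exact ⟨v', by rw [fe]; simp, by rw [fe']; simp, vpt_ext (by rw [e2']; ring)
      (by rw [e1']; ring)⟩

/-- two unit intervals meeting -/
lemma num_rr {a b c d : ℤ} (h1 : a = b + 1 ∨ b = a + 1) (h2 : c = d + 1 ∨ d = c + 1) {s t : ℝ}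
    (s0 : 0 ≤ s) (s1 : s ≤ 1) (t0 : 0 ≤ t) (t1 : t ≤ 1)
    (h : 4 * (a : ℝ) + s * (4 * (b : ℝ) - 4 * a) = 4 * (c : ℝ) + t * (4 * (d : ℝ) - 4 * c)) :
    (a = c ∧ b = d) ∨ (a = d ∧ b = c) ∨
      ∃ m : ℤ, 4 * (m : ℝ) = 4 * (a : ℝ) + s * (4 * (b : ℝ) - 4 * a) := by
  have key : ∀ (m n : ℤ) (q : ℝ), 4 * (m : ℝ) ≤ q → q ≤ 4 * m + 4 → 4 * (n : ℝ) ≤ q →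
      q ≤ 4 * n + 4 → m = n ∨ ∃ k : ℤ, 4 * (k : ℝ) = q := by
    intro m n q a1 a2 a3 a4
    rcases lt_trichotomy m n with h | h | h
    · have := int_lt_real h
      exact Or.inr ⟨n, by linarith⟩
    · exact Or.inl h
    · have := int_lt_real h
      exact Or.inr ⟨m, by linarith⟩
  obtain ⟨q, hq⟩ : ∃ q : ℝ, q = 4 * (a : ℝ) + s * (4 * (b : ℝ) - 4 * a) := ⟨_, rfl⟩
  rw [← hq] at h ⊢
  rcases h1 with rfl | rfl <;> rcases h2 with rfl | rfl <;> push_cast at h hq ⊢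
  · rcases key b d q (by linarith) (by linarith) (by linarith) (by linarith) with hh | hh
    · left; omega
    · right; right; exact hh
  · rcases key b c q (by linarith) (by linarith) (by linarith) (by linarith) with hh | hh
    · right; left; omega
    · right; right; exact hh
  · rcases key a d q (by linarith) (by linarith) (by linarith) (by linarith) with hh | hh
    · right; left; omega
    · right; right; exact hh
  · rcases key a c q (by linarith) (by linarith) (by linarith) (by linarith) with hh | hh
    · left; omega
    · right; right; exact hh

lemma p_rr (h : PairOK x y e e') (a : OnStr x y e q) (b : OnStr x y e' q) :
    Meet x y e e' q := by
  obtain ⟨u, v, hc, s, s0, s1, e1, e2⟩ := a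
  obtain ⟨u', v', hc', s', s0', s1', e1', e2'⟩ := b
  have fe := str_facts hc
  have fe' := str_facts hc'
  obtain ⟨ux, uy⟩ := h.s _ _ hc
  obtain ⟨ux', uy'⟩ := h.s' _ _ hc'
  rcases num_rr ux ux' s0 s1 s0' s1' (by rw [← e1, e1']) with ⟨h1, h2⟩ | ⟨h1, h2⟩ | ⟨m, hm⟩
  · exact absurd (by rw [fe, fe', h.hx h1, h.hx h2]) h.ne
  · exact absurd (by rw [fe, fe', h.hx h1, h.hx h2, Sym2.eq_swap]) h.ne
  · have A : ∃ w, w ∈ e.ends ∧ x w = m ∧ q = vpt x y w := by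
      rcases num_str ux s0 s1 hm with ⟨h1, h2⟩ | ⟨h1, h2⟩
      · exact ⟨u, by rw [fe]; simp, h1.symm, vpt_ext (by rw [e1, h2]; ring) (by rw [e2, h2]; ring)⟩
      · exact ⟨v, by rw [fe]; simp, h1.symm, vpt_ext (by rw [e1, h2]; ring) (by rw [e2, h2]; ring)⟩
    have B : ∃ w, w ∈ e'.ends ∧ x w = m ∧ q = vpt x y w := by
      rcases num_str ux' s0' s1' (c := m) (by rw [hm, ← e1, e1']) with ⟨h1, h2⟩ | ⟨h1, h2⟩
      · exact ⟨u', by rw [fe']; simp, h1.symm, vpt_ext (by rw [e1', h2]; ring)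
          (by rw [e2', h2]; ring)⟩
      · exact ⟨v', by rw [fe']; simp, h1.symm, vpt_ext (by rw [e1', h2]; ring)
          (by rw [e2', h2]; ring)⟩
    obtain ⟨w, a1, a2, a3⟩ := A
    obtain ⟨w', b1, b2, b3⟩ := B
    have := h.hx (a2.trans b2.symm)
    subst this
    exact ⟨w, a1, b1, a3⟩

/-- The main pairwise statement. -/
lemma pair_main (h : PairOK x y e e') {s s' : Pt × Pt} (hs : s ∈ polySegs (pts x y e))
    (hs' : s' ∈ polySegs (pts x y e')) (hq : q ∈ segment ℝ s.1 s.2) (hq' : q ∈ segment ℝ s'.1 s'.2) :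
    Meet x y e e' q ∨ ((¬ ∃ w, w ∈ e.ends ∧ w ∈ e'.ends) ∧
      ((OnHor x y e q ∧ SegHor s ∧ OnVer x y e' q ∧ SegVer s') ∨
       (OnVer x y e q ∧ SegVer s ∧ OnHor x y e' q ∧ SegHor s'))) := by
  have h' := h.symm
  rcases classify x y e s hs q hq with ⟨a, sa⟩ | ⟨a, sa⟩ | a | a | a <;>
  rcases classify x y e' s' hs' q hq' with ⟨b, sb⟩ | ⟨b, sb⟩ | b | b | b
  · exact Or.inl (p_hh h a b)
  · rcases p_hv h a b with c | c
    · exact Or.inl c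
    · exact Or.inr ⟨c, Or.inl ⟨a, sa, b, sb⟩⟩
  · exact Or.inl (p_th h' b a).symm
  · exact Or.inl (p_sh h' b a).symm
  · exact Or.inl (p_rh h' b a).symm
  · rcases p_hv h' b a with c | c
    · exact Or.inl c.symm
    · refine Or.inr ⟨fun ⟨w, w1, w2⟩ => c ⟨w, w2, w1⟩, Or.inr ⟨a, sa, b, sb⟩⟩
  · exact Or.inl (p_vv h a b)
  · exact Or.inl (p_tv h' b a).symm
  · exact Or.inl (p_sv h' b a).symm
  · exact Or.inl (p_rv h' b a).symm
  · exact Or.inl (p_th h a b)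
  · exact Or.inl (p_tv h a b)
  · exact Or.inl (p_tt h a b)
  · exact Or.inl (p_ts h a b)
  · exact Or.inl (p_rt h' b a).symm
  · exact Or.inl (p_sh h a b)
  · exact Or.inl (p_sv h a b)
  · exact Or.inl (p_ts h' b a).symm
  · exact Or.inl (p_ss h a b)
  · exact Or.inl (p_rs h' b a).symm
  · exact Or.inl (p_rh h a b)
  · exact Or.inl (p_rv h a b)
  · exact Or.inl (p_rt h a b)
  · exact Or.inl (p_rs h a b)
  · exact Or.inl (p_rr h a b)

lemma mem_polySet {l : List Pt} : q ∈ polySet l ↔ ∃ s ∈ polySegs l, q ∈ segment ℝ s.1 s.2 := by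
  simp [polySet]

/-- candidate crossing points -/
def crossPts (x y : W → ℤ) (e e' : Ed W) : Set Pt :=
  vpt x y '' {w | w ∈ e.ends} ∪ {q | OnHor x y e q ∧ OnVer x y e' q} ∪
    {q | OnVer x y e q ∧ OnHor x y e' q}

lemma hv_finite (x y : W → ℤ) (e e' : Ed W) : {q | OnHor x y e q ∧ OnVer x y e' q}.Finite := by
  rcases Set.eq_empty_or_nonempty {q | OnHor x y e q ∧ OnVer x y e' q} with h | ⟨p, hp⟩
  · rw [h]; exact Set.finite_empty
  · apply (Set.finite_singleton p).subset
    rintro q ⟨⟨c, d, δ, hc, e2, -⟩, ⟨c', d', δ', hc', e1, -⟩⟩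
    obtain ⟨⟨k, l, m, hk, f2, -⟩, ⟨k', l', m', hk', f1, -⟩⟩ := hp
    rw [hk] at hc; rw [hk'] at hc'
    simp at hc hc'
    obtain ⟨rfl, -⟩ := hc
    obtain ⟨rfl, -⟩ := hc'
    exact Prod.ext (by rw [e1, f1]) (by rw [e2, f2])

lemma crossPts_finite (x y : W → ℤ) (e e' : Ed W) : (crossPts x y e e').Finite := by
  refine ((Set.Finite.image _ ?_).union (hv_finite x y e e')).union ?_
  · obtain ⟨a, b⟩ := e.ends
    apply (Set.toFinite {a, b}).subset
    intro w hw
    have : w ∈ s(a, b) := hw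
    simpa using this
  · apply (hv_finite x y e' e).subset
    rintro q ⟨a, b⟩; exact ⟨b, a⟩

/-- vertices lie off other edges -/
lemma vertex_off_aux (hx : Function.Injective x) (hy : Function.Injective y) (v : Valid x y e)
    (s4 : Unit4 x y e) {w : W} (hw : w ∉ e.ends) : vpt x y w ∉ polySet (pts x y e) := by
  intro hm
  obtain ⟨s, hs, hq⟩ := mem_polySet.1 hm
  rcases classify x y e s hs _ hq with ⟨a, sa⟩ | ⟨a, sa⟩ | a | a | a
  · obtain ⟨c, d, δ, hc, e2, -⟩ := a
    have : w = c := hy (real_eq e2)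
    subst this; exact hw (hor_facts v hc).1
  · obtain ⟨c, d, δ, hc, e2, -⟩ := a
    have : w = c := hx (real_eq e2)
    subst this; exact hw (ver_facts v hc).1
  · obtain ⟨u, z, ε, hc, s, s0, s1, e1, e2⟩ := a
    obtain ⟨fh, fε, fne, fe⟩ := steep_facts v hc
    have n := num_steep_near fε s0 s1
    have : w = z := hx (near_eq e1 n.1 n.2)
    subst this; apply hw; rw [fe]; simp
  · obtain ⟨u, z, ε, hc, s, s0, s1, e1, e2⟩ := a
    obtain ⟨fh, fε, fne, fe⟩ := shal_facts v hc
    have n := num_steep_near fε s0 s1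
    have : w = z := hy (near_eq e1 n.1 n.2)
    subst this; apply hw; rw [fe]; simp
  · obtain ⟨u, z, hc, s, s0, s1, e1, e2⟩ := a
    have fe := str_facts hc
    rcases num_str (s4 _ _ hc).1 s0 s1 e1 with ⟨h1, -⟩ | ⟨h1, -⟩
    · have := hx h1; subst this; apply hw; rw [fe]; simp
    · have := hx h1; subst this; apply hw; rw [fe]; simp

lemma pts_ends (x y : W → ℤ) (e : Ed W) : ∃ u v, e.ends = s(u, v) ∧
    (pts x y e).head? = some (vpt x y u) ∧ (pts x y e).getLast? = some (vpt x y v) := by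
  cases e with
  | S u v => exact ⟨u, v, rfl, rfl, rfl⟩
  | L u v => exact ⟨u, v, rfl, rfl, rfl⟩
  | H u v e => exact ⟨u, v, rfl, rfl, rfl⟩
  | V u v e => exact ⟨u, v, rfl, rfl, rfl⟩

theorem draw_ok {V : Type} (G : SimpleGraph V) (ι : V → W) (hι : Function.Injective ι)
    (x y : W → ℤ) (hx : Function.Injective x) (hy : Function.Injective y) (ed : Sym2 V → Ed W)
    (hends : ∀ e ∈ G.edgeSet, (ed e).ends = e.map ι)
    (hval : ∀ e ∈ G.edgeSet, Valid x y (ed e) ∧ Unit4 x y (ed e))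
    (hcomp : ∀ e ∈ G.edgeSet, ∀ e' ∈ G.edgeSet, e ≠ e' → Compat x y (ed e) (ed e')) :
    IsBendRACDrawing 1 G (fun v => vpt x y (ι v)) (fun e => pts x y (ed e)) := by
  have hpair : ∀ e ∈ G.edgeSet, ∀ e' ∈ G.edgeSet, e ≠ e' → PairOK x y (ed e) (ed e') := by
    intro e he e' he' hne
    refine ⟨hx, hy, (hval e he).1, (hval e' he').1, (hval e he).2, (hval e' he').2, ?_,
      hcomp e he e' he' hne, hcomp e' he' e he hne.symm⟩
    rw [hends e he, hends e' he']
    intro h; exact hne (Sym2.map.injective hι h)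
  have hmem : ∀ e ∈ G.edgeSet, ∀ v, v ∈ e → ι v ∈ (ed e).ends := by
    intro e he v hv
    rw [hends e he]; exact Sym2.mem_map.2 ⟨v, hv, rfl⟩
  have hmem' : ∀ e ∈ G.edgeSet, ∀ w, w ∈ (ed e).ends → ∃ v, v ∈ e ∧ ι v = w := by
    intro e he w hw
    rw [hends e he] at hw; exact Sym2.mem_map.1 hw
  have vinj : ∀ a b, vpt x y a = vpt x y b → a = b := by
    intro a b h
    exact hx (real_eq (congrArg Prod.fst h))
  have common : ∀ e ∈ G.edgeSet, ∀ e' ∈ G.edgeSet, e ≠ e' → ∀ w w', w ∈ e → w ∈ e' →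
      w' ∈ e → w' ∈ e' → w = w' := by
    intro e he e' he' hne w w' h1 h2 h3 h4
    by_contra hww
    apply hne
    rw [(Sym2.mem_and_mem_iff hww).1 ⟨h1, h3⟩, (Sym2.mem_and_mem_iff hww).1 ⟨h2, h4⟩]
  constructor
  · intro a b h; exact hι (vinj _ _ h)
  · intro e he
    obtain ⟨u, v, h1, h2, h3⟩ := pts_ends x y (ed e)
    have he' := hends e he
    rw [h1] at he'
    induction e using Sym2.ind with
    | _ a b =>
    simp only [Sym2.map_mk, Sym2.eq_iff] at he'
    rcases he' with ⟨rfl, rfl⟩ | ⟨rfl, rfl⟩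
    · exact ⟨a, b, rfl, h2, h3⟩
    · exact ⟨b, a, Sym2.eq_swap, h2, h3⟩
  · intro e he
    cases ed e <;> simp [pts]
  · intro e he w hw
    apply vertex_off_aux hx hy (hval e he).1 (hval e he).2
    intro h
    obtain ⟨v, hv, hvw⟩ := hmem' e he _ h
    rw [hι hvw] at hv
    exact hw hv
  · rintro e he e' he' hne w hw hw' q ⟨hq, hq'⟩
    obtain ⟨s, hs, hqs⟩ := mem_polySet.1 hq
    obtain ⟨s', hs', hqs'⟩ := mem_polySet.1 hq'
    rcases pair_main (hpair e he e' he' hne) hs hs' hqs hqs' with ⟨z, z1, z2, z3⟩ | ⟨hno, -⟩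
    · obtain ⟨v, v1, v2⟩ := hmem' e he _ z1
      obtain ⟨v', v1', v2'⟩ := hmem' e' he' _ z2
      have : v = v' := hι (v2.trans v2'.symm)
      subst this
      have := common e he e' he' hne w v hw hw' v1 v1'
      subst this
      rw [z3, ← v2]; rfl
    · exact absurd ⟨ι w, hmem e he w hw, hmem e' he' w hw'⟩ hno
  · intro e he e' he' hne
    apply (crossPts_finite x y (ed e) (ed e')).subset
    rintro q ⟨hq, hq'⟩
    obtain ⟨s, hs, hqs⟩ := mem_polySet.1 hq
    obtain ⟨s', hs', hqs'⟩ := mem_polySet.1 hq'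
    rcases pair_main (hpair e he e' he' hne) hs hs' hqs hqs' with
      ⟨z, z1, z2, z3⟩ | ⟨-, ⟨a, -, b, -⟩ | ⟨a, -, b, -⟩⟩
    · left; left; exact ⟨z, z1, z3.symm⟩
    · left; right; exact ⟨a, b⟩
    · right; exact ⟨a, b⟩
  · intro e he e' he' hne s hs s' hs' q hqs hqs' hnot
    rcases pair_main (hpair e he e' he' hne) hs hs' hqs hqs' with
      ⟨z, z1, z2, z3⟩ | ⟨-, ⟨-, a, -, b⟩ | ⟨-, a, -, b⟩⟩
    · obtain ⟨v, v1, v2⟩ := hmem' e he _ z1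
      obtain ⟨v', v1', v2'⟩ := hmem' e' he' _ z2
      have : v = v' := hι (v2.trans v2'.symm)
      subst this
      exact absurd (by rw [z3, ← v2]) (hnot v v1 v1')
    · unfold SegOrth; unfold SegHor at a; unfold SegVer at b; rw [a, b]; ring
    · unfold SegOrth; unfold SegVer at a; unfold SegHor at b; rw [a, b]; ring
end

section
variable {W : Type}

/-- rank of a vertex with respect to a key -/
def rk [Fintype W] (κ : W → ℤ) (w : W) : ℤ := ((Finset.univ.filter (fun w' => κ w' < κ w)).card : ℤ)

lemma rk_lt [Fintype W] {κ : W → ℤ} {a b : W} (h : κ a < κ b) : rk κ a < rk κ b := by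
  unfold rk
  have : (Finset.univ.filter (fun w' => κ w' < κ a)) ⊂ (Finset.univ.filter (fun w' => κ w' < κ b)) := by
    refine Finset.ssubset_iff_subset_ne.2 ⟨?_, ?_⟩
    · intro w hw
      simp at hw ⊢
      omega
    · intro he
      have : a ∈ (Finset.univ.filter (fun w' => κ w' < κ b)) := by simp [h]
      rw [← he] at this
      simp at this
  exact_mod_cast Finset.card_lt_card this

lemma rk_lt_iff [Fintype W] {κ : W → ℤ} {a b : W} : rk κ a < rk κ b ↔ κ a < κ b := by
  refine ⟨fun h => ?_, rk_lt⟩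
  rcases lt_trichotomy (κ a) (κ b) with h' | h' | h'
  · exact h'
  · exfalso; simp [rk, h'] at h
  · have := rk_lt h'; omega

lemma rk_inj [Fintype W] {κ : W → ℤ} (h : Function.Injective κ) : Function.Injective (rk κ) := by
  intro a b hab
  apply h
  rcases lt_trichotomy (κ a) (κ b) with h' | h' | h'
  · have := rk_lt h'; omega
  · exact h'
  · have := rk_lt h'; omega

lemma rk_bound [Fintype W] (κ : W → ℤ) (a : W) : 0 ≤ rk κ a ∧ rk κ a < Fintype.card W := by
  unfold rk
  refine ⟨by positivity, ?_⟩
  have : (Finset.univ.filter (fun w' => κ w' < κ a)) ⊂ Finset.univ := by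
    refine Finset.ssubset_iff_subset_ne.2 ⟨Finset.subset_univ _, ?_⟩
    intro he
    have : a ∈ (Finset.univ.filter (fun w' => κ w' < κ a)) := by rw [he]; simp
    simp at this
  exact_mod_cast Finset.card_lt_card this

lemma rk_step [Fintype W] {κ : W → ℤ} (hi : Function.Injective κ) {a b : W} (h : κ a < κ b)
    (hno : ∀ w, ¬ (κ a < κ w ∧ κ w < κ b)) : rk κ b = rk κ a + 1 := by
  unfold rk
  have : (Finset.univ.filter (fun w' => κ w' < κ b)) =
      insert a (Finset.univ.filter (fun w' => κ w' < κ a)) := by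
    ext w
    simp
    constructor
    · intro hw
      by_cases hh : κ w < κ a
      · exact Or.inr hh
      · left
        apply hi
        have := hno w
        omega
    · rintro (rfl | hw) <;> omega
  rw [this, Finset.card_insert_of_notMem (by simp)]
  push_cast; ring

lemma rk_step' [Fintype W] {κ : W → ℤ} (hi : Function.Injective κ) {a b : W} (h : a ≠ b)
    (hno : ∀ w, ¬ Btwn (κ a) (κ w) (κ b)) : rk κ a = rk κ b + 1 ∨ rk κ b = rk κ a + 1 := by
  have hne : κ a ≠ κ b := fun hh => h (hi hh)
  rcases lt_or_gt_of_ne hne with h' | h'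
  · right; exact rk_step hi h' (fun w hw => hno w (Or.inl hw))
  · left; exact rk_step hi h' (fun w hw => hno w (Or.inr hw))

lemma rk_le_iff [Fintype W] {κ : W → ℤ} {a b : W} : rk κ a ≤ rk κ b ↔ κ a ≤ κ b := by
  rw [← not_lt, ← not_lt, rk_lt_iff]

def δval (e : Ed W) : Prop := (∀ c d δ, e.hor = some (c, d, δ) → -1 ≤ δ ∧ δ ≤ 1) ∧
  (∀ c d δ, e.ver = some (c, d, δ) → -1 ≤ δ ∧ δ ≤ 1)

lemma Compat.transfer {X Y X' Y' : W → ℤ} (hX : ∀ a b, X' a < X' b ↔ X a < X b)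
    (hY : ∀ a b, Y' a < Y' b ↔ Y a < Y b) {e e' : Ed W} (d : δval e) (d' : δval e')
    (h : Compat X Y e e') : Compat X' Y' e e' := by
  have hXe : ∀ a b, X' a ≤ X' b ↔ X a ≤ X b := by
    intro a b; rw [← not_lt, ← not_lt, hX]
  have hYe : ∀ a b, Y' a ≤ Y' b ↔ Y a ≤ Y b := by
    intro a b; rw [← not_lt, ← not_lt, hY]
  constructor
  · intro c d δ d' δ' h1 h2
    have := h.c1 _ _ _ _ _ h1 h2
    unfold Opp at *
    simp only [hX]; exact this
  · intro c d δ d' δ' h1 h2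
    have := h.c2 _ _ _ _ _ h1 h2
    unfold Opp at *
    simp only [hY]; exact this
  · intro u v ε c d δ h1 h2 h3
    have := h.c3 _ _ _ _ _ _ h1 h2 (by unfold Btwn at *; simpa only [hY] using h3)
    have := d'.1 _ _ _ h2
    have := hX c v; have := hX v c; have := hX d v; have := hX v d
    unfold Avoid at *
    omega
  · intro u v ε c d δ h1 h2 h3
    have := h.c4 _ _ _ _ _ _ h1 h2 (by unfold Btwn at *; simpa only [hX] using h3)
    have := d'.2 _ _ _ h2
    have := hY c v; have := hY v c; have := hY d v; have := hY v d
    unfold Avoid at *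
    omega
  · intro u v ε u' v' ε' h1 h2 h3
    have := h.c5 _ _ _ _ _ _ h1 h2 h3
    unfold Out at *
    simp only [hX, hY]; exact this
  · intro c d1 δ c' d2 δ' h1 h2 h3 h4
    have := h.c6 _ _ _ _ _ _ h1 h2 h3 h4
    have := d.1 _ _ _ h2
    have := d'.2 _ _ _ h3
    have := hX c c'; have := hX c' c; have := hX c' d1; have := hX d1 c'
    have := hY c c'; have := hY c' c; have := hY c d2; have := hY d2 c
    unfold Out at *
    omega

lemma Valid.δval {X Y : W → ℤ} {e : Ed W} (h : Valid X Y e) : δval e := by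
  constructor
  · intro c d δ h1
    have := hor_facts h h1
    exact ⟨by exact_mod_cast this.2.1, by exact_mod_cast this.2.2⟩
  · intro c d δ h1
    have := ver_facts h h1
    exact ⟨by exact_mod_cast this.2.1, by exact_mod_cast this.2.2⟩

theorem keys_ok [Fintype W] {V : Type} (G : SimpleGraph V) (ι : V → W) (hι : Function.Injective ι)
    (x y : W → ℤ) (hx : Function.Injective x) (hy : Function.Injective y) (ed : Sym2 V → Ed W)
    (hends : ∀ e ∈ G.edgeSet, (ed e).ends = e.map ι)
    (hval : ∀ e ∈ G.edgeSet, Valid x y (ed e))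
    (hcomp : ∀ e ∈ G.edgeSet, ∀ e' ∈ G.edgeSet, e ≠ e' → Compat x y (ed e) (ed e'))
    (c : ℝ) (hc : 4 * (Fintype.card W : ℝ) + 2 ≤ c ∨ IsEmpty V) :
    ∃ (p : V → Pt) (poly : Sym2 V → List Pt), IsBendRACDrawing 1 G p poly ∧
      (∀ e, (ed e).isS → (poly e).length = 2) ∧ InGridSquare c (drawingPoints G p poly) := by
  refine ⟨fun v => vpt (rk x) (rk y) (ι v), fun e => pts (rk x) (rk y) (ed e), ?_, ?_, ?_⟩
  · apply draw_ok G ι hι (rk x) (rk y) (rk_inj hx) (rk_inj hy) ed hends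
    · intro e he
      have h := hval e he
      constructor
      · cases hh : ed e with
        | S u v =>
          rw [hh] at h
          refine ⟨h.1, fun w => ?_⟩
          have := h.2 w
          unfold Btwn at *
          simpa only [rk_lt_iff] using this
        | L u v => rw [hh] at h; exact h
        | H u v e => rw [hh] at h; exact h
        | V u v e => rw [hh] at h; exact h
      · intro u v huv
        cases hh : ed e <;> rw [hh] at huv <;> simp [Ed.str] at huv
        obtain ⟨rfl, rfl⟩ := huv
        rw [hh] at h
        exact ⟨rk_step' hx h.1 (fun w => (h.2 w).1), rk_step' hy h.1 (fun w => (h.2 w).2)⟩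
    · intro e he e' he' hne
      exact (hcomp e he e' he' hne).transfer (fun a b => rk_lt_iff) (fun a b => rk_lt_iff)
        (hval e he).δval (hval e' he').δval
  · intro e he
    dsimp only
    cases hh : ed e <;> rw [hh] at he <;> simp [Ed.isS] at he
    simp [pts]
  · have key : ∀ q ∈ drawingPoints G (fun v => vpt (rk x) (rk y) (ι v))
        (fun e => pts (rk x) (rk y) (ed e)), ∃ a b : W, ∃ m n : ℤ, -1 ≤ m ∧ m ≤ 1 ∧ -1 ≤ n ∧ n ≤ 1 ∧
        q = (((4 * rk x a + m : ℤ) : ℝ), ((4 * rk y b + n : ℤ) : ℝ)) := by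
      have hv : ∀ w, ∃ a b : W, ∃ m n : ℤ, -1 ≤ m ∧ m ≤ 1 ∧ -1 ≤ n ∧ n ≤ 1 ∧
        vpt (rk x) (rk y) w = (((4 * rk x a + m : ℤ) : ℝ), ((4 * rk y b + n : ℤ) : ℝ)) := by
        intro w
        refine ⟨w, w, 0, 0, by norm_num, by norm_num, by norm_num, by norm_num, ?_⟩
        simp [vpt]
      rintro q (⟨v, rfl⟩ | ⟨e, he, hq⟩)
      · exact hv _
      · have h := hval e he
        dsimp only at hq
        cases hh : ed e with
        | S u v =>
          rw [hh] at hq; simp [pts] at hq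
          rcases hq with rfl | rfl
          · exact hv _
          · exact hv _
        | L u v =>
          rw [hh] at hq; simp [pts] at hq
          rcases hq with rfl | rfl | rfl
          · exact hv _
          · exact ⟨v, u, 0, 0, by norm_num, by norm_num, by norm_num, by norm_num, by simp⟩
          · exact hv _
        | H u v ε =>
          rw [hh] at hq; simp [pts] at hq
          rw [hh] at h
          rcases hq with rfl | rfl | rfl
          · exact hv _
          · exact ⟨v, u, ε, 0, by have := h.2; omega, by have := h.2; omega, by norm_num,
              by norm_num, by simp⟩
          · exact hv _
        | V u v ε =>
          rw [hh] at hq; simp [pts] at hq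
          rw [hh] at h
          rcases hq with rfl | rfl | rfl
          · exact hv _
          · exact ⟨u, v, 0, ε, by norm_num, by norm_num, by have := h.2; omega,
              by have := h.2; omega, by simp⟩
          · exact hv _
    constructor
    · intro q hq
      obtain ⟨a, b, m, n, -, -, -, -, rfl⟩ := key q hq
      exact ⟨_, _, rfl⟩
    · refine ⟨-1, -1, fun q hq => ?_⟩
      have hc' : 4 * (Fintype.card W : ℝ) + 2 ≤ c := by
        rcases hc with hc | hc
        · exact hc
        · exfalso
          rcases hq with ⟨v, rfl⟩ | ⟨e, he, hq⟩
          · exact hc.elim v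
          · induction e using Sym2.ind with
            | _ a b => exact hc.elim a
      obtain ⟨a, b, m, n, h1, h2, h3, h4, rfl⟩ := key q hq
      have ha := rk_bound x a
      have hb := rk_bound y b
      have i1 : (-1 : ℤ) ≤ 4 * rk x a + m := by omega
      have i2 : 4 * rk x a + m ≤ 4 * (Fintype.card W : ℤ) + 1 := by omega
      have i3 : (-1 : ℤ) ≤ 4 * rk y b + n := by omega
      have i4 : 4 * rk y b + n ≤ 4 * (Fintype.card W : ℤ) + 1 := by omega
      have j1 : (-1 : ℝ) ≤ ((4 * rk x a + m : ℤ) : ℝ) := by exact_mod_cast i1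
      have j2 : ((4 * rk x a + m : ℤ) : ℝ) ≤ 4 * (Fintype.card W : ℝ) + 1 := by exact_mod_cast i2
      have j3 : (-1 : ℝ) ≤ ((4 * rk y b + n : ℤ) : ℝ) := by exact_mod_cast i3
      have j4 : ((4 * rk y b + n : ℤ) : ℝ) ≤ 4 * (Fintype.card W : ℝ) + 1 := by exact_mod_cast i4
      refine ⟨j1, by dsimp only; linarith, j3, by dsimp only; linarith⟩
end

section
/-- Splitting a 2-in 2-out digraph into two permutations. -/
lemma split2 {E W : Type} [Fintype E] [Fintype W] (p q : E → W)
    (hp : ∀ w, (Finset.univ.filter (fun e => p e = w)).card = 2)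
    (hq : ∀ w, (Finset.univ.filter (fun e => q e = w)).card = 2) :
    ∃ (φ : Bool → Equiv.Perm W) (m : Bool × W → E), Function.Bijective m ∧
      ∀ b w, p (m (b, w)) = w ∧ q (m (b, w)) = φ b w := by
  let t : W → Finset W := fun w => (Finset.univ.filter (fun e => p e = w)).image q
  have hall : ∀ A : Finset W, A.card ≤ (A.biUnion t).card := by
    intro A
    have h1 : (Finset.univ.filter (fun e => p e ∈ A)).card = 2 * A.card := by
      rw [Finset.card_eq_sum_card_fiberwise (f := p) (t := A) (by intro e he; simpa using he)]
      rw [Finset.sum_const_nat (m := 2), mul_comm]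
      intro w hw
      rw [← hp w]; congr 1; ext e; simp; rintro rfl; exact hw
    have h2 : (Finset.univ.filter (fun e => p e ∈ A)).card ≤ 2 * (A.biUnion t).card := by
      rw [Finset.card_eq_sum_card_fiberwise (f := q) (t := A.biUnion t)
        (by intro e he; simp [t] at he ⊢; exact ⟨e, he, rfl⟩)]
      rw [mul_comm]
      apply Finset.sum_le_card_nsmul
      intro w hw
      rw [← hq w]
      apply Finset.card_le_card
      intro e he
      simp at he ⊢; exact he.2
    omega
  obtain ⟨f, hf, hft⟩ := (Finset.all_card_le_biUnion_card_iff_exists_injective t).1 hall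
  have hfb : Function.Bijective f := Finite.injective_iff_bijective.1 hf
  have hm : ∀ w, ∃ e, p e = w ∧ q e = f w := by
    intro w
    have := hft w
    simp [t] at this
    exact this
  choose m1 hm1 hm1' using hm
  have hm2 : ∀ w, ∃ e, p e = w ∧ e ≠ m1 w ∧ ∀ e', p e' = w → e' = m1 w ∨ e' = e := by
    intro w
    obtain ⟨a, b, hab, hh⟩ := Finset.card_eq_two.1 (hp w)
    have key : ∀ e, p e = w ↔ e = a ∨ e = b := by
      intro e
      have : e ∈ (Finset.univ.filter (fun e => p e = w)) ↔ e ∈ ({a, b} : Finset E) := by rw [hh]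
      simpa using this
    rcases (key _).1 (hm1 w) with h | h
    · exact ⟨b, (key b).2 (Or.inr rfl), by rw [h]; exact hab.symm, fun e' he' => by
        rw [h]; exact (key e').1 he'⟩
    · exact ⟨a, (key a).2 (Or.inl rfl), by rw [h]; exact hab, fun e' he' => by
        rw [h]; exact ((key e').1 he').symm⟩
  choose m2 hm2 hm2ne hm2all using hm2
  have hg : Function.Injective (fun w => q (m2 w)) := by
    intro w w' hww
    by_contra hne
    obtain ⟨z, hz⟩ := hfb.2 (q (m2 w))
    have h3 : ({m2 w, m2 w', m1 z} : Finset E).card ≤ 2 := by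
      rw [← hq (q (m2 w))]
      apply Finset.card_le_card
      intro e he
      simp at he ⊢
      rcases he with rfl | rfl | rfl
      · rfl
      · exact hww.symm
      · rw [hm1', hz]
    have n1 : m2 w ≠ m2 w' := fun h => hne (by rw [← hm2 w, h, hm2])
    have n2 : m2 w ≠ m1 z := by
      intro h
      have : w = z := by rw [← hm2 w, h, hm1]
      subst this; exact hm2ne w h
    have n3 : m2 w' ≠ m1 z := by
      intro h
      have : w' = z := by rw [← hm2 w', h, hm1]
      subst this; exact hm2ne w' h
    rw [Finset.card_eq_three.2 ⟨_, _, _, n1, n2, n3, rfl⟩] at h3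
    omega
  have hgb : Function.Bijective (fun w => q (m2 w)) := Finite.injective_iff_bijective.1 hg
  refine ⟨fun b => if b then Equiv.ofBijective _ hgb else Equiv.ofBijective f hfb,
    fun x => if x.1 then m2 x.2 else m1 x.2, ⟨?_, ?_⟩, ?_⟩
  · rintro ⟨b, w⟩ ⟨b', w'⟩ h
    cases b <;> cases b' <;> simp at h ⊢
    · rw [← hm1 w, h, hm1]
    · have : w = w' := by rw [← hm1 w, h, hm2]
      subst this; exact hm2ne w h.symm
    · have : w = w' := by rw [← hm2 w, h, hm1]
      subst this; exact hm2ne w h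
    · rw [← hm2 w, h, hm2]
  · intro e
    rcases hm2all (p e) e rfl with h | h
    · exact ⟨(false, p e), by simp [← h]⟩
    · exact ⟨(true, p e), by simp [← h]⟩
  · intro b w
    cases b <;> simp [hm1, hm2, hm1']

lemma orient4 {E W : Type} [Fintype E] [Fintype W] (en : E → Sym2 W) 
    (h4 : ∀ w, (Finset.univ.filter (fun e => w ∈ en e)).card = 4) (hd : ∀ e, ¬ (en e).IsDiag) :
    ∃ p q : E → W, (∀ e, en e = s(p e, q e)) ∧
    (∀ w, (Finset.univ.filter (fun e => p e = w)).card = 2) ∧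
    (∀ w, (Finset.univ.filter (fun e => q e = w)).card = 2) := by
  have le2 : ∀ e, (Finset.univ.filter (fun w => w ∈ en e)).card = 2 := by
    intro e
    have hd' := hd e
    generalize en e = z at hd' ⊢
    induction z using Sym2.ind with
    | _ a b =>
    have hab : a ≠ b := fun h => hd' (by simpa using h)
    rw [Finset.card_eq_two]
    refine ⟨a, b, hab, ?_⟩
    ext w
    simp only [Finset.mem_filter, Finset.mem_univ, true_and, Finset.mem_insert, Finset.mem_singleton]
    exact Sym2.mem_iff
  have dc : ∀ A : Finset W, 4 * A.card = ∑ e : E, (A.filter (fun w => w ∈ en e)).card := by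
    intro A
    have : ∑ w ∈ A, (Finset.univ.filter (fun e => w ∈ en e)).card = 4 * A.card := by
      rw [Finset.sum_const_nat (m := 4), mul_comm]
      intro w _; exact h4 w
    rw [← this]
    exact Finset.sum_card_bipartiteAbove_eq_sum_card_bipartiteBelow (fun w e => w ∈ en e)
  let t : W × Fin 2 → Finset E := fun x => Finset.univ.filter (fun e => x.1 ∈ en e)
  have hall : ∀ A : Finset (W × Fin 2), A.card ≤ (A.biUnion t).card := by
    intro A
    let B := A.image Prod.fst
    have h1 : A.card ≤ 2 * B.card := by
      refine Finset.card_le_mul_card_image A 2 ?_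
      intro w _
      have : (A.filter (fun x => x.1 = w)) ⊆ (Finset.univ : Finset (Fin 2)).image (fun i => (w, i)) := by
        rintro ⟨a, i⟩ h
        simp at h ⊢; exact h.2.symm
      refine (Finset.card_le_card this).trans (Finset.card_image_le.trans (by simp))
    have h2 : 4 * B.card ≤ 2 * (A.biUnion t).card := by
      rw [dc B]
      have : ∑ e : E, (B.filter (fun w => w ∈ en e)).card =
          ∑ e ∈ A.biUnion t, (B.filter (fun w => w ∈ en e)).card := by
        symm
        apply Finset.sum_subset (Finset.subset_univ _)
        intro e _ he
        rw [Finset.card_eq_zero, Finset.filter_eq_empty_iff]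
        intro w hw hwe
        apply he
        simp only [B, Finset.mem_image] at hw
        obtain ⟨x, hx, rfl⟩ := hw
        simp only [Finset.mem_biUnion]
        exact ⟨x, hx, by simp [t, hwe]⟩
      rw [this, mul_comm 2]
      apply Finset.sum_le_card_nsmul
      intro e _
      rw [← le2 e]
      apply Finset.card_le_card
      intro w hw; simp at hw ⊢; exact hw.2
    omega
  obtain ⟨f, hf, hft⟩ := (Finset.all_card_le_biUnion_card_iff_exists_injective t).1 hall
  have hcard : Fintype.card (W × Fin 2) = Fintype.card E := by
    have := dc Finset.univ
    simp only [le2] at this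
    simp at this ⊢
    omega
  have hfb : Function.Bijective f := (Fintype.bijective_iff_injective_and_card f).2 ⟨hf, hcard⟩
  let F := Equiv.ofBijective f hfb
  let p : E → W := fun e => (F.symm e).1
  have hpm : ∀ e, p e ∈ en e := by
    intro e
    have := hft (F.symm e)
    simp only [t, Finset.mem_filter] at this
    have h2 : f (F.symm e) = e := F.apply_symm_apply e
    rw [h2] at this
    exact this.2
  choose q hq using fun e => Sym2.mem_iff_exists.1 (hpm e)
  have hp2 : ∀ w, (Finset.univ.filter (fun e => p e = w)).card = 2 := by
    intro w
    have : (Finset.univ.filter (fun e => p e = w)) =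
        (Finset.univ : Finset (Fin 2)).image (fun i => F (w, i)) := by
      ext e
      simp only [Finset.mem_filter, Finset.mem_univ, true_and, Finset.mem_image]
      constructor
      · rintro rfl
        exact ⟨(F.symm e).2, by simp [p]⟩
      · rintro ⟨i, rfl⟩
        simp [p]
    rw [this, Finset.card_image_of_injective]
    · simp
    · intro i j h
      simpa using h
  refine ⟨p, q, hq, hp2, ?_⟩
  intro w
  have h := h4 w
  have hsplit : (Finset.univ.filter (fun e => w ∈ en e)) =
      (Finset.univ.filter (fun e => p e = w)) ∪ (Finset.univ.filter (fun e => q e = w)) := by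
    ext e
    simp only [Finset.mem_filter, Finset.mem_univ, true_and, Finset.mem_union]
    rw [hq e, Sym2.mem_iff]
    constructor <;> rintro (h | h) <;> simp [h]
  rw [hsplit, Finset.card_union_of_disjoint, hp2 w] at h
  · omega
  · rw [Finset.disjoint_left]
    intro e h1 h2
    simp at h1 h2
    apply hd e
    rw [hq e, h1, h2]; simp

/-- The decomposition theorem. -/
theorem decomp (V : Type) [Fintype V] (G : SimpleGraph V) (hdeg : ∀ v, vdeg G v ≤ 4) :
    ∃ φ : Bool → Equiv.Perm (V ⊕ V),
      (∀ b v w, φ b (Sum.inl v) = Sum.inl w → G.Adj v w) ∧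
      (∀ v w, G.Adj v w → ∃ b, φ b (Sum.inl v) = Sum.inl w ∨ φ b (Sum.inl w) = Sum.inl v) ∧
      (∀ b b' v v' w w', φ b (Sum.inl v) = Sum.inl w → φ b' (Sum.inl v') = Sum.inl w' →
        s(v, w) = s(v', w') → b = b' ∧ v = v') := by
  let E := (G.edgeSet × Bool) ⊕ (Σ v : V, Fin (4 - vdeg G v))
  let en : E → Sym2 (V ⊕ V) := fun e => match e with
    | Sum.inl (e, false) => (e : Sym2 V).map Sum.inl
    | Sum.inl (e, true) => (e : Sym2 V).map Sum.inr
    | Sum.inr ⟨v, _⟩ => s(Sum.inl v, Sum.inr v)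
  have hd : ∀ e, ¬ (en e).IsDiag := by
    rintro (⟨⟨e, he⟩, b⟩ | ⟨v, i⟩)
    · have := G.not_isDiag_of_mem_edgeSet he
      induction e using Sym2.ind with
      | _ a c =>
      cases b <;> simpa [en] using this
    · simp [en]
  have hinc : ∀ v, (Finset.univ.filter (fun e : G.edgeSet => v ∈ (e : Sym2 V))).card = vdeg G v := by
    intro v
    have h1 : vdeg G v = G.degree v := by
      unfold vdeg
      rw [Set.ncard_eq_toFinset_card']
      rw [← SimpleGraph.card_neighborFinset_eq_degree]
      rfl
    rw [h1, ← SimpleGraph.card_incidenceFinset_eq_degree]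
    rw [← Finset.card_map (Function.Embedding.subtype _)]
    congr 1
    ext e
    simp [SimpleGraph.mem_incidenceFinset, SimpleGraph.incidenceSet]
    constructor
    · rintro ⟨a, b⟩; exact ⟨b, a⟩
    · rintro ⟨a, b⟩; exact ⟨b, a⟩
  have gen : ∀ (v : V) (b : Bool) (w : V ⊕ V), w = (if b then Sum.inr v else Sum.inl v) →
      (Finset.univ.filter (fun e : E => w ∈ en e)).card = 4 := by
    intro v b w hw
    have : (Finset.univ.filter (fun e : E => w ∈ en e)) =
        ((Finset.univ.filter (fun e : G.edgeSet => v ∈ (e : Sym2 V))).image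
          (fun e => (Sum.inl (e, b) : E))) ∪
        ((Finset.univ : Finset (Fin (4 - vdeg G v))).image (fun i => (Sum.inr ⟨v, i⟩ : E))) := by
      ext e
      simp only [Finset.mem_filter, Finset.mem_univ, true_and, Finset.mem_union, Finset.mem_image]
      rcases e with ⟨⟨e, he⟩, b'⟩ | ⟨v', i⟩
      · induction e using Sym2.ind with
        | _ a c =>
        constructor
        · intro h
          left
          refine ⟨⟨s(a, c), he⟩, ?_, ?_⟩
          · cases b <;> cases b' <;> simp [en, hw] at h ⊢ <;> exact h
          · cases b <;> cases b' <;> simp [en, hw] at h ⊢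
        · rintro (⟨⟨z, hz⟩, h1, h⟩ | ⟨i, h⟩)
          · have h' := Sum.inl_injective h
            simp only [Prod.mk.injEq, Subtype.mk.injEq] at h'
            obtain ⟨rfl, rfl⟩ := h'
            cases b <;> simp [en, hw] at h1 ⊢ <;> exact h1
          · exact absurd h (by simp)
      · constructor
        · intro h
          right
          have : v = v' := by cases b <;> simpa [en, hw] using h
          subst this
          exact ⟨i, rfl⟩
        · rintro (⟨a, -, h⟩ | ⟨a, h⟩)
          · exact absurd h (by simp)
          · have h' := Sum.inr_injective h
            have : v = v' := congrArg Sigma.fst h'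
            subst this
            cases b <;> simp [en, hw]
    rw [this, Finset.card_union_of_disjoint, Finset.card_image_of_injective,
      Finset.card_image_of_injective, hinc]
    · have := hdeg v
      simp; omega
    · intro i j h
      have := Sum.inr_injective h
      simpa using this
    · intro i j h
      have := Sum.inl_injective h
      simpa using this
    · rw [Finset.disjoint_left]
      intro e h1 h2
      rw [Finset.mem_image] at h1 h2
      obtain ⟨a, ha, rfl⟩ := h1
      obtain ⟨i, _, hi⟩ := h2
      cases hi
  have h4 : ∀ w, (Finset.univ.filter (fun e : E => w ∈ en e)).card = 4 := by
    rintro (v | v)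
    · exact gen v false _ rfl
    · exact gen v true _ rfl
  obtain ⟨p, q, hpq, hp, hq⟩ := orient4 en (by intro w; convert h4 w) hd
  obtain ⟨φ, m, hm, hφ⟩ := split2 p q hp hq
  have hen : ∀ b w, en (m (b, w)) = s(w, φ b w) := by
    intro b w; rw [hpq, (hφ b w).1, (hφ b w).2]
  have inv : ∀ b v w, φ b (Sum.inl v) = Sum.inl w → ∃ e : G.edgeSet,
      (e : Sym2 V) = s(v, w) ∧ m (b, Sum.inl v) = Sum.inl (e, false) := by
    intro b v w h
    have h1 := hen b (Sum.inl v)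
    rw [h] at h1
    rcases hh : m (b, Sum.inl v) with ⟨⟨e, he⟩, b'⟩ | ⟨v', i⟩
    · rw [hh] at h1
      refine ⟨⟨e, he⟩, ?_, ?_⟩
      · induction e using Sym2.ind with
        | _ a c =>
        cases b' <;> simpa [en] using h1
      · induction e using Sym2.ind with
        | _ a c =>
        cases b' 
        · rfl
        · simp [en] at h1
    · rw [hh] at h1
      simp [en] at h1
  refine ⟨φ, ?_, ?_, ?_⟩
  · intro b v w h
    obtain ⟨e, he, -⟩ := inv b v w h
    have := e.2
    rw [he] at this
    exact this
  · intro v w h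
    obtain ⟨⟨b, u⟩, hu⟩ := hm.2 (Sum.inl (⟨s(v, w), h⟩, false))
    have h1 := hen b u
    rw [hu] at h1
    simp [en] at h1
    rcases h1 with ⟨rfl, h2⟩ | ⟨h2, rfl⟩
    · exact ⟨b, Or.inl h2.symm⟩
    · exact ⟨b, Or.inr h2.symm⟩
  · intro b b' v v' w w' h h' hs
    obtain ⟨e, he, hme⟩ := inv b v w h
    obtain ⟨e', he', hme'⟩ := inv b' v' w' h'
    have : e = e' := Subtype.ext (by rw [he, he', hs])
    subst this
    have := hm.1 (hme.trans hme'.symm)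
    simpa using this
end

section
/-! ### Local layouts of a block -/
variable {W : Type}

/-- number of elements with a property -/
def cnt [Fintype W] (P : W → Prop) : ℕ := (Finset.univ.filter P).card

structure Hyp (A : W → Prop) (f g : Equiv.Perm W) : Prop where
  f1 : ∀ v, A v → A (f v) → f v ≠ v
  f2 : ∀ v, A v → A (f v) → f (f v) ≠ v
  g1 : ∀ v, A v → A (g v) → g v ≠ v
  g2 : ∀ v, A v → A (g v) → g (g v) ≠ v
  fg : ∀ v, A v → A (f v) → g v ≠ f v
  gf : ∀ v, A v → A (f v) → g (f v) ≠ v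

/-- environment of a block `{rel = 0}` in one coordinate -/
structure Env1 (g : Equiv.Perm W) (rel p zone : W → ℤ) (K : ℤ) (κ : W → ℤ) (lo : ℤ) : Prop where
  inj : Function.Injective κ
  z0 : ∀ v, rel v = 0 → zone v = 0 → κ v = lo + p v
  out : ∀ v, rel v ≠ 0 → κ v < lo ∨ lo + K < κ v
  oE : ∀ v, rel v = 0 → rel (g v) < 0 → κ (g v) < lo
  oL : ∀ v, rel v = 0 → 0 < rel (g v) → lo + K < κ (g v)
  iE : ∀ v, rel (g v) = 0 → rel v < 0 → κ v < lo
  iL : ∀ v, rel (g v) = 0 → 0 < rel v → lo + K < κ v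
  fR1 : ∀ z, rel z = 0 → zone z = 1 → lo + K < κ z
  fR2 : ∀ z, rel z = 0 → zone z = 1 → ∀ w, 0 < rel w → κ w < κ z
  fR3 : ∀ z, rel z = 0 → zone z = 1 → ∀ w, rel w < 0 → κ w < lo ∨ κ z < κ w
  fR4 : ∀ z, rel z = 0 → zone z = 1 → ∀ w, 0 < rel w → κ (g w) < κ z
  fL1 : ∀ z, rel z = 0 → zone z = -1 → κ z < lo
  fL2 : ∀ z, rel z = 0 → zone z = -1 → ∀ w, rel w < 0 → κ z < κ w
  fL3 : ∀ z, rel z = 0 → zone z = -1 → ∀ w, 0 < rel w → lo + K < κ w ∨ κ w < κ z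
  fL4 : ∀ z, rel z = 0 → zone z = -1 → ∀ w, rel w < 0 → κ z < κ (g w)

structure Loc (W : Type) where
  px : W → ℤ
  py : W → ℤ
  zone : W → ℤ
  df : W → Ed W
  dg : W → Ed W
  nm : W → Prop

structure Env (g : Equiv.Perm W) (rel : W → ℤ) (D : Loc W) (K : ℤ) (κx κy : W → ℤ) (lo : ℤ) :
    Prop where
  ex : Env1 g rel D.px D.zone K κx lo
  ey : Env1 g rel D.py D.zone K κy lo
  co : ∀ u w, rel u = 0 → rel w ≠ 0 → (κx u < κx w ↔ κy u < κy w)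

/-- special arcs -/
def Sp (A : W → Prop) (f g : Equiv.Perm W) (rel : W → ℤ) (D : Loc W) (e : Ed W) : Prop :=
  (∃ v, rel v = 0 ∧ A v ∧ A (f v) ∧ e = D.df v) ∨
  (∃ v, rel v = 0 ∧ ¬ D.nm v ∧ A v ∧ A (g v) ∧ e = D.dg v)

/-- normal arcs touching the block -/
def Nm (A : W → Prop) (g : Equiv.Perm W) (rel : W → ℤ) (D : Loc W) (w : W) : Prop :=
  A w ∧ A (g w) ∧ ((rel w = 0 ∧ D.nm w) ∨ (rel w ≠ 0 ∧ rel (g w) = 0))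

def Two (rel : W → ℤ) (u v w : W) : Prop :=
  (rel u = 0 ∧ rel v = 0) ∨ (rel u = 0 ∧ rel w = 0) ∨ (rel v = 0 ∧ rel w = 0)

structure LocalOK [Fintype W] (A : W → Prop) (f g : Equiv.Perm W) (rel : W → ℤ) (K : ℤ)
    (D : Loc W) : Prop where
  bx : ∀ v, rel v = 0 → D.zone v = 0 → 0 < D.px v ∧ D.px v < K
  by' : ∀ v, rel v = 0 → D.zone v = 0 → 0 < D.py v ∧ D.py v < K
  ix : ∀ u v, rel u = 0 → rel v = 0 → D.zone u = 0 → D.zone v = 0 → D.px u = D.px v → u = v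
  iy : ∀ u v, rel u = 0 → rel v = 0 → D.zone u = 0 → D.zone v = 0 → D.py u = D.py v → u = v
  zv : ∀ v, rel v = 0 → D.zone v = 0 ∨ D.zone v = 1 ∨ D.zone v = -1
  zu : ∀ u v, rel u = 0 → rel v = 0 → D.zone u ≠ 0 → D.zone v ≠ 0 → u = v
  z1 : ∀ v, rel v = 0 → D.zone v = 1 → rel (g v) ≤ 0 ∧ rel (g.symm v) ≤ 0
  z2 : ∀ v, rel v = 0 → D.zone v = -1 → 0 ≤ rel (g v) ∧ 0 ≤ rel (g.symm v)
  ef : ∀ v, rel v = 0 → (D.df v).ends = s(v, f v)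
  eg : ∀ v, rel v = 0 → ¬ D.nm v → (D.dg v).ends = s(v, g v) ∧ rel (g v) = 0
  en : ∀ v, rel v = 0 → D.nm v → D.dg v = Ed.L v (g v)
  sz : ∀ e, Sp A f g rel D e → ∀ u v ε, e.steep = some (u, v, ε) → D.zone u = 0
  hz : ∀ e, Sp A f g rel D e → ∀ u v ε, e.shal = some (u, v, ε) → D.zone u = 0 ∧ D.zone v = 0
  val : ∀ κx κy lo, Env g rel D K κx κy lo → ∀ e, Sp A f g rel D e → Valid κx κy e
  ss : ∀ κx κy lo, Env g rel D K κx κy lo → ∀ e e', Sp A f g rel D e → Sp A f g rel D e' →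
    e.ends ≠ e'.ends → Compat κx κy e e'
  sn : ∀ κx κy lo, Env g rel D K κx κy lo → ∀ e w, Sp A f g rel D e → Nm A g rel D w →
    Compat κx κy e (Ed.L w (g w)) ∧ Compat κx κy (Ed.L w (g w)) e
  ch : ∀ κx κy lo, Env g rel D K κx κy lo → ∀ v, A v → A (g v) → A (g (g v)) →
    Two rel v (g v) (g (g v)) → Out (κx (g (g v))) (κx v) (κx (g v)) ∨
      Out (κy v) (κy (g (g v))) (κy (g v))
  ct : 4 * cnt (fun v => rel v = 0 ∧ A v ∧ A (f v) ∧ ¬ (D.df v).isS) ≤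
    3 * cnt (fun v => rel v = 0 ∧ A v ∧ A (f v))

/-! reversal -/
def Loc.rev (f : Equiv.Perm W) (D : Loc W) : Loc W := { D with df := fun v => D.df (f v) }

lemma Hyp.rev {A : W → Prop} {f g : Equiv.Perm W} (h : Hyp A f g) : Hyp A f.symm g where
  f1 := by
    intro v h1 h2 h3
    have := h.f1 (f.symm v) h2 (by simpa using h1)
    simp at this; exact this h3.symm
  f2 := by
    intro v h1 h2 h3
    have := h.f2 (f.symm v) h2 (by simpa using h1)
    simp at this; apply this; rw [← h3]; simp; exact h3.symm ▸ rfl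
  g1 := h.g1
  g2 := h.g2
  fg := by
    intro v h1 h2 h3
    have := h.gf (f.symm v) h2 (by simpa using h1)
    simp at this; exact this h3
  gf := by
    intro v h1 h2 h3
    have := h.fg (f.symm v) h2 (by simpa using h1)
    simp at this; exact this h3

lemma LocalOK.rev [Fintype W] {A : W → Prop} {f g : Equiv.Perm W} {rel : W → ℤ} {K : ℤ}
    {D : Loc W} (hf : ∀ v, rel (f v) = 0 ↔ rel v = 0)
    (h : LocalOK A f.symm g rel K D) : LocalOK A f g rel K (D.rev f) := by
  have hsp : ∀ e, Sp A f g rel (D.rev f) e → Sp A f.symm g rel D e := by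
    rintro e (⟨v, h1, h2, h3, rfl⟩ | h1)
    · left
      exact ⟨f v, (hf v).2 h1, h3, by simpa using h2, rfl⟩
    · right; exact h1
  have henv : ∀ κx κy lo, Env g rel (D.rev f) K κx κy lo → Env g rel D K κx κy lo :=
    fun κx κy lo h => ⟨h.ex, h.ey, h.co⟩
  refine ⟨h.bx, h.by', h.ix, h.iy, h.zv, h.zu, h.z1, h.z2, ?_, h.eg, h.en,
    fun e he => h.sz e (hsp e he), fun e he => h.hz e (hsp e he),
    fun κx κy lo hE e he => h.val κx κy lo (henv _ _ _ hE) e (hsp e he),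
    fun κx κy lo hE e e' he he' => h.ss κx κy lo (henv _ _ _ hE) e e' (hsp e he) (hsp e' he'),
    fun κx κy lo hE e w he hw => h.sn κx κy lo (henv _ _ _ hE) e w (hsp e he) hw,
    fun κx κy lo hE => h.ch κx κy lo (henv _ _ _ hE), ?_⟩
  · intro v hv
    have := h.ef (f v) ((hf v).2 hv)
    simp at this
    show (D.df (f v)).ends = _
    rw [this, Sym2.eq_swap]
  · have h1 := h.ct
    have e1 : ∀ P : W → Prop, cnt (fun v => P (f v)) = cnt (fun v => P v) := by
      intro P
      unfold cnt
      rw [← Finset.card_map f.toEmbedding]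
      congr 1
      ext v
      simp only [Finset.mem_map, Finset.mem_filter, Finset.mem_univ, true_and]
      constructor
      · rintro ⟨a, ha, rfl⟩; exact ha
      · intro h; exact ⟨f.symm v, by simpa using h, by simp⟩
    have e2 := e1 (fun v => rel v = 0 ∧ A v ∧ A (f.symm v) ∧ ¬ (D.df v).isS)
    have e3 := e1 (fun v => rel v = 0 ∧ A v ∧ A (f.symm v))
    rw [← e2, ← e3] at h1
    simp only [hf, Equiv.symm_apply_apply] at h1
    have q1 : (fun v => rel v = 0 ∧ A v ∧ A (f v) ∧ ¬ ((D.rev f).df v).isS) =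
        (fun v => rel v = 0 ∧ A (f v) ∧ A v ∧ ¬ (D.df (f v)).isS) := by
      ext v
      show (_ ∧ _ ∧ _ ∧ ¬ (D.df (f v)).isS) ↔ _
      tauto
    have q2 : (fun v => rel v = 0 ∧ A v ∧ A (f v)) =
        (fun v => rel v = 0 ∧ A (f v) ∧ A v) := by
      ext v
      tauto
    rw [q1, q2]
    exact h1

/-! rotation -/
def Ed.neg : Ed W → Ed W
  | .S u v => .S u v
  | .L u v => .L u v
  | .H u v e => .H u v (-e)
  | .V u v e => .V u v (-e)

lemma Ed.neg_ends (e : Ed W) : e.neg.ends = e.ends := by cases e <;> rfl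
lemma Ed.neg_isS (e : Ed W) : e.neg.isS = e.isS := by cases e <;> rfl
lemma Ed.neg_neg (e : Ed W) : e.neg.neg = e := by cases e <;> simp [Ed.neg]
lemma Ed.neg_hor (e : Ed W) {c d δ} (h : e.neg.hor = some (c, d, δ)) :
    e.hor = some (c, d, -δ) := by
  cases e <;> simp_all [Ed.neg, Ed.hor] <;> omega
lemma Ed.neg_ver (e : Ed W) {c d δ} (h : e.neg.ver = some (c, d, δ)) :
    e.ver = some (c, d, -δ) := by
  cases e <;> simp_all [Ed.neg, Ed.ver] <;> omega
lemma Ed.neg_steep (e : Ed W) {c d δ} (h : e.neg.steep = some (c, d, δ)) :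
    e.steep = some (c, d, -δ) := by
  cases e <;> simp_all [Ed.neg, Ed.steep] <;> omega
lemma Ed.neg_shal (e : Ed W) {c d δ} (h : e.neg.shal = some (c, d, δ)) :
    e.shal = some (c, d, -δ) := by
  cases e <;> simp_all [Ed.neg, Ed.shal] <;> omega

lemma Compat.neg {X Y : W → ℤ} {e e' : Ed W} (h : Compat (fun w => - X w) (fun w => - Y w) e e') :
    Compat X Y e.neg e'.neg where
  c1 := by
    intro c d δ d' δ' h1 h2
    have := h.c1 _ _ _ _ _ (e.neg_hor h1) (e'.neg_hor h2)
    unfold Opp at *; (try dsimp only at *); omega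
  c2 := by
    intro c d δ d' δ' h1 h2
    have := h.c2 _ _ _ _ _ (e.neg_ver h1) (e'.neg_ver h2)
    unfold Opp at *; (try dsimp only at *); omega
  c3 := by
    intro u v ε c d δ h1 h2 h3
    have := h.c3 _ _ _ _ _ _ (e.neg_steep h1) (e'.neg_hor h2) (by unfold Btwn at *; (try dsimp only at *); omega)
    unfold Avoid at *; (try dsimp only at *); omega
  c4 := by
    intro u v ε c d δ h1 h2 h3
    have := h.c4 _ _ _ _ _ _ (e.neg_shal h1) (e'.neg_ver h2) (by unfold Btwn at *; (try dsimp only at *); omega)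
    unfold Avoid at *; (try dsimp only at *); omega
  c5 := by
    intro u v ε u' v' ε' h1 h2 h3
    have := h.c5 _ _ _ _ _ _ (e.neg_steep h1) (e'.neg_shal h2) h3
    unfold Out at *; (try dsimp only at *); omega
  c6 := by
    intro c d δ c' d' δ' h0 h1 h2 h3
    rw [Ed.neg_ends, Ed.neg_ends] at h0
    have := h.c6 _ _ _ _ _ _ h0 (e.neg_hor h1) (e'.neg_ver h2) h3
    unfold Out at *; (try dsimp only at *); omega

lemma Valid.neg {X Y : W → ℤ} {e : Ed W} (h : Valid (fun w => - X w) (fun w => - Y w) e) :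
    Valid X Y e.neg := by
  cases e with
  | S u v => exact ⟨h.1, fun w => by have := h.2 w; unfold Btwn at *; (try dsimp only at *); omega⟩
  | L u v => exact h
  | H u v e => exact ⟨h.1, by have := h.2; omega⟩
  | V u v e => exact ⟨h.1, by have := h.2; omega⟩

def Loc.rot (K : ℤ) (D : Loc W) : Loc W where
  px := fun v => K - D.px v
  py := fun v => K - D.py v
  zone := fun v => - D.zone v
  df := fun v => (D.df v).neg
  dg := fun v => (D.dg v).neg
  nm := D.nm

lemma Env1.rot {g : Equiv.Perm W} {rel p zone : W → ℤ} {K : ℤ} {κ : W → ℤ} {lo : ℤ}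
    (h : Env1 g rel (fun v => K - p v) (fun v => - zone v) K κ lo) :
    Env1 g (fun v => - rel v) p zone K (fun v => - κ v) (-lo - K) where
  inj := fun u v huv => h.inj (by simpa using huv)
  z0 := fun v h1 h2 => by have := h.z0 v (by (try dsimp only at *); omega) (by (try dsimp only at *); omega); omega
  out := fun v h1 => by have := h.out v (by (try dsimp only at *); omega); omega
  oE := fun v h1 h2 => by have := h.oL v (by (try dsimp only at *); omega) (by (try dsimp only at *); omega); omega
  oL := fun v h1 h2 => by have := h.oE v (by (try dsimp only at *); omega) (by (try dsimp only at *); omega); omega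
  iE := fun v h1 h2 => by have := h.iL v (by (try dsimp only at *); omega) (by (try dsimp only at *); omega); omega
  iL := fun v h1 h2 => by have := h.iE v (by (try dsimp only at *); omega) (by (try dsimp only at *); omega); omega
  fR1 := fun z h1 h2 => by have := h.fL1 z (by (try dsimp only at *); omega) (by (try dsimp only at *); omega); omega
  fR2 := fun z h1 h2 w h3 => by have := h.fL2 z (by (try dsimp only at *); omega) (by (try dsimp only at *); omega) w (by (try dsimp only at *); omega); omega
  fR3 := fun z h1 h2 w h3 => by have := h.fL3 z (by (try dsimp only at *); omega) (by (try dsimp only at *); omega) w (by (try dsimp only at *); omega); omega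
  fR4 := fun z h1 h2 w h3 => by have := h.fL4 z (by (try dsimp only at *); omega) (by (try dsimp only at *); omega) w (by (try dsimp only at *); omega); omega
  fL1 := fun z h1 h2 => by have := h.fR1 z (by (try dsimp only at *); omega) (by (try dsimp only at *); omega); omega
  fL2 := fun z h1 h2 w h3 => by have := h.fR2 z (by (try dsimp only at *); omega) (by (try dsimp only at *); omega) w (by (try dsimp only at *); omega); omega
  fL3 := fun z h1 h2 w h3 => by have := h.fR3 z (by (try dsimp only at *); omega) (by (try dsimp only at *); omega) w (by (try dsimp only at *); omega); omega
  fL4 := fun z h1 h2 w h3 => by have := h.fR4 z (by (try dsimp only at *); omega) (by (try dsimp only at *); omega) w (by (try dsimp only at *); omega); omega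

lemma LocalOK.rot [Fintype W] {A : W → Prop} {f g : Equiv.Perm W} {rel : W → ℤ} {K : ℤ}
    {D : Loc W} (h : LocalOK A f g (fun v => - rel v) K D) : LocalOK A f g rel K (D.rot K) := by
  have hsp : ∀ e, Sp A f g rel (D.rot K) e → Sp A f g (fun v => - rel v) D e.neg := by
    rintro e (⟨v, h1, h2, h3, rfl⟩ | ⟨v, h1, h2, h3, h4, rfl⟩)
    · left
      exact ⟨v, by (try dsimp only at *); omega, h2, h3, Ed.neg_neg _⟩
    · right; exact ⟨v, by (try dsimp only at *); omega, h2, h3, h4, Ed.neg_neg _⟩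
  have hnm : ∀ e, Nm A g rel (D.rot K) e → Nm A g (fun v => - rel v) D e := by
    rintro e ⟨h1, h2, h3⟩
    refine ⟨h1, h2, h3.imp ?_ ?_⟩
    · rintro ⟨a, b⟩; exact ⟨by (try dsimp only at *); omega, b⟩
    · rintro ⟨a, b⟩; exact ⟨by (try dsimp only at *); omega, by (try dsimp only at *); omega⟩
  have henv : ∀ κx κy lo, Env g rel (D.rot K) K κx κy lo →
      Env g (fun v => - rel v) D K (fun v => - κx v) (fun v => - κy v) (-lo - K) := by
    intro κx κy lo hE
    refine ⟨hE.ex.rot, hE.ey.rot, ?_⟩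
    intro u w hu hw
    have h1 := hE.co u w (by (try dsimp only at *); omega) (by (try dsimp only at *); omega)
    have h2 : κx u ≠ κx w := fun h => by have := hE.ex.inj h; subst this; omega
    have h3 : κy u ≠ κy w := fun h => by have := hE.ey.inj h; subst this; omega
    omega
  constructor
  · intro v h1 h2
    have := h.bx v (by (try dsimp only at *); omega) (by simp [Loc.rot] at h2; omega)
    simp [Loc.rot]; omega
  · intro v h1 h2
    have := h.by' v (by (try dsimp only at *); omega) (by simp [Loc.rot] at h2; omega)
    simp [Loc.rot]; omega
  · intro u v h1 h2 h3 h4 h5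
    simp [Loc.rot] at h3 h4 h5
    exact h.ix u v (by (try dsimp only at *); omega) (by (try dsimp only at *); omega) h3 h4 h5
  · intro u v h1 h2 h3 h4 h5
    simp [Loc.rot] at h3 h4 h5
    exact h.iy u v (by (try dsimp only at *); omega) (by (try dsimp only at *); omega) h3 h4 h5
  · intro v h1
    have := h.zv v (by (try dsimp only at *); omega)
    simp [Loc.rot]; omega
  · intro u v h1 h2 h3 h4
    simp [Loc.rot] at h3 h4
    exact h.zu u v (by (try dsimp only at *); omega) (by (try dsimp only at *); omega) h3 h4
  · intro v h1 h2
    have := h.z2 v (by (try dsimp only at *); omega) (by simp [Loc.rot] at h2; omega)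
    omega
  · intro v h1 h2
    have := h.z1 v (by (try dsimp only at *); omega) (by simp [Loc.rot] at h2; omega)
    omega
  · intro v h1
    exact ((D.df v).neg_ends).trans (h.ef v (by (try dsimp only at *); omega))
  · intro v h1 h2
    have := h.eg v (by (try dsimp only at *); omega) h2
    exact ⟨((D.dg v).neg_ends).trans this.1, by have := this.2; omega⟩
  · intro v h1 h2
    have := h.en v (by (try dsimp only at *); omega) h2
    simp [Loc.rot, this, Ed.neg]
  · intro e he u v ε h1
    have := h.sz _ (hsp e he) u v (-ε) (Ed.neg_steep _ (by rw [Ed.neg_neg, h1]))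
    simp [Loc.rot, this]
  · intro e he u v ε h1
    have := h.hz _ (hsp e he) u v (-ε) (Ed.neg_shal _ (by rw [Ed.neg_neg, h1]))
    simp [Loc.rot, this]
  · intro κx κy lo hE e he
    have := (h.val _ _ _ (henv _ _ _ hE) _ (hsp e he)).neg
    rwa [Ed.neg_neg] at this
  · intro κx κy lo hE e e' he he' hne
    have := (h.ss _ _ _ (henv _ _ _ hE) _ _ (hsp e he) (hsp e' he')
      (by rwa [Ed.neg_ends, Ed.neg_ends])).neg
    rwa [Ed.neg_neg, Ed.neg_neg] at this
  · intro κx κy lo hE e w he hw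
    have := h.sn _ _ _ (henv _ _ _ hE) _ w (hsp e he) (hnm w hw)
    have a := this.1.neg
    have b := this.2.neg
    rw [Ed.neg_neg] at a b
    exact ⟨a, b⟩
  · intro κx κy lo hE v h1 h2 h3 h4
    have := h.ch _ _ _ (henv _ _ _ hE) v h1 h2 h3 (by unfold Two at *; (try dsimp only at *); omega)
    unfold Out at *; (try dsimp only at *); omega
  · have := h.ct
    simp only [neg_eq_zero] at this
    simpa only [Loc.rot, Ed.neg_isS] using this
end

section
variable {W : Type}

/-- cyclic indexing of a block -/
structure Cyc [Fintype W] (f : Equiv.Perm W) (rel : W → ℤ) (c : W) (k : ℤ) (ix : W → ℤ) : Prop where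
  hk : 1 ≤ k
  kc : k ≤ Fintype.card W
  rc : rel c = 0
  i0 : ix c = 0
  rng : ∀ v, rel v = 0 → 0 ≤ ix v ∧ ix v < k
  st : ∀ v, rel v = 0 → f v ≠ c → ix (f v) = ix v + 1
  la : ix (f.symm c) = k - 1
  inj : ∀ u v, rel u = 0 → rel v = 0 → ix u = ix v → u = v
  cl : ∀ v, rel (f v) = 0 ↔ rel v = 0

lemma exists_cyc [Fintype W] (f : Equiv.Perm W) (rel : W → ℤ) (c : W)
    (hC : ∀ v, rel v = 0 ↔ f.SameCycle c v) : ∃ k ix, Cyc f rel c k ix := by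
  set k := Function.minimalPeriod f c with hk
  have hper : c ∈ Function.periodicPts f := by
    have := isOfFinOrder_of_finite f
    obtain ⟨n, hn, h⟩ := isOfFinOrder_iff_pow_eq_one.1 this
    refine ⟨n, hn, ?_⟩
    unfold Function.IsPeriodicPt Function.IsFixedPt
    rw [Equiv.Perm.iterate_eq_pow, h]; rfl
  have hkpos : 0 < k := Function.minimalPeriod_pos_of_mem_periodicPts hper
  have hkc : f^[k] c = c := Function.iterate_minimalPeriod
  have hinj : ∀ i j, i < k → j < k → f^[i] c = f^[j] c → i = j := by
    intro i j hi hj h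
    exact Function.iterate_injOn_Iio_minimalPeriod hi hj h
  have hex : ∀ v, f.SameCycle c v → ∃ i < k, f^[i] c = v := by
    intro v hv
    obtain ⟨i, -, hi⟩ := hv.exists_pow_eq'
    refine ⟨i % k, Nat.mod_lt _ hkpos, ?_⟩
    rw [Function.iterate_mod_minimalPeriod_eq, Equiv.Perm.iterate_eq_pow, hi]
  have hsc : ∀ i, f.SameCycle c (f^[i] c) := by
    intro i
    exact ⟨i, by rw [Equiv.Perm.iterate_eq_pow]; simp⟩
  choose! ix h1 h2 using hex
  have huniq : ∀ i, i < k → ix (f^[i] c) = i := by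
    intro i hi
    exact hinj _ _ (h1 _ (hsc i)) hi (h2 _ (hsc i))
  have hcl : ∀ v, rel (f v) = 0 ↔ rel v = 0 := by
    intro v; rw [hC, hC]; exact Equiv.Perm.sameCycle_apply_right
  refine ⟨k, fun v => ix v, ⟨by exact_mod_cast hkpos, ?_, (hC c).2 (Equiv.Perm.SameCycle.refl _ _),
    ?_, ?_, ?_, ?_, ?_, hcl⟩⟩
  · have : (Finset.univ.image (fun i : Fin k => f^[i] c)).card = k := by
      rw [Finset.card_image_of_injective, Finset.card_univ, Fintype.card_fin]
      intro i j h
      exact Fin.ext (hinj _ _ i.2 j.2 h)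
    have h3 := Finset.card_le_univ (Finset.univ.image (fun i : Fin k => f^[i] c))
    rw [this] at h3
    exact_mod_cast h3
  · have := huniq 0 hkpos
    simp at this; simp [this]
  · intro v hv
    have := h1 v ((hC v).1 hv)
    simp; exact this
  · intro v hv hne
    have hv := (hC v).1 hv
    have e1 := h2 v hv
    have l1 := h1 v hv
    by_cases hh : ix v + 1 < k
    · have := huniq (ix v + 1) hh
      rw [Function.iterate_succ_apply', e1] at this
      simp [this]
    · have : ix v + 1 = k := by omega
      exfalso; apply hne
      have e4 : f^[ix v + 1] c = c := by rw [this, hkc]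
      rwa [Function.iterate_succ_apply', e1] at e4
  · have : f^[k-1] c = f.symm c := by
      rw [Equiv.eq_symm_apply, ← Function.iterate_succ_apply' f]
      rw [show (k - 1).succ = k by omega, hkc]
    have h3 := huniq (k - 1) (by omega)
    rw [this] at h3
    simp only [h3]; omega
  · intro u v hu hv h
    have h : ix u = ix v := by exact_mod_cast h
    rw [← h2 u ((hC u).1 hu), ← h2 v ((hC v).1 hv), h]

namespace Cyc
variable [Fintype W] {f : Equiv.Perm W} {rel : W → ℤ} {c : W} {k : ℤ} {ix : W → ℤ}
lemma cl' (h : Cyc f rel c k ix) (v : W) : rel (f.symm v) = 0 ↔ rel v = 0 := by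
  rw [← h.cl (f.symm v)]; simp
lemma st' (h : Cyc f rel c k ix) (v : W) (hv : rel v = 0) (hne : v ≠ c) :
    ix (f.symm v) = ix v - 1 := by
  have := h.st (f.symm v) ((h.cl' v).2 hv) (by simpa using hne)
  simp at this; omega
lemma pos (h : Cyc f rel c k ix) (v : W) (hv : rel v = 0) (hne : v ≠ c) : 1 ≤ ix v := by
  have h1 := h.rng v hv
  have h2 : ix v ≠ 0 := fun h3 => hne (h.inj _ _ hv h.rc (by rw [h3, h.i0]))
  omega
lemma last (h : Cyc f rel c k ix) (v : W) (hv : rel v = 0) (hne : f v ≠ c) : ix v < k - 1 := by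
  have h1 := h.rng v hv
  have h2 : ix v ≠ k - 1 := fun h3 => by
    apply hne
    rw [h.inj v (f.symm c) hv ((h.cl' c).2 h.rc) (by rw [h3, h.la])]
    simp
  omega
end Cyc

lemma Opp.symm {X : W → ℤ} {c d d' : W} (h : Opp X c d d') : Opp X c d' d := by
  unfold Opp at *; omega

lemma compat_LL {X Y : W → ℤ} (hX : Function.Injective X) (hY : Function.Injective Y)
    {a b c d : W} (hab : a ≠ b) (hcd : c ≠ d)
    (co : b = c → (X a < X b ↔ Y a < Y b) ∧ (X a < X d ↔ Y a < Y d) ∧ (X b < X d ↔ Y b < Y d))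
    (h1 : a = c → Opp X a b d) (h2 : b = d → Opp Y b a c) :
    Compat X Y (Ed.L a b) (Ed.L c d) where
  c1 := by
    intro c' d₁ δ d' δ' e1 e2
    simp [Ed.hor] at e1 e2
    obtain ⟨rfl, rfl, -⟩ := e1
    obtain ⟨rfl, rfl, -⟩ := e2
    exact h1 rfl
  c2 := by
    intro c' d₁ δ d' δ' e1 e2
    simp [Ed.ver] at e1 e2
    obtain ⟨rfl, rfl, -⟩ := e1
    obtain ⟨rfl, rfl, -⟩ := e2
    exact h2 rfl
  c3 := by intro u v ε c d δ e1; simp [Ed.steep] at e1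
  c4 := by intro u v ε c d δ e1; simp [Ed.shal] at e1
  c5 := by intro u v ε c d δ e1; simp [Ed.steep] at e1
  c6 := by
    intro c₁ d₁ δ c' d' δ' e0 e1 e2 e3
    simp [Ed.hor, Ed.ver] at e1 e2
    obtain ⟨rfl, rfl, rfl⟩ := e1
    obtain ⟨rfl, rfl, rfl⟩ := e2
    have hXn : X a ≠ X d := fun h => e3 (hX h)
    have hYn : Y a ≠ Y d := fun h => e3 (hY h)
    obtain ⟨w, hw, hw'⟩ := e0
    simp [Ed.ends] at hw hw'
    have : a = c ∨ b = c ∨ b = d := by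
      rcases hw with rfl | rfl <;> rcases hw' with rfl | rfl <;> simp_all
    rcases this with rfl | rfl | rfl
    · have := h1 rfl
      unfold Opp Out at *; omega
    · have := co rfl
      have n1 : X b ≠ X d := fun h => hcd (hX h)
      have n2 : X a ≠ X b := fun h => hab (hX h)
      have n3 : Y b ≠ Y d := fun h => hcd (hY h)
      have n4 : Y a ≠ Y b := fun h => hab (hY h)
      unfold Out; omega
    · have := h2 rfl
      unfold Opp Out at *; omega

lemma compat_S {X Y : W → ℤ} (a b : W) (e : Ed W) : Compat X Y (Ed.S a b) e ∧
    Compat X Y e (Ed.S a b) := by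
  constructor <;> constructor <;> intros <;> simp_all [Ed.hor, Ed.ver, Ed.steep, Ed.shal]

lemma ch_com {X Y : W → ℤ} (hX : Function.Injective X) (hY : Function.Injective Y) {rel : W → ℤ}
    (com : ∀ u, rel u = 0 → ∀ w, (X u < X w ↔ Y u < Y w))
    {a b c : W} (hab : a ≠ b) (hbc : b ≠ c) (hac : a ≠ c) (h : Two rel a b c) :
    Out (X c) (X a) (X b) ∨ Out (Y a) (Y c) (Y b) := by
  have n1 : X b ≠ X c := fun h => hbc (hX h)
  have n2 : X a ≠ X b := fun h => hab (hX h)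
  have n3 : Y b ≠ Y c := fun h => hbc (hY h)
  have n4 : Y a ≠ Y b := fun h => hab (hY h)
  have n5 : X a ≠ X c := fun h => hac (hX h)
  have n6 : Y a ≠ Y c := fun h => hac (hY h)
  unfold Two at h
  unfold Out
  rcases h with ⟨h1, h2⟩ | ⟨h1, h2⟩ | ⟨h1, h2⟩
  · have := com a h1 b; have := com a h1 c; have := com b h2 c; omega
  · have := com a h1 b; have := com a h1 c; have := com c h2 b; omega
  · have := com b h1 a; have := com b h1 c; have := com c h2 a; omega

lemma Env.com [Fintype W] {g : Equiv.Perm W} {rel : W → ℤ} {D : Loc W} {K : ℤ} {κx κy : W → ℤ}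
    {lo : ℤ} (hE : Env g rel D K κx κy lo) (hp : ∀ v, rel v = 0 → D.px v = D.py v)
    (bx : ∀ v, rel v = 0 → D.zone v = 0 → 0 < D.px v ∧ D.px v < K)
    (zv : ∀ v, rel v = 0 → D.zone v = 0 ∨ D.zone v = 1 ∨ D.zone v = -1)
    (zu : ∀ u v, rel u = 0 → rel v = 0 → D.zone u ≠ 0 → D.zone v ≠ 0 → u = v) :
    ∀ u, rel u = 0 → ∀ w, (κx u < κx w ↔ κy u < κy w) := by
  intro u hu w
  by_cases hw : rel w = 0
  · by_cases hzu : D.zone u = 0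
    · have b1 := bx u hu hzu
      have e1 := hE.ex.z0 u hu hzu
      have e2 := hE.ey.z0 u hu hzu
      have := hp u hu
      rcases zv w hw with h | h | h
      · have := hE.ex.z0 w hw h
        have := hE.ey.z0 w hw h
        have := hp w hw
        omega
      · have := hE.ex.fR1 w hw h
        have := hE.ey.fR1 w hw h
        omega
      · have := hE.ex.fL1 w hw h
        have := hE.ey.fL1 w hw h
        omega
    · by_cases hzw : D.zone w = 0
      · have b1 := bx w hw hzw
        have e1 := hE.ex.z0 w hw hzw
        have e2 := hE.ey.z0 w hw hzw
        have := hp w hw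
        rcases zv u hu with h | h | h
        · exact absurd h hzu
        · have := hE.ex.fR1 u hu h
          have := hE.ey.fR1 u hu h
          omega
        · have := hE.ex.fL1 u hu h
          have := hE.ey.fL1 u hu h
          omega
      · rw [zu u w hu hw hzu hzw]; simp
  · exact hE.co u w hu hw

/-- configurations with only straight and L-shaped edges -/
structure LConf [Fintype W] (A : W → Prop) (f g : Equiv.Perm W) (rel : W → ℤ) (K : ℤ)
    (D : Loc W) : Prop where
  hp : D.px = D.py
  hz : ∀ v, D.zone v = 0
  bx : ∀ v, rel v = 0 → 0 < D.px v ∧ D.px v < K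
  ix : ∀ u v, rel u = 0 → rel v = 0 → D.px u = D.px v → u = v
  ef : ∀ v, rel v = 0 → (D.df v).ends = s(v, f v)
  eg : ∀ v, rel v = 0 → ¬ D.nm v → (D.dg v).ends = s(v, g v) ∧ rel (g v) = 0
  en : ∀ v, rel v = 0 → D.nm v → D.dg v = Ed.L v (g v)
  sh : ∀ e, Sp A f g rel D e → 
    (∃ a b, e = .S a b ∧ rel a = 0 ∧ rel b = 0 ∧ a ≠ b ∧
      ∀ w, rel w = 0 → ¬ Btwn (D.px a) (D.px w) (D.px b)) ∨
    (∃ a b, e = .L a b ∧ rel a = 0 ∧ rel b = 0 ∧ a ≠ b)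
  pr : ∀ κ lo, Env1 g rel D.px D.zone K κ lo → ∀ a b c d, Sp A f g rel D (.L a b) →
    Sp A f g rel D (.L c d) → s(a, b) ≠ s(c, d) → (a = c → Opp κ a b d) ∧ (b = d → Opp κ b a c)
  pn : ∀ κ lo, Env1 g rel D.px D.zone K κ lo → ∀ a b, Sp A f g rel D (.L a b) →
    (Nm A g rel D a → Opp κ a b (g a)) ∧ (∀ w, Nm A g rel D w → g w = b → Opp κ b a w)
  ct : 4 * cnt (fun v => rel v = 0 ∧ A v ∧ A (f v) ∧ ¬ (D.df v).isS) ≤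
    3 * cnt (fun v => rel v = 0 ∧ A v ∧ A (f v))

lemma LConf.ok [Fintype W] {A : W → Prop} {f g : Equiv.Perm W} {rel : W → ℤ} {K : ℤ}
    {D : Loc W} (H : Hyp A f g) (h : LConf A f g rel K D) : LocalOK A f g rel K D := by
  have hcom : ∀ κx κy lo, Env g rel D K κx κy lo →
      ∀ u, rel u = 0 → ∀ w, (κx u < κx w ↔ κy u < κy w) := by
    intro κx κy lo hE
    exact hE.com (fun v _ => by rw [h.hp]) (fun v hv _ => h.bx v hv) (fun v _ => Or.inl (h.hz v))
      (fun u v _ _ hu => absurd (h.hz u) hu)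
  constructor
  · intro v hv _; exact h.bx v hv
  · intro v hv _; rw [← h.hp]; exact h.bx v hv
  · intro u v hu hv _ _; exact h.ix u v hu hv
  · intro u v hu hv _ _; rw [← h.hp]; exact h.ix u v hu hv
  · intro v _; left; exact h.hz v
  · intro u v _ _ hu; exact absurd (h.hz u) hu
  · intro v _ hv; rw [h.hz] at hv; omega
  · intro v _ hv; rw [h.hz] at hv; omega
  · exact h.ef
  · exact h.eg
  · exact h.en
  · intro e _ u v ε _; exact h.hz u
  · intro e _ u v ε _; exact ⟨h.hz u, h.hz v⟩
  · intro κx κy lo hE e he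
    rcases h.sh e he with ⟨a, b, rfl, ha, hb, hab, hw⟩ | ⟨a, b, rfl, ha, hb, hab⟩
    · refine ⟨hab, fun w => ?_⟩
      have b1 := h.bx a ha
      have b2 := h.bx b hb
      have e1 := hE.ex.z0 a ha (h.hz a)
      have e2 := hE.ey.z0 a ha (h.hz a)
      have e3 := hE.ex.z0 b hb (h.hz b)
      have e4 := hE.ey.z0 b hb (h.hz b)
      rw [← h.hp] at e2 e4
      by_cases hw0 : rel w = 0
      · have := hw w hw0
        have e5 := hE.ex.z0 w hw0 (h.hz w)
        have e6 := hE.ey.z0 w hw0 (h.hz w)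
        rw [← h.hp] at e6
        unfold Btwn at *; omega
      · have e5 := hE.ex.out w hw0
        have e6 := hE.ey.out w hw0
        unfold Btwn at *; omega
    · exact hab
  · intro κx κy lo hE e e' he he' hne
    rcases h.sh e he with ⟨a, b, rfl, -⟩ | ⟨a, b, rfl, ha, hb, hab⟩
    · exact (compat_S _ _ _).1
    rcases h.sh e' he' with ⟨c, d, rfl, -⟩ | ⟨c, d, rfl, hc, hd, hcd⟩
    · exact (compat_S _ _ _).2
    have h1 := h.pr κx lo hE.ex a b c d he he' hne
    have h2 := h.pr κy lo (by rw [h.hp]; exact hE.ey) a b c d he he' hne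
    have hc := hcom _ _ _ hE
    exact compat_LL hE.ex.inj hE.ey.inj hab hcd
      (fun _ => ⟨hc a ha b, hc a ha d, hc b hb d⟩) h1.1 h2.2
  · intro κx κy lo hE e w he hw
    rcases h.sh e he with ⟨a, b, rfl, -⟩ | ⟨a, b, rfl, ha, hb, hab⟩
    · exact compat_S _ _ _
    have h1 := h.pn κx lo hE.ex a b he
    have h2 := h.pn κy lo (by rw [h.hp]; exact hE.ey) a b he
    have hc := hcom _ _ _ hE
    have hgw : w ≠ g w := (H.g1 w hw.1 hw.2.1).symm
    constructor
    · refine compat_LL hE.ex.inj hE.ey.inj hab hgw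
        (fun _ => ⟨hc a ha b, hc a ha (g w), hc b hb (g w)⟩) ?_ ?_
      · rintro rfl; exact h1.1 hw
      · intro hb; exact h2.2 w hw hb.symm
    · refine compat_LL hE.ex.inj hE.ey.inj hgw hab
        (fun h => ?_) ?_ ?_
      · rw [h]
        have s1 := hc a ha w
        have s2 := hc b hb w
        have n : ∀ u v, u ≠ v → κx u ≠ κx v ∧ κy u ≠ κy v := fun u v h =>
          ⟨fun h' => h (hE.ex.inj h'), fun h' => h (hE.ey.inj h')⟩
        have n1 := n w a (by rw [← h]; exact hgw)
        refine ⟨by omega, ?_, hc a ha b⟩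
        by_cases hwb : w = b
        · subst hwb; simp
        · have := n w b hwb; omega
      · rintro rfl; exact (h1.1 hw).symm
      · intro hb; rw [hb]; exact (h2.2 w hw hb).symm
  · intro κx κy lo hE v h1 h2 h3 h4
    exact ch_com hE.ex.inj hE.ey.inj (hcom _ _ _ hE) (H.g1 v h1 h2).symm (H.g1 _ h2 h3).symm
      (H.g2 v h1 h2).symm h4
  · exact h.ct
end

section
variable {W : Type}

lemma cnt_le_of [Fintype W] {P : W → Prop} (s : Finset W) (h : ∀ v, P v → v ∈ s) :
    cnt P ≤ s.card := by
  unfold cnt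
  apply Finset.card_le_card
  intro v hv
  simp at hv
  exact h v hv

lemma le_cnt_of [Fintype W] {P : W → Prop} (s : Finset W) (h : ∀ v ∈ s, P v) :
    s.card ≤ cnt P := by
  unfold cnt
  apply Finset.card_le_card
  intro v hv
  simp; exact h v hv

lemma three_card {a b c : W} (h1 : a ≠ b) (h2 : a ≠ c) (h3 : b ≠ c) : ({a, b, c} : Finset W).card = 3 := by
  rw [Finset.card_eq_three]; exact ⟨a, b, c, h1, h2, h3, rfl⟩

/-- common facts for a block all of whose vertices are original -/
structure Blk [Fintype W] (A : W → Prop) (f g : Equiv.Perm W) (rel : W → ℤ) (c : W) (k : ℤ)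
    (ix : W → ℤ) (K : ℤ) : Prop extends Cyc f rel c k ix where
  H : Hyp A f g
  hA : ∀ v, rel v = 0 → A v
  hK : 2 * k + 4 ≤ K

namespace Blk
variable [Fintype W] {A : W → Prop} {f g : Equiv.Perm W} {rel : W → ℤ} {c : W} {k : ℤ}
    {ix : W → ℤ} {K : ℤ}

lemma f1 (h : Blk A f g rel c k ix K) (v : W) (hv : rel v = 0) : f v ≠ v :=
  h.H.f1 v (h.hA v hv) (h.hA _ ((h.cl v).2 hv))
lemma f2 (h : Blk A f g rel c k ix K) (v : W) (hv : rel v = 0) : f (f v) ≠ v :=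
  h.H.f2 v (h.hA v hv) (h.hA _ ((h.cl v).2 hv))
lemma f1' (h : Blk A f g rel c k ix K) (v : W) (hv : rel v = 0) : f.symm v ≠ v := by
  have := h.f1 (f.symm v) ((h.cl' v).2 hv); simp at this; exact fun h => this h.symm
lemma f2' (h : Blk A f g rel c k ix K) (v : W) (hv : rel v = 0) : f v ≠ f.symm v := by
  intro e
  have := h.f2 v hv
  rw [e] at this; simp at this
lemma fg (h : Blk A f g rel c k ix K) (v : W) (hv : rel v = 0) : g v ≠ f v :=
  h.H.fg v (h.hA v hv) (h.hA _ ((h.cl v).2 hv))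
lemma fg' (h : Blk A f g rel c k ix K) (v : W) (hv : rel v = 0) : g v ≠ f.symm v := by
  have := h.H.gf (f.symm v) (h.hA _ ((h.cl' v).2 hv)) (by simpa using h.hA v hv)
  simpa using this

lemma ct2 (h : Blk A f g rel c k ix K) {D : Loc W} {a b : W}
    (hD : ∀ v, rel v = 0 → v ≠ a → v ≠ b → (D.df v).isS) :
    4 * cnt (fun v => rel v = 0 ∧ A v ∧ A (f v) ∧ ¬ (D.df v).isS) ≤
    3 * cnt (fun v => rel v = 0 ∧ A v ∧ A (f v)) := by
  have h1 : cnt (fun v => rel v = 0 ∧ A v ∧ A (f v) ∧ ¬ (D.df v).isS) ≤ 2 := by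
    refine (cnt_le_of {a, b} ?_).trans Finset.card_le_two
    rintro v ⟨h1, -, -, h2⟩
    by_contra h3
    simp at h3
    exact h2 (hD v h1 h3.1 h3.2)
  have h2 : 3 ≤ cnt (fun v => rel v = 0 ∧ A v ∧ A (f v)) := by
    rw [← three_card (h.f1 c h.rc) (h.f2' c h.rc) (h.f1' c h.rc).symm]
    apply le_cnt_of
    intro v hv
    have hv : rel v = 0 := by
      simp at hv
      rcases hv with rfl | rfl | rfl
      · exact (h.cl _).2 h.rc
      · exact h.rc
      · exact (h.cl' _).2 h.rc
    exact ⟨hv, h.hA v hv, h.hA _ ((h.cl v).2 hv)⟩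
  omega
end Blk

def trivD (f g : Equiv.Perm W) (ix : W → ℤ) : Loc W where
  px := fun v => 2 * ix v + 2
  py := fun v => 2 * ix v + 2
  zone := fun _ => 0
  df := fun v => .S v (f v)
  dg := fun v => .L v (g v)
  nm := fun _ => True

lemma triv_ok [Fintype W] {A : W → Prop} {f g : Equiv.Perm W} {rel : W → ℤ} {K : ℤ} {c : W} {k : ℤ}
    {ix : W → ℤ} (H : Hyp A f g) (h : Cyc f rel c k ix) (hK : 2 * k + 4 ≤ K) (hc : ¬ A c) :
    LocalOK A f g rel K (trivD f g ix) := by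
  apply LConf.ok H
  constructor
  · rfl
  · intro v; rfl
  · intro v hv; have := h.rng v hv; simp [trivD]; omega
  · intro u v hu hv e; simp [trivD] at e; exact h.inj u v hu hv e
  · intro v hv; rfl
  · intro v hv h1; exact absurd trivial h1
  · intro v hv _; rfl
  · rintro e (⟨v, h1, h2, h3, rfl⟩ | ⟨v, h1, h2, -⟩)
    · left
      refine ⟨v, f v, rfl, h1, (h.cl v).2 h1, (H.f1 v h2 h3).symm, fun w hw => ?_⟩
      have := h.st v h1 (by rintro e; exact hc (e ▸ h3))
      simp [trivD]; unfold Btwn; omega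
    · exact absurd trivial h2
  · rintro κ lo - a b c d (⟨v, h1, h2, h3, e⟩ | ⟨v, h1, h2, -⟩)
    · simp [trivD] at e
    · exact absurd trivial h2
  · rintro κ lo - a b (⟨v, h1, h2, h3, e⟩ | ⟨v, h1, h2, -⟩)
    · simp [trivD] at e
    · exact absurd trivial h2
  · have : cnt (fun v => rel v = 0 ∧ A v ∧ A (f v) ∧ ¬ ((trivD f g ix).df v).isS) = 0 := by
      have := cnt_le_of (P := fun v => rel v = 0 ∧ A v ∧ A (f v) ∧ ¬ ((trivD f g ix).df v).isS) ∅
        (by rintro v ⟨-, -, -, h⟩; simp [trivD, Ed.isS] at h)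
      simpa using this
    omega

/-- adjacent `P`,`S` -/
def lb1D (f g : Equiv.Perm W) (ix : W → ℤ) (c : W) : Loc W where
  px := fun v => 2 * ix v + 2
  py := fun v => 2 * ix v + 2
  zone := fun _ => 0
  df := fun v => if v = f.symm c then .L c v else .S v (f v)
  dg := fun v => .L v (g v)
  nm := fun _ => True

lemma lb1_ok [Fintype W] {A : W → Prop} {f g : Equiv.Perm W} {rel : W → ℤ} {K : ℤ} {c : W} {k : ℤ}
    {ix : W → ℤ} (h : Blk A f g rel c k ix K) (h1 : rel (g c) < 0)
    (h2 : 0 < rel (g.symm (f.symm c))) : LocalOK A f g rel K (lb1D f g ix c) := by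
  have hL : ∀ a b, Sp A f g rel (lb1D f g ix c) (.L a b) → a = c ∧ b = f.symm c := by
    rintro a b (⟨v, h1, h2, h3, e⟩ | ⟨v, h1, h2, -⟩)
    · simp only [lb1D] at e
      split_ifs at e with hv
      · simp at e; exact ⟨e.1, e.2.trans hv⟩
    · exact absurd trivial h2
  have hq : rel (f.symm c) = 0 := (h.cl' c).2 h.rc
  have h3 := h.la
  have h4 := h.i0
  have h6 : 1 ≤ ix (f.symm c) := h.pos _ hq (h.f1' c h.rc)
  apply LConf.ok h.H
  constructor
  · rfl
  · intro v; rfl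
  · intro v hv; have := h.rng v hv; have := h.hK; simp [lb1D]; omega
  · intro u v hu hv e; simp [lb1D] at e; exact h.inj u v hu hv e
  · intro v hv
    simp only [lb1D]
    split_ifs with e
    · subst e; simp [Ed.ends, Sym2.eq_swap]
    · rfl
  · intro v hv h1; exact absurd trivial h1
  · intro v hv _; rfl
  · rintro e (⟨v, h1, h2, h3, rfl⟩ | ⟨v, h1, h2, -⟩)
    · simp only [lb1D]
      split_ifs with e
      · right; subst e; exact ⟨_, _, rfl, h.rc, h1, (h.f1' c h.rc).symm⟩
      left
      refine ⟨v, f v, rfl, h1, (h.cl v).2 h1, (h.f1 v h1).symm, fun w hw => ?_⟩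
      have := h.st v h1 (by rintro e'; apply e; rw [← e']; simp)
      unfold Btwn; omega
    · exact absurd trivial h2
  · intro κ lo hE a b c' d e1 e2 e3
    obtain ⟨rfl, rfl⟩ := hL _ _ e1
    obtain ⟨rfl, rfl⟩ := hL _ _ e2
    exact absurd rfl e3
  · intro κ lo hE a b e1
    obtain ⟨rfl, rfl⟩ := hL _ _ e1
    have k1 := hE.oE a h.rc h1
    have k2 := hE.z0 a h.rc rfl
    have k3 := hE.z0 _ hq rfl
    simp only [lb1D] at k2 k3
    constructor
    · intro _; unfold Opp; omega
    · rintro w - hw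
      have : g.symm (f.symm a) = w := by rw [← hw]; simp
      rw [this] at h2
      have k4 := hE.iL w (by rw [hw]; exact hq) h2
      have := h.rng _ hq
      have := h.hK
      unfold Opp; omega
  · refine h.ct2 (a := f.symm c) (b := f.symm c) ?_
    intro v _ hv _
    simp [lb1D, hv, Ed.isS]
end

section
variable {W : Type}

def Share (e e' : Ed W) : Prop := ∃ w, w ∈ e.ends ∧ w ∈ e'.ends

lemma compat_HL {X Y : W → ℤ} {u v w t : W} {ε : ℤ} (h1 : u = w → Opp X u v t)
    (h3 : Btwn (Y u) (Y w) (Y v) → Avoid (4 * X w) (4 * X t) (4 * X v) ε)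
    (h6 : (u = w ∨ v = w ∨ v = t) → u ≠ t →
      Out (4 * X t) (4 * X u) (4 * X v + ε) ∨ Out (4 * Y u) (4 * Y t) (4 * Y w)) :
    Compat X Y (.H u v ε) (.L w t) := by
  constructor
  · intro c d δ d' δ' e1 e2
    simp [Ed.hor] at e1 e2
    obtain ⟨rfl, rfl, rfl⟩ := e1
    obtain ⟨rfl, rfl, rfl⟩ := e2
    exact h1 rfl
  · intro c d δ d' δ' e1; simp [Ed.ver] at e1
  · intro u' v' ε' c d δ e1 e2
    simp [Ed.hor, Ed.steep] at e1 e2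
    obtain ⟨rfl, rfl, rfl⟩ := e1
    obtain ⟨rfl, rfl, rfl⟩ := e2
    simpa using h3
  · intro u' v' ε' c d δ e1; simp [Ed.shal] at e1
  · intro u' v' ε' c d δ e1 e2; simp [Ed.shal] at e2
  · intro c d δ c' d' δ' e0 e1 e2 e3
    simp [Ed.hor, Ed.ver] at e1 e2
    obtain ⟨rfl, rfl, rfl⟩ := e1
    obtain ⟨rfl, rfl, rfl⟩ := e2
    have : u = w ∨ v = w ∨ v = t := by
      obtain ⟨x, hw, hw'⟩ := e0
      simp [Ed.ends] at hw hw'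
      rcases hw with rfl | rfl <;> rcases hw' with rfl | rfl <;> simp_all
    simpa using h6 this e3

lemma compat_LH {X Y : W → ℤ} {u v w t : W} {ε : ℤ} (h1 : u = w → Opp X u v t) :
    Compat X Y (.L w t) (.H u v ε) := by
  constructor
  · intro c d δ d' δ' e1 e2
    simp [Ed.hor] at e1 e2
    obtain ⟨rfl, rfl, rfl⟩ := e1
    obtain ⟨rfl, rfl, rfl⟩ := e2
    exact (h1 rfl).symm
  · intro c d δ d' δ' e1 e2; simp [Ed.ver] at e2
  · intro u' v' ε' c d δ e1 e2; simp [Ed.steep] at e1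
  · intro u' v' ε' c d δ e1; simp [Ed.shal] at e1
  · intro u' v' ε' c d δ e1 e2; simp [Ed.shal] at e2
  · intro c d δ c' d' δ' e0 e1 e2 e3; simp [Ed.ver] at e2

lemma compat_VL {X Y : W → ℤ} {u v w t : W} {ε : ℤ} (h1 : u = t → Opp Y u v w)
    (h4 : Btwn (X u) (X t) (X v) → Avoid (4 * Y t) (4 * Y w) (4 * Y v) ε) :
    Compat X Y (.V u v ε) (.L w t) := by
  constructor
  · intro c d δ d' δ' e1 e2; simp [Ed.hor] at e1
  · intro c d δ d' δ' e1 e2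
    simp [Ed.ver] at e1 e2
    obtain ⟨rfl, rfl, rfl⟩ := e1
    obtain ⟨rfl, rfl, rfl⟩ := e2
    exact h1 rfl
  · intro u' v' ε' c d δ e1 e2; simp [Ed.steep] at e1
  · intro u' v' ε' c d δ e1 e2
    simp [Ed.ver, Ed.shal] at e1 e2
    obtain ⟨rfl, rfl, rfl⟩ := e1
    obtain ⟨rfl, rfl, rfl⟩ := e2
    simpa using h4
  · intro u' v' ε' c d δ e1 e2; simp [Ed.shal] at e2
  · intro c d δ c' d' δ' e0 e1 e2 e3; simp [Ed.hor] at e1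

lemma compat_LV {X Y : W → ℤ} {u v w t : W} {ε : ℤ} (h1 : u = t → Opp Y u v w)
    (h6 : (w = v ∨ t = u ∨ t = v) → w ≠ u →
      Out (4 * X u) (4 * X w) (4 * X t) ∨ Out (4 * Y w) (4 * Y u) (4 * Y v + ε)) :
    Compat X Y (.L w t) (.V u v ε) := by
  constructor
  · intro c d δ d' δ' e1 e2; simp [Ed.hor] at e2
  · intro c d δ d' δ' e1 e2
    simp [Ed.ver] at e1 e2
    obtain ⟨rfl, rfl, rfl⟩ := e1
    obtain ⟨rfl, rfl, rfl⟩ := e2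
    exact (h1 rfl).symm
  · intro u' v' ε' c d δ e1 e2; simp [Ed.steep] at e1
  · intro u' v' ε' c d δ e1 e2; simp [Ed.shal] at e1
  · intro u' v' ε' c d δ e1 e2; simp [Ed.steep] at e1
  · intro c d δ c' d' δ' e0 e1 e2 e3
    simp [Ed.hor, Ed.ver] at e1 e2
    obtain ⟨rfl, rfl, rfl⟩ := e1
    obtain ⟨rfl, rfl, rfl⟩ := e2
    have : w = v ∨ t = u ∨ t = v := by
      obtain ⟨x, hw, hw'⟩ := e0
      simp [Ed.ends] at hw hw'
      rcases hw with rfl | rfl <;> rcases hw' with rfl | rfl <;> simp_all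
    simpa using h6 this e3

lemma compat_HH {X Y : W → ℤ} {u v u' v' : W} {ε ε' : ℤ} (h1 : u = u' → Opp X u v v')
    (h3 : Btwn (Y u) (Y u') (Y v) → Avoid (4 * X u') (4 * X v' + ε') (4 * X v) ε) :
    Compat X Y (.H u v ε) (.H u' v' ε') := by
  constructor
  · intro c d δ d' δ' e1 e2
    simp [Ed.hor] at e1 e2
    obtain ⟨rfl, rfl, rfl⟩ := e1
    obtain ⟨rfl, rfl, rfl⟩ := e2
    exact h1 rfl
  · intro c d δ d' δ' e1; simp [Ed.ver] at e1
  · intro u' v' ε' c d δ e1 e2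
    simp [Ed.hor, Ed.steep] at e1 e2
    obtain ⟨rfl, rfl, rfl⟩ := e1
    obtain ⟨rfl, rfl, rfl⟩ := e2
    exact h3
  · intro u' v' ε' c d δ e1; simp [Ed.shal] at e1
  · intro u' v' ε' c d δ e1 e2; simp [Ed.shal] at e2
  · intro c d δ c' d' δ' e0 e1 e2 e3; simp [Ed.ver] at e2

lemma compat_HV {X Y : W → ℤ} {u v u' v' : W} {ε ε' : ℤ}
    (h5 : v ≠ v' → Out (X v) (X u') (X v') ∨ Out (Y v') (Y u) (Y v))
    (h6 : u ≠ u' → Out (4 * X u') (4 * X u) (4 * X v + ε) ∨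
      Out (4 * Y u) (4 * Y u') (4 * Y v' + ε')) :
    Compat X Y (.H u v ε) (.V u' v' ε') := by
  constructor
  · intro c d δ d' δ' e1 e2; simp [Ed.hor] at e2
  · intro c d δ d' δ' e1; simp [Ed.ver] at e1
  · intro u' v' ε' c d δ e1 e2; simp [Ed.hor] at e2
  · intro u' v' ε' c d δ e1; simp [Ed.shal] at e1
  · intro u' v' ε' c d δ e1 e2
    simp [Ed.shal, Ed.steep] at e1 e2
    obtain ⟨rfl, rfl, rfl⟩ := e1
    obtain ⟨rfl, rfl, rfl⟩ := e2
    exact h5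
  · intro c d δ c' d' δ' e0 e1 e2 e3
    simp [Ed.hor, Ed.ver] at e1 e2
    obtain ⟨rfl, rfl, rfl⟩ := e1
    obtain ⟨rfl, rfl, rfl⟩ := e2
    exact h6 e3

lemma compat_VH {X Y : W → ℤ} {u v u' v' : W} {ε ε' : ℤ} :
    Compat X Y (.V u v ε) (.H u' v' ε') := by
  constructor <;> intros <;> simp_all [Ed.hor, Ed.ver, Ed.steep, Ed.shal]

/-- isolated block -/
def isoD (f g : Equiv.Perm W) (ix : W → ℤ) (c : W) : Loc W where
  px := fun v => 2 * ix v + 2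
  py := fun v => 2 * ix v + 2
  zone := fun _ => 0
  df := fun v => if v = f.symm c then .H c v 1 else .S v (f v)
  dg := fun v => if v = c then .V (g c) c 1 else .L v (g v)
  nm := fun v => v ≠ c

lemma iso_ok [Fintype W] {A : W → Prop} {f g : Equiv.Perm W} {rel : W → ℤ} {K : ℤ} {c : W} {k : ℤ}
    {ix : W → ℤ} (h : Blk A f g rel c k ix K) (hg : ∀ v, rel v = 0 → rel (g v) = 0)
    (hg' : ∀ v, rel (g v) = 0 → rel v = 0) : LocalOK A f g rel K (isoD f g ix c) := by
  have hq : rel (f.symm c) = 0 := (h.cl' c).2 h.rc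
  have hsr : rel (g c) = 0 := hg c h.rc
  have hcq : c ≠ f.symm c := (h.f1' c h.rc).symm
  have hsq : g c ≠ f.symm c := h.fg' c h.rc
  have hsc : g c ≠ c := h.H.g1 c (h.hA c h.rc) (h.hA _ hsr)
  have i0 := h.i0
  have iq := h.la
  have hsp : ∀ e, Sp A f g rel (isoD f g ix c) e → (∃ v, e = .S v (f v) ∧ rel v = 0 ∧ f v ≠ c) ∨
      e = .H c (f.symm c) 1 ∨ e = .V (g c) c 1 := by
    rintro e (⟨v, h1, h2, h3, rfl⟩ | ⟨v, h1, h2, h3, h4, rfl⟩)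
    · simp only [isoD]
      split_ifs with e
      · right; left; rw [e]
      · left; exact ⟨v, rfl, h1, fun h => e (by rw [← h]; simp)⟩
    · simp [isoD] at h2
      subst h2
      simp [isoD]
  have hnm : ∀ w, Nm A g rel (isoD f g ix c) w → rel w = 0 ∧ rel (g w) = 0 ∧ w ≠ c := by
    rintro w ⟨-, -, ⟨a, b⟩ | ⟨a, b⟩⟩
    · exact ⟨a, hg _ a, b⟩
    · exact absurd (hg' _ b) a
  have hcom : ∀ κx κy lo, Env g rel (isoD f g ix c) K κx κy lo →
      ∀ u, rel u = 0 → ∀ w, (κx u < κx w ↔ κy u < κy w) := by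
    intro κx κy lo hE
    have hK := h.hK
    exact hE.com (fun v _ => rfl) (fun v hv _ => by
      have := h.rng v hv; simp [isoD]; omega) (fun v _ => Or.inl rfl)
      (fun u v _ _ hu => absurd rfl hu)
  have hK := h.hK
  constructor
  · intro v hv _; have := h.rng v hv; simp [isoD]; omega
  · intro v hv _; have := h.rng v hv; simp [isoD]; omega
  · intro u v hu hv _ _ e; simp [isoD] at e; exact h.inj u v hu hv e
  · intro u v hu hv _ _ e; simp [isoD] at e; exact h.inj u v hu hv e
  · intro v _; left; rfl
  · intro u v _ _ hu; exact absurd rfl hu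
  · intro v _ hv; simp [isoD] at hv
  · intro v _ hv; simp [isoD] at hv
  · intro v hv
    simp only [isoD]
    split_ifs with e
    · subst e; simp [Ed.ends, Sym2.eq_swap]
    · rfl
  · intro v hv h1
    simp [isoD] at h1
    subst h1
    refine ⟨?_, hsr⟩
    simp [isoD, Ed.ends, Sym2.eq_swap]
  · intro v hv h1
    have h1 : v ≠ c := h1
    simp [isoD, h1]
  · intro e _ u v ε _; rfl
  · intro e _ u v ε _; exact ⟨rfl, rfl⟩
  · intro κx κy lo hE e he
    have zx : ∀ w, rel w = 0 → κx w = lo + (2 * ix w + 2) := fun w hw => hE.ex.z0 w hw rfl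
    have zy : ∀ w, rel w = 0 → κy w = lo + (2 * ix w + 2) := fun w hw => hE.ey.z0 w hw rfl
    rcases hsp e he with ⟨v, rfl, hv, hfv⟩ | rfl | rfl
    · refine ⟨(h.f1 v hv).symm, fun w => ?_⟩
      have e0 := h.st v hv hfv
      have r1 := h.rng v hv
      have hv' := (h.cl v).2 hv
      have r2 := h.rng _ hv'
      have e1 := zx v hv; have e2 := zy v hv
      have e3 := zx _ hv'; have e4 := zy _ hv'
      by_cases hw0 : rel w = 0
      · have e5 := zx w hw0; have e6 := zy w hw0
        unfold Btwn at *; omega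
      · have e5 := hE.ex.out w hw0
        have e6 := hE.ey.out w hw0
        unfold Btwn at *; omega
    · exact ⟨hcq, Or.inl rfl⟩
    · exact ⟨hsc, Or.inl rfl⟩
  · intro κx κy lo hE e e' he he' hne
    have zx : ∀ w, rel w = 0 → κx w = lo + (2 * ix w + 2) := fun w hw => hE.ex.z0 w hw rfl
    have zy : ∀ w, rel w = 0 → κy w = lo + (2 * ix w + 2) := fun w hw => hE.ey.z0 w hw rfl
    have := zx c h.rc; have := zy c h.rc; have := zx _ hq; have := zy _ hq
    have := zx _ hsr; have := zy _ hsr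
    have := h.rng _ hsr
    have n1 : ix (g c) ≠ ix (f.symm c) := fun e => hsq (h.inj _ _ hsr hq e)
    have n2 := h.pos _ hsr hsc
    rcases hsp e he with ⟨v, rfl, hv, hfv⟩ | rfl | rfl
    · exact (compat_S _ _ _).1
    · rcases hsp e' he' with ⟨v, rfl, hv, hfv⟩ | rfl | rfl
      · exact (compat_S _ _ _).2
      · exact absurd rfl hne
      · apply compat_HV
        · intro _; left; unfold Out; omega
        · intro _; right; unfold Out; omega
    · rcases hsp e' he' with ⟨v, rfl, hv, hfv⟩ | rfl | rfl
      · exact (compat_S _ _ _).2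
      · exact compat_VH
      · exact absurd rfl hne
  · intro κx κy lo hE e w he hw
    have zx : ∀ w, rel w = 0 → κx w = lo + (2 * ix w + 2) := fun w hw => hE.ex.z0 w hw rfl
    have zy : ∀ w, rel w = 0 → κy w = lo + (2 * ix w + 2) := fun w hw => hE.ey.z0 w hw rfl
    have := zx c h.rc; have := zy c h.rc; have := zx _ hq; have := zy _ hq
    have := zx _ hsr; have := zy _ hsr
    have := h.rng _ hsr
    have n1 : ix (g c) ≠ ix (f.symm c) := fun e => hsq (h.inj _ _ hsr hq e)
    have n2 := h.pos _ hsr hsc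
    obtain ⟨w1, w2, w3⟩ := hnm w hw
    have := zx w w1; have := zy w w1; have := zx _ w2; have := zy _ w2
    have := h.rng w w1; have := h.rng _ w2; have n3 := h.pos w w1 w3
    rcases hsp e he with ⟨v, rfl, hv, hfv⟩ | rfl | rfl
    · exact compat_S _ _ _
    · constructor
      · apply compat_HL
        · intro e; exact absurd e.symm w3
        · intro _; unfold Avoid; left; omega
        · intro _ e
          have n4 := h.pos _ w2 e.symm
          right; unfold Out; omega
      · apply compat_LH
        intro e; exact absurd e.symm w3
    · constructor
      · apply compat_VL
        · intro e; exact absurd (g.injective e).symm w3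
        · intro hb; unfold Btwn Avoid at *; omega
      · apply compat_LV
        · intro e; exact absurd (g.injective e).symm w3
        · rintro (e | e | e) hne
          · exact absurd e w3
          · exact absurd (g.injective e) w3
          · have n4 : ix w ≠ ix (g c) := fun e => hne (h.inj _ _ w1 hsr e)
            rw [e] at *
            unfold Out; omega
  · intro κx κy lo hE v h1 h2 h3 h4
    exact ch_com hE.ex.inj hE.ey.inj (hcom _ _ _ hE) (h.H.g1 v h1 h2).symm (h.H.g1 _ h2 h3).symm
      (h.H.g2 v h1 h2).symm h4
  · refine h.ct2 (a := f.symm c) (b := f.symm c) ?_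
    intro v _ hv _
    simp [isoD, hv, Ed.isS]
end

section
variable {W : Type}

/-- far vertex -/
def farD (f g : Equiv.Perm W) (rel ix : W → ℤ) (c : W) : Loc W where
  px := fun v => 2 * ix v + 2
  py := fun v => 2 * ix v + 2
  zone := fun v => if v = c then 1 else 0
  df := fun v => if v = c then .H (f c) c (if rel (g.symm c) = 0 then 1 else -1)
    else if v = f.symm c then .H v c (-1) else .S v (f v)
  dg := fun v => .L v (g v)
  nm := fun _ => True

set_option maxHeartbeats 2000000 in
lemma far_ok [Fintype W] {A : W → Prop} {f g : Equiv.Perm W} {rel : W → ℤ} {K : ℤ} {c : W} {k : ℤ}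
    {ix : W → ℤ} (h : Blk A f g rel c k ix K) (h1 : rel (g (f c)) < 0)
    (h2 : rel (g (f.symm c)) ≤ 0) (h3 : rel (g c) ≤ 0) (h4 : rel (g.symm c) ≤ 0) :
    LocalOK A f g rel K (farD f g rel ix c) := by
  obtain ⟨ε, hε⟩ : ∃ ε : ℤ, ε = if rel (g.symm c) = 0 then 1 else -1 := ⟨_, rfl⟩
  have hε1 : ε = 1 ∨ ε = -1 := by rw [hε]; split_ifs <;> simp
  have hε2 : rel (g.symm c) = 0 → ε = 1 := by intro e; rw [hε]; simp [e]
  have hε3 : rel (g.symm c) < 0 → ε = -1 := by intro e; rw [hε]; simp [e.ne]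
  have hz1 : (farD f g rel ix c).zone c = 1 := by simp [farD]
  have hz0 : ∀ v, v ≠ c → (farD f g rel ix c).zone v = 0 := by intro v hv; simp [farD, hv]
  have ha : rel (f c) = 0 := (h.cl c).2 h.rc
  have hb : rel (f.symm c) = 0 := (h.cl' c).2 h.rc
  have hca : f c ≠ c := h.f1 c h.rc
  have hcb : f.symm c ≠ c := h.f1' c h.rc
  have hab : f c ≠ f.symm c := h.f2' c h.rc
  have i0 := h.i0
  have ia := h.st c h.rc hca
  have ib := h.la
  have hK := h.hK
  have hsp : ∀ e, Sp A f g rel (farD f g rel ix c) e →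
      (∃ v, e = .S v (f v) ∧ rel v = 0 ∧ v ≠ c ∧ f v ≠ c) ∨
      e = .H (f c) c ε ∨ e = .H (f.symm c) c (-1) := by
    rintro e (⟨v, h1, h2, h3, rfl⟩ | ⟨v, h1, h2, h3, h4, rfl⟩)
    · simp only [farD]
      rw [← hε]
      split_ifs with e e'
      · right; left; rfl
      · right; right; rw [e']
      · left; exact ⟨v, rfl, h1, e, fun h => e' (by rw [← h]; simp)⟩
    · exact absurd trivial h2
  have hbx : ∀ v, rel v = 0 → 0 < 2 * ix v + 2 ∧ 2 * ix v + 2 < K := by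
    intro v hv; have := h.rng v hv; omega
  have hzv : ∀ v, (farD f g rel ix c).zone v = 0 ∨ (farD f g rel ix c).zone v = 1 ∨
      (farD f g rel ix c).zone v = -1 := by
    intro v
    by_cases hv : v = c
    · right; left; rw [hv]; exact hz1
    · left; exact hz0 v hv
  have hzc : ∀ v, (farD f g rel ix c).zone v ≠ 0 → v = c := by
    intro v hv; by_contra hh; exact hv (hz0 v hh)
  have hcom : ∀ κx κy lo, Env g rel (farD f g rel ix c) K κx κy lo →
      ∀ u, rel u = 0 → ∀ w, (κx u < κx w ↔ κy u < κy w) := by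
    intro κx κy lo hE
    exact hE.com (fun v _ => rfl) (fun v hv _ => hbx v hv) (fun v _ => hzv v)
      (fun u v _ _ hu hv => (hzc u hu).trans (hzc v hv).symm)
  -- one-coordinate facts
  have opA : ∀ κ lo, Env1 g rel (fun v => 2 * ix v + 2) (farD f g rel ix c).zone K κ lo →
      Opp κ (f c) c (g (f c)) := by
    intro κ lo hE
    have := hE.oE _ ha h1
    have := hE.z0 _ ha (hz0 _ hca)
    have := hE.fR1 c h.rc hz1
    have := hbx _ ha
    unfold Opp; omega
  have opB : ∀ κ lo, Env1 g rel (fun v => 2 * ix v + 2) (farD f g rel ix c).zone K κ lo →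
      Opp κ (f.symm c) c (g (f.symm c)) := by
    intro κ lo hE
    have := hE.z0 _ hb (hz0 _ hcb)
    have := hE.fR1 c h.rc hz1
    have := hbx _ hb
    rcases h2.lt_or_eq with e | e
    · have := hE.oE _ hb e
      unfold Opp; omega
    · have n1 : g (f.symm c) ≠ c := by
        have := h.fg (f.symm c) hb; simpa using this
      have n2 : g (f.symm c) ≠ f.symm c := h.H.g1 _ (h.hA _ hb) (h.hA _ e)
      have := hE.z0 _ e (hz0 _ n1)
      have := h.rng _ e
      have n3 : ix (g (f.symm c)) ≠ ix (f.symm c) := fun e' => n2 (h.inj _ _ e hb e')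
      unfold Opp; omega
  constructor
  · intro v hv _; exact hbx v hv
  · intro v hv _; exact hbx v hv
  · intro u v hu hv _ _ e; simp [farD] at e; exact h.inj u v hu hv e
  · intro u v hu hv _ _ e; simp [farD] at e; exact h.inj u v hu hv e
  · intro v _; exact hzv v
  · intro u v _ _ hu hv; exact (hzc u hu).trans (hzc v hv).symm
  · intro v _ hv
    have := hzc v (by omega)
    rw [this]; exact ⟨h3, h4⟩
  · intro v _ hv
    have := hzc v (by omega)
    rw [this, hz1] at hv; omega
  · intro v hv
    simp only [farD]
    split_ifs with e1 e2 e3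
    · subst e1; simp [Ed.ends, Sym2.eq_swap]
    · subst e1; simp [Ed.ends, Sym2.eq_swap]
    · subst e3; simp [Ed.ends]
    · rfl
  · intro v hv h1; exact absurd trivial h1
  · intro v hv h1; rfl
  · intro e he u v ε' hst
    apply hz0
    rcases hsp e he with ⟨v, rfl, hv, hvc, hfv⟩ | rfl | rfl
    · simp [Ed.steep] at hst
    · simp [Ed.steep] at hst; rw [← hst.1]; exact hca
    · simp [Ed.steep] at hst; rw [← hst.1]; exact hcb
  · intro e he u v ε' hst
    rcases hsp e he with ⟨v, rfl, hv, hvc, hfv⟩ | rfl | rfl <;> simp [Ed.shal] at hst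
  · intro κx κy lo hE e he
    have zx : ∀ w, rel w = 0 → w ≠ c → κx w = lo + (2 * ix w + 2) :=
      fun w hw hc => hE.ex.z0 w hw (hz0 w hc)
    have zy : ∀ w, rel w = 0 → w ≠ c → κy w = lo + (2 * ix w + 2) :=
      fun w hw hc => hE.ey.z0 w hw (hz0 w hc)
    rcases hsp e he with ⟨v, rfl, hv, hvc, hfv⟩ | rfl | rfl
    · refine ⟨(h.f1 v hv).symm, fun w => ?_⟩
      have e0 := h.st v hv hfv
      have r1 := h.rng v hv
      have hv' := (h.cl v).2 hv
      have r2 := h.rng _ hv'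
      have e1 := zx v hv hvc; have e2 := zy v hv hvc
      have e3 := zx _ hv' hfv; have e4 := zy _ hv' hfv
      by_cases hw0 : rel w = 0
      · by_cases hwc : w = c
        · rw [hwc]
          have := hE.ex.fR1 c h.rc hz1
          have := hE.ey.fR1 c h.rc hz1
          unfold Btwn at *; omega
        · have e5 := zx w hw0 hwc; have e6 := zy w hw0 hwc
          unfold Btwn at *; omega
      · have e5 := hE.ex.out w hw0
        have e6 := hE.ey.out w hw0
        unfold Btwn at *; omega
    · exact ⟨hca, hε1⟩
    · exact ⟨hcb, Or.inr rfl⟩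
  · intro κx κy lo hE e e' he he' hne
    have xa := hE.ex.z0 _ ha (hz0 _ hca)
    have ya := hE.ey.z0 _ ha (hz0 _ hca)
    have xb := hE.ex.z0 _ hb (hz0 _ hcb)
    have yb := hE.ey.z0 _ hb (hz0 _ hcb)
    have ba := hbx _ ha
    have bb := hbx _ hb
    have xc := hE.ex.fR1 c h.rc hz1
    have yc := hE.ey.fR1 c h.rc hz1
    simp only [farD] at xa ya xb yb
    have ra := h.rng _ ha
    have nab : ix (f c) ≠ ix (f.symm c) := fun e => hab (h.inj _ _ ha hb e)
    rcases hsp e he with ⟨v, rfl, hv, hfv⟩ | rfl | rfl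
    · exact (compat_S _ _ _).1
    · rcases hsp e' he' with ⟨v, rfl, hv, hfv⟩ | rfl | rfl
      · exact (compat_S _ _ _).2
      · exact absurd rfl hne
      · apply compat_HH
        · intro e; exact absurd e hab
        · intro hB; unfold Btwn Avoid at *; omega
    · rcases hsp e' he' with ⟨v, rfl, hv, hfv⟩ | rfl | rfl
      · exact (compat_S _ _ _).2
      · apply compat_HH
        · intro e; exact absurd e.symm hab
        · intro hB; have := h.rng _ hb; unfold Btwn Avoid at *; omega
      · exact absurd rfl hne
  · intro κx κy lo hE e w he hw
    have xa := hE.ex.z0 _ ha (hz0 _ hca)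
    have ya := hE.ey.z0 _ ha (hz0 _ hca)
    have xb := hE.ex.z0 _ hb (hz0 _ hcb)
    have yb := hE.ey.z0 _ hb (hz0 _ hcb)
    have ba := hbx _ ha
    have bb := hbx _ hb
    have xc := hE.ex.fR1 c h.rc hz1
    have yc := hE.ey.fR1 c h.rc hz1
    have oxA := opA κx lo hE.ex
    have oxB := opB κx lo hE.ex
    have hwn := hw.2.2
    have hgn : g w ≠ w := h.H.g1 w hw.1 hw.2.1
    -- crossing of the long vertical part
    have key : lo < κy w → κy w < κy c → κx w < κx c ∧
        (κx (g w) < κx c ∨ (g w = c ∧ rel w = 0)) := by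
      intro l1 l2
      by_cases hw0 : rel w = 0
      · have hwc : w ≠ c := by rintro rfl; omega
        have e1 := hE.ex.z0 w hw0 (hz0 w hwc)
        have b1 : 2 * ix w + 2 < K := (hbx w hw0).2
        have q1 : κx w < κx c := by simp only [farD] at e1; omega
        refine ⟨q1, ?_⟩
        rcases lt_trichotomy (rel (g w)) 0 with e | e | e
        · have := hE.ex.oE w hw0 e; left; omega
        · by_cases hgc : g w = c
          · right; exact ⟨hgc, hw0⟩
          · have e1 := hE.ex.z0 _ e (hz0 _ hgc)
            have b1 : 2 * ix (g w) + 2 < K := (hbx _ e).2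
            left; simp only [farD] at e1; omega
        · left; exact hE.ex.fR2 c h.rc hz1 _ e
      · have : 0 < rel w := by
          rcases lt_trichotomy (rel w) 0 with e | e | e
          · have := hE.ey.fR3 c h.rc hz1 w e; omega
          · exact absurd e hw0
          · exact e
        exact ⟨hE.ex.fR2 c h.rc hz1 w this, Or.inl (hE.ex.fR4 c h.rc hz1 w this)⟩
    -- the out-arc at `c`
    have gz : rel (g c) < 0 ∧ κx (g c) < lo ∨ rel (g c) = 0 ∧ A (g c) ∧ g c ≠ c ∧
        κx (g c) = lo + (2 * ix (g c) + 2) ∧ κy (g c) = lo + (2 * ix (g c) + 2) ∧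
        1 < ix (g c) ∧ ix (g c) < k - 1 := by
      rcases h3.lt_or_eq with e | e
      · left; exact ⟨e, hE.ex.oE c h.rc e⟩
      · right
        have n0 := h.hA _ e
        have n1 : g c ≠ c := h.H.g1 c (h.hA c h.rc) n0
        have m1 := h.pos _ e n1
        have m2 := h.rng _ e
        have m3 : ix (g c) ≠ ix (f c) := fun e' => h.fg c h.rc (h.inj _ _ e ha e')
        have m4 : ix (g c) ≠ ix (f.symm c) := fun e' => h.fg' c h.rc (h.inj _ _ e hb e')
        exact ⟨e, n0, n1, hE.ex.z0 _ e (hz0 _ n1), hE.ey.z0 _ e (hz0 _ n1), by omega, by omega⟩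
    simp only [farD] at xa ya xb yb
    rcases hsp e he with ⟨v, rfl, hv, hfv⟩ | rfl | rfl
    · exact compat_S _ _ _
    · constructor
      · apply compat_HL
        · rintro rfl; exact oxA
        · intro hB
          have key := key (by unfold Btwn at hB; omega) (by unfold Btwn at hB; omega)
          rcases key with ⟨k1, k2 | ⟨k2, k3⟩⟩
          · unfold Avoid; omega
          · have : g.symm c = w := by rw [← k2]; simp
            rw [this] at hε2
            have := hε2 k3
            rw [k2]
            unfold Avoid; omega
        · rintro (rfl | rfl | e) hne
          · unfold Opp Out at *; omega
          · rcases gz with ⟨q1, q2⟩ | ⟨q1, q2, q3, q4, q5, q6, q7⟩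
            · left; unfold Out; omega
            · right; unfold Out; omega
          · have hs : g.symm c = w := by rw [e]; simp
            rw [hs] at hε2 hε3 h4
            rw [← e]
            rcases h4.lt_or_eq with q | q
            · have := hε3 q
              unfold Out; omega
            · have hwc : w ≠ c := by rw [e]; exact hgn.symm
              have hwa : w ≠ f c := by rintro rfl; rw [← e] at h1; have := h.rc; omega
              have e2 := hE.ey.z0 w q (hz0 w hwc)
              simp only [farD] at e2
              have m1 := h.pos w q hwc
              have m3 : ix w ≠ ix (f c) := fun e' => hwa (h.inj _ _ q ha e')
              right; unfold Out; omega
      · apply compat_LH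
        rintro rfl; exact oxA
    · constructor
      · apply compat_HL
        · rintro rfl; exact oxB
        · intro hB
          have key := key (by unfold Btwn at hB; omega) (by unfold Btwn at hB; omega)
          rcases key with ⟨k1, k2 | ⟨k2, k3⟩⟩
          · unfold Avoid; omega
          · exfalso
            have hwc : w ≠ c := by rw [← k2]; exact hgn.symm
            have e2 := hE.ey.z0 w k3 (hz0 w hwc)
            simp only [farD] at e2
            have := h.rng w k3
            unfold Btwn at hB; omega
        · rintro (rfl | rfl | e) hne
          · unfold Opp Out at *; omega
          · rcases gz with ⟨q1, q2⟩ | ⟨q1, q2, q3, q4, q5, q6, q7⟩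
            · left; unfold Out; omega
            · left; unfold Out; omega
          · rw [← e]
            unfold Out; omega
      · apply compat_LH
        rintro rfl; exact oxB
  · intro κx κy lo hE v h1 h2 h3 h4
    exact ch_com hE.ex.inj hE.ey.inj (hcom _ _ _ hE) (h.H.g1 v h1 h2).symm (h.H.g1 _ h2 h3).symm
      (h.H.g2 v h1 h2).symm h4
  · refine h.ct2 (a := c) (b := f.symm c) ?_
    intro v _ hv hv'
    simp [farD, hv, hv', Ed.isS]

/-- twisted vertex -/
def laD (f g : Equiv.Perm W) (ix : W → ℤ) (c : W) (k : ℤ) : Loc W where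
  px := fun v => 2 * ix v + 2
  py := fun v => if v = c then 2 * k + 2 else 2 * ix v + 2
  zone := fun _ => 0
  df := fun v => if v = c then .V c (f c) 1
    else if v = f.symm c then .H c v (-1) else .S v (f v)
  dg := fun v => .L v (g v)
  nm := fun _ => True

set_option maxHeartbeats 2000000 in
lemma la_ok [Fintype W] {A : W → Prop} {f g : Equiv.Perm W} {rel : W → ℤ} {K : ℤ} {c : W} {k : ℤ}
    {ix : W → ℤ} (h : Blk A f g rel c k ix K) (h1 : rel (g c) < 0)
    (h2 : 0 < rel (g.symm c)) :
    LocalOK A f g rel K (laD f g ix c k) := by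
  have ha : rel (f c) = 0 := (h.cl c).2 h.rc
  have hb : rel (f.symm c) = 0 := (h.cl' c).2 h.rc
  have hca : f c ≠ c := h.f1 c h.rc
  have hcb : f.symm c ≠ c := h.f1' c h.rc
  have hab : f c ≠ f.symm c := h.f2' c h.rc
  have i0 := h.i0
  have ia := h.st c h.rc hca
  have ib := h.la
  have hK := h.hK
  have rb := h.rng _ hb
  have ra := h.rng _ ha
  have nab : ix (f c) ≠ ix (f.symm c) := fun e => hab (h.inj _ _ ha hb e)
  have hsp : ∀ e, Sp A f g rel (laD f g ix c k) e →
      (∃ v, e = .S v (f v) ∧ rel v = 0 ∧ v ≠ c ∧ f v ≠ c) ∨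
      e = .V c (f c) 1 ∨ e = .H c (f.symm c) (-1) := by
    rintro e (⟨v, h1, h2, h3, rfl⟩ | ⟨v, h1, h2, h3, h4, rfl⟩)
    · simp only [laD]
      split_ifs with e e'
      · right; left; rfl
      · right; right; rw [e']
      · left; exact ⟨v, rfl, h1, e, fun h => e' (by rw [← h]; simp)⟩
    · exact absurd trivial h2
  constructor
  · intro v hv _; have := h.rng v hv; simp only [laD]; omega
  · intro v hv _; have := h.rng v hv; simp only [laD]; split_ifs <;> omega
  · intro u v hu hv _ _ e; simp [laD] at e; exact h.inj u v hu hv e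
  · intro u v hu hv _ _ e
    have := h.rng u hu; have := h.rng v hv
    simp only [laD] at e
    split_ifs at e with e1 e2 e3
    · rw [e1, e2]
    · omega
    · omega
    · exact h.inj u v hu hv (by omega)
  · intro v _; left; rfl
  · intro u v _ _ hu hv; exact absurd rfl hu
  · intro v _ hv; simp [laD] at hv
  · intro v _ hv; simp [laD] at hv
  · intro v hv
    simp only [laD]
    split_ifs with e1 e2
    · subst e1; rfl
    · subst e2; simp [Ed.ends, Sym2.eq_swap]
    · rfl
  · intro v hv h1; exact absurd trivial h1
  · intro v hv h1; rfl
  · intro e he u v ε' hst; rfl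
  · intro e he u v ε' hst; exact ⟨rfl, rfl⟩
  · intro κx κy lo hE e he
    have zx : ∀ w, rel w = 0 → κx w = lo + (2 * ix w + 2) :=
      fun w hw => hE.ex.z0 w hw rfl
    have zy : ∀ w, rel w = 0 → w ≠ c → κy w = lo + (2 * ix w + 2) :=
      fun w hw hc => by have := hE.ey.z0 w hw rfl; simpa [laD, hc] using this
    have zc : κy c = lo + (2 * k + 2) := by
      have := hE.ey.z0 c h.rc rfl; simpa [laD] using this
    rcases hsp e he with ⟨v, rfl, hv, hvc, hfv⟩ | rfl | rfl
    · refine ⟨(h.f1 v hv).symm, fun w => ?_⟩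
      have e0 := h.st v hv hfv
      have r1 := h.rng v hv
      have hv' := (h.cl v).2 hv
      have r2 := h.rng _ hv'
      have e1 := zx v hv; have e2 := zy v hv hvc
      have e3 := zx _ hv'; have e4 := zy _ hv' hfv
      by_cases hw0 : rel w = 0
      · by_cases hwc : w = c
        · rw [hwc]
          have := zx c h.rc
          unfold Btwn at *; omega
        · have e5 := zx w hw0; have e6 := zy w hw0 hwc
          unfold Btwn at *; omega
      · have e5 := hE.ex.out w hw0
        have e6 := hE.ey.out w hw0
        unfold Btwn at *; omega
    · exact ⟨hca.symm, Or.inl rfl⟩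
    · exact ⟨hcb.symm, Or.inr rfl⟩
  · intro κx κy lo hE e e' he he' hne
    have zx : ∀ w, rel w = 0 → κx w = lo + (2 * ix w + 2) :=
      fun w hw => hE.ex.z0 w hw rfl
    have := zx _ ha; have := zx _ hb; have := zx c h.rc
    rcases hsp e he with ⟨v, rfl, hv, hfv⟩ | rfl | rfl
    · exact (compat_S _ _ _).1
    · rcases hsp e' he' with ⟨v, rfl, hv, hfv⟩ | rfl | rfl
      · exact (compat_S _ _ _).2
      · exact absurd rfl hne
      · exact compat_VH
    · rcases hsp e' he' with ⟨v, rfl, hv, hfv⟩ | rfl | rfl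
      · exact (compat_S _ _ _).2
      · apply compat_HV
        · intro _; left; unfold Out; omega
        · intro e; exact absurd rfl e
      · exact absurd rfl hne
  · intro κx κy lo hE e w he hw
    have zx : ∀ w, rel w = 0 → κx w = lo + (2 * ix w + 2) :=
      fun w hw => hE.ex.z0 w hw rfl
    have zy : ∀ w, rel w = 0 → w ≠ c → κy w = lo + (2 * ix w + 2) :=
      fun w hw hc => by have := hE.ey.z0 w hw rfl; simpa [laD, hc] using this
    have zc : κy c = lo + (2 * k + 2) := by
      have := hE.ey.z0 c h.rc rfl; simpa [laD] using this
    have := zx _ ha; have := zx _ hb; have := zx c h.rc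
    have := zy _ ha hca; have := zy _ hb hcb
    have xg := hE.ex.oE c h.rc h1
    have hgn : g w ≠ w := h.H.g1 w hw.1 hw.2.1
    have yg : g w = c → lo + K < κy w := by
      intro e
      have : g.symm c = w := by rw [← e]; simp
      rw [this] at h2
      exact hE.ey.iL w (by rw [e]; exact h.rc) h2
    rcases hsp e he with ⟨v, rfl, hv, hfv⟩ | rfl | rfl
    · exact compat_S _ _ _
    · have o1 : c = g w → Opp κy c (f c) w := by
        intro e
        have := yg e.symm
        unfold Opp; omega
      constructor
      · apply compat_VL o1
        intro hB; exfalso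
        by_cases hg0 : rel (g w) = 0
        · have := zx _ hg0
          unfold Btwn at hB; omega
        · have := hE.ex.out _ hg0
          unfold Btwn at hB; omega
      · apply compat_LV o1
        rintro (e | e | e) hne
        · rw [e]; right; unfold Out; omega
        · have := yg e; right; unfold Out; omega
        · by_cases hw0 : rel w = 0
          · have := zx w hw0
            have := h.pos w hw0 hne
            rw [e]
            left; unfold Out; omega
          · have := hE.ey.out w hw0
            right; unfold Out; omega
    · have o1 : c = w → Opp κx c (f.symm c) (g w) := by
        rintro rfl; unfold Opp; omega
      constructor
      · apply compat_HL o1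
        · intro hB; exfalso
          by_cases hw0 : rel w = 0
          · by_cases hwc : w = c
            · rw [hwc] at hB; unfold Btwn at hB; omega
            · have := zy w hw0 hwc
              have := h.rng w hw0
              unfold Btwn at hB; omega
          · have := hE.ey.out w hw0
            unfold Btwn at hB; omega
        · rintro (e | e | e) hne
          · rw [← e]; left; unfold Out; omega
          · by_cases hg0 : rel (g w) = 0
            · have := zy _ hg0 hne.symm
              have := h.rng _ hg0
              have e3 : κy w = κy (f.symm c) := by rw [e]
              have e4 : κx w = κx (f.symm c) := by rw [e]
              right; unfold Out; omega
            · have := hE.ex.out _ hg0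
              left; unfold Out; omega
          · rw [← e]; left; unfold Out; omega
      · exact compat_LH o1
  · intro κx κy lo hE v a1 a2 a3 a4
    have zx : ∀ w, rel w = 0 → κx w = lo + (2 * ix w + 2) :=
      fun w hw => hE.ex.z0 w hw rfl
    have zy : ∀ w, rel w = 0 → w ≠ c → κy w = lo + (2 * ix w + 2) :=
      fun w hw hc => by have := hE.ey.z0 w hw rfl; simpa [laD, hc] using this
    have zc : κy c = lo + (2 * k + 2) := by
      have := hE.ey.z0 c h.rc rfl; simpa [laD] using this
    have zc' := zx c h.rc
    have xg := hE.ex.oE c h.rc h1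
    have yg : ∀ w, g w = c → lo + K < κy w ∧ lo + K < κx w := by
      intro w e
      have : g.symm c = w := by rw [← e]; simp
      rw [this] at h2
      exact ⟨hE.ey.iL w (by rw [e]; exact h.rc) h2, hE.ex.iL w (by rw [e]; exact h.rc) h2⟩
    have d1 := h.H.g1 v a1 a2
    have d2 := h.H.g1 _ a2 a3
    have d3 := h.H.g2 v a1 a2
    by_cases c1 : v = c
    · subst c1
      have : rel (g (g v)) = 0 := by
        unfold Two at a4; omega
      have := zx _ this
      have := h.pos _ ‹_› d3
      left; unfold Out; omega
    by_cases c2 : g v = c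
    · have := yg v c2
      rw [c2]
      left; unfold Out; omega
    by_cases c3 : g (g v) = c
    · have := yg _ c3
      have : rel (g v) ≠ 0 := by
        intro e
        have := (zx _ e)
        have := h.rng _ e
        omega
      have hv0 : rel v = 0 := by
        unfold Two at a4; omega
      have := zy v hv0 c1
      have := h.rng v hv0
      rw [c3]
      right; unfold Out; omega
    have com : ∀ u w, u ≠ c → w ≠ c → rel u = 0 → (κx u < κx w ↔ κy u < κy w) := by
      intro u w e1 e2 e3
      by_cases hw : rel w = 0
      · rw [zx u e3, zx w hw, zy u e3 e1, zy w hw e2]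
      · exact hE.co u w e3 hw
    have n : ∀ u w, u ≠ w → κx u ≠ κx w ∧ κy u ≠ κy w := fun u v h =>
          ⟨fun h' => h (hE.ex.inj h'), fun h' => h (hE.ey.inj h')⟩
    have n1 := n _ _ d1
    have n2 := n _ _ d2
    have n3 := n _ _ d3
    unfold Two at a4
    unfold Out
    rcases a4 with ⟨q1, q2⟩ | ⟨q1, q2⟩ | ⟨q1, q2⟩
    · have := com _ _ c1 c2 q1; have := com _ _ c1 c3 q1; have := com _ _ c2 c3 q2; omega
    · have := com _ _ c1 c2 q1; have := com _ _ c1 c3 q1; have := com _ _ c3 c2 q2; omega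
    · have := com _ _ c2 c1 q1; have := com _ _ c2 c3 q1; have := com _ _ c3 c1 q2; omega
  · refine h.ct2 (a := c) (b := f.symm c) ?_
    intro v _ hv hv'
    simp [laD, hv, hv', Ed.isS]
end

section
variable {W : Type}

/-- position after moving `c` between `z` and `f z` -/
def altP (ix : W → ℤ) (c z : W) (v : W) : ℤ := if v = c then 2 * ix z + 3 else 2 * ix v + 2

def altD (f g : Equiv.Perm W) (ix : W → ℤ) (c z : W) (u1 v1 u2 v2 u3 v3 : W) (sp : W → Prop) :
    Loc W where
  px := altP ix c z
  py := altP ix c z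
  zone := fun _ => 0
  df := fun v => if v = c then .L u1 v1 else if v = f.symm c then .L u2 v2
    else if v = z then .L u3 v3 else .S v (f v)
  dg := fun v => if sp v then .S c (f z) else .L v (g v)
  nm := fun v => ¬ sp v

/-- tail condition -/
def TO (g : Equiv.Perm W) (rel P : W → ℤ) (u v : W) : Prop :=
  (rel (g u) < 0 ∧ P u < P v) ∨ (0 < rel (g u) ∧ P v < P u) ∨ (rel (g u) = 0 ∧ Opp P u v (g u))

/-- link conditions -/
structure Lk (g : Equiv.Perm W) (rel P : W → ℤ) (sp : W → Prop) (u v : W) : Prop where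
  t : ¬ sp u → TO g rel P u v
  h : ¬ sp (g.symm v) → TO g.symm rel P v u

structure LP (P : W → ℤ) (u v u' v' : W) : Prop where
  t : u = u' → Opp P u v v'
  h : v = v' → Opp P v u u'

lemma alt_gen [Fintype W] {A : W → Prop} {f g : Equiv.Perm W} {rel : W → ℤ} {K : ℤ} {c : W} {k : ℤ}
    {ix : W → ℤ} (h : Blk A f g rel c k ix K) (z : W) (hz : rel z = 0) (hzc : z ≠ c)
    (hfz : f z ≠ c) (d : W) (hd : rel d = 0) (hdc : d ≠ c) (hda : d ≠ f c) (hdb : d ≠ f.symm c)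
    (u1 v1 u2 v2 u3 v3 : W) (sp : W → Prop)
    (e1 : s(u1, v1) = s(c, f c)) (e2 : s(u2, v2) = s(f.symm c, c)) (e3 : s(u3, v3) = s(z, f z))
    (hsp : ∀ v, sp v → rel v = 0 ∧ s(v, g v) = s(c, f z))
    (k1 : Lk g rel (altP ix c z) sp u1 v1) (k2 : Lk g rel (altP ix c z) sp u2 v2)
    (k3 : Lk g rel (altP ix c z) sp u3 v3)
    (p12 : LP (altP ix c z) u1 v1 u2 v2) (p13 : LP (altP ix c z) u1 v1 u3 v3)
    (p23 : LP (altP ix c z) u2 v2 u3 v3) :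
    LocalOK A f g rel K (altD f g ix c z u1 v1 u2 v2 u3 v3 sp) := by
  have ha : rel (f c) = 0 := (h.cl c).2 h.rc
  have hb : rel (f.symm c) = 0 := (h.cl' c).2 h.rc
  have hy : rel (f z) = 0 := (h.cl z).2 hz
  have mem : ∀ {u v a b : W}, s(u, v) = s(a, b) → rel a = 0 → rel b = 0 → a ≠ b →
      rel u = 0 ∧ rel v = 0 ∧ u ≠ v := by
    intro u v a b e r1 r2 hn
    simp only [Sym2.eq_iff] at e
    rcases e with ⟨rfl, rfl⟩ | ⟨rfl, rfl⟩
    · exact ⟨r1, r2, hn⟩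
    · exact ⟨r2, r1, hn.symm⟩
  have m1 := mem e1 h.rc ha (h.f1 c h.rc).symm
  have m2 := mem e2 hb h.rc (h.f1' c h.rc)
  have m3 := mem e3 hz hy (h.f1 z hz).symm
  have iz := h.st z hz hfz
  have rz := h.rng z hz
  have ry := h.rng _ hy
  have hL : ∀ a b, Sp A f g rel (altD f g ix c z u1 v1 u2 v2 u3 v3 sp) (.L a b) →
      (a = u1 ∧ b = v1) ∨ (a = u2 ∧ b = v2) ∨ (a = u3 ∧ b = v3) := by
    rintro a b (⟨v, h1, h2, h3, e⟩ | ⟨v, h1, h2, h3, h4, e⟩)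
    · simp only [altD] at e
      split_ifs at e with q1 q2 q3
      · simp at e; left; exact e
      · simp at e; right; left; exact e
      · simp at e; right; right; exact e
    · have h2 : sp v := by simpa [altD] using h2
      simp [altD, h2] at e
  have tr : ∀ κ lo, Env1 g rel (altP ix c z) (fun _ => 0) K κ lo → ∀ u v w, rel u = 0 → rel v = 0 →
      rel w = 0 → Opp (altP ix c z) u v w → Opp κ u v w := by
    intro κ lo hE u v w hu hv hw ho
    have := hE.z0 u hu rfl; have := hE.z0 v hv rfl; have := hE.z0 w hw rfl
    unfold Opp at *; omega
  have bd : ∀ v, rel v = 0 → 0 < altP ix c z v ∧ altP ix c z v < K := by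
    intro v hv
    have := h.rng v hv; have := h.hK; unfold altP; split_ifs <;> omega
  have lkT : ∀ κ lo, Env1 g rel (altP ix c z) (fun _ => 0) K κ lo → ∀ u v, rel u = 0 → rel v = 0 →
      TO g rel (altP ix c z) u v → Opp κ u v (g u) := by
    intro κ lo hE u v hu hv ht
    have r1 := hE.z0 u hu rfl; have r2 := hE.z0 v hv rfl
    have := bd u hu
    rcases ht with ⟨q1, q2⟩ | ⟨q1, q2⟩ | ⟨q1, q2⟩
    · have := hE.oE u hu q1; unfold Opp; omega
    · have := hE.oL u hu q1; unfold Opp; omega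
    · exact tr κ lo hE _ _ _ hu hv q1 q2
  have lkH : ∀ κ lo, Env1 g rel (altP ix c z) (fun _ => 0) K κ lo → ∀ u v, rel u = 0 → rel v = 0 →
      TO g.symm rel (altP ix c z) u v → Opp κ u v (g.symm u) := by
    intro κ lo hE u v hu hv ht
    have r1 := hE.z0 u hu rfl; have r2 := hE.z0 v hv rfl
    have := bd u hu
    have hu' : rel (g (g.symm u)) = 0 := by simpa using hu
    rcases ht with ⟨q1, q2⟩ | ⟨q1, q2⟩ | ⟨q1, q2⟩
    · have := hE.iE _ hu' q1; unfold Opp; omega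
    · have := hE.iL _ hu' q1; unfold Opp; omega
    · exact tr κ lo hE _ _ _ hu hv q1 q2
  have osym : ∀ (κ : W → ℤ) a b c, Opp κ a b c → Opp κ a c b := by
    intro κ a b c; unfold Opp; omega
  apply LConf.ok h.H
  constructor
  · rfl
  · intro v; rfl
  · intro v hv; exact bd v hv
  · intro u v hu hv e
    simp only [altD, altP] at e
    split_ifs at e with q1 q2 q3
    · rw [q1, q2]
    · omega
    · omega
    · exact h.inj u v hu hv (by omega)
  · intro v hv
    simp only [altD]
    split_ifs with q1 q2 q3
    · subst q1; exact e1
    · subst q2; rw [Equiv.apply_symm_apply]; exact e2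
    · subst q3; exact e3
    · rfl
  · intro v hv h1
    have h1 : sp v := by simpa [altD] using h1
    obtain ⟨r1, r2⟩ := hsp v h1
    constructor
    · simp only [altD, h1, if_true, Ed.ends, r2]
    · have := mem r2 h.rc hy hfz.symm
      exact this.2.1
  · intro v hv h1
    have h1 : ¬ sp v := h1
    simp [altD, h1]
  · rintro e (⟨v, h1, h2, h3, rfl⟩ | ⟨v, h1, h2, h3, h4, rfl⟩)
    · simp only [altD]
      split_ifs with q1 q2 q3
      · right; exact ⟨_, _, rfl, m1⟩
      · right; exact ⟨_, _, rfl, m2⟩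
      · right; exact ⟨_, _, rfl, m3⟩
      · left
        have q4 : f v ≠ c := fun e => q2 (by rw [← e]; simp)
        refine ⟨v, f v, rfl, h1, (h.cl v).2 h1, (h.f1 v h1).symm, fun w hw => ?_⟩
        have := h.st v h1 q4
        have : ix v ≠ ix z := fun e => q3 (h.inj _ _ h1 hz e)
        simp only [altP, q1, q4, if_false]
        unfold Btwn; split_ifs <;> omega
    · have h2 : sp v := by simpa [altD] using h2
      left
      refine ⟨c, f z, by simp [altD, h2], h.rc, hy, hfz.symm, fun w hw => ?_⟩
      simp only [altD, altP, hfz, if_false, if_true]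
      unfold Btwn; split_ifs <;> omega
  · intro κ lo hE a b c' d' s1 s2 s3
    have tr := tr κ lo hE
    rcases hL _ _ s1 with ⟨rfl, rfl⟩ | ⟨rfl, rfl⟩ | ⟨rfl, rfl⟩ <;>
    rcases hL _ _ s2 with ⟨rfl, rfl⟩ | ⟨rfl, rfl⟩ | ⟨rfl, rfl⟩
    · exact absurd rfl s3
    · exact ⟨fun e => tr _ _ _ m1.1 m1.2.1 m2.2.1 (p12.t e),
        fun e => tr _ _ _ m1.2.1 m1.1 m2.1 (p12.h e)⟩
    · exact ⟨fun e => tr _ _ _ m1.1 m1.2.1 m3.2.1 (p13.t e),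
        fun e => tr _ _ _ m1.2.1 m1.1 m3.1 (p13.h e)⟩
    · exact ⟨fun e => osym _ _ _ _ (e ▸ tr _ _ _ m1.1 m1.2.1 m2.2.1 (p12.t e.symm)),
        fun e => osym _ _ _ _ (e ▸ tr _ _ _ m1.2.1 m1.1 m2.1 (p12.h e.symm))⟩
    · exact absurd rfl s3
    · exact ⟨fun e => tr _ _ _ m2.1 m2.2.1 m3.2.1 (p23.t e),
        fun e => tr _ _ _ m2.2.1 m2.1 m3.1 (p23.h e)⟩
    · exact ⟨fun e => osym _ _ _ _ (e ▸ tr _ _ _ m1.1 m1.2.1 m3.2.1 (p13.t e.symm)),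
        fun e => osym _ _ _ _ (e ▸ tr _ _ _ m1.2.1 m1.1 m3.1 (p13.h e.symm))⟩
    · exact ⟨fun e => osym _ _ _ _ (e ▸ tr _ _ _ m2.1 m2.2.1 m3.2.1 (p23.t e.symm)),
        fun e => osym _ _ _ _ (e ▸ tr _ _ _ m2.2.1 m2.1 m3.1 (p23.h e.symm))⟩
    · exact absurd rfl s3
  · intro κ lo hE a b s1
    have key : rel a = 0 ∧ rel b = 0 ∧ Lk g rel (altP ix c z) sp a b := by
      rcases hL _ _ s1 with ⟨rfl, rfl⟩ | ⟨rfl, rfl⟩ | ⟨rfl, rfl⟩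
      · exact ⟨m1.1, m1.2.1, k1⟩
      · exact ⟨m2.1, m2.2.1, k2⟩
      · exact ⟨m3.1, m3.2.1, k3⟩
    obtain ⟨ra, rb, lk⟩ := key
    constructor
    · rintro ⟨-, -, ⟨-, q⟩ | ⟨q, -⟩⟩
      · exact lkT κ lo hE _ _ ra rb (lk.t q)
      · exact absurd ra q
    · rintro w ⟨-, -, hw⟩ hg
      have hgw : g.symm b = w := by rw [← hg]; simp
      rw [← hgw]
      apply lkH κ lo hE _ _ rb ra (lk.h _)
      rw [hgw]
      rcases hw with ⟨-, q⟩ | ⟨q, -⟩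
      · exact q
      · intro hs; exact q (hsp w hs).1
  · have h1 : cnt (fun v => rel v = 0 ∧ A v ∧ A (f v) ∧
        ¬ ((altD f g ix c z u1 v1 u2 v2 u3 v3 sp).df v).isS) ≤ 3 := by
      refine (cnt_le_of {c, f.symm c, z} ?_).trans Finset.card_le_three
      rintro v ⟨h1, -, -, h2⟩
      by_contra h3
      simp at h3
      apply h2
      simp [altD, h3.1, h3.2.1, h3.2.2, Ed.isS]
    have h2 : 4 ≤ cnt (fun v => rel v = 0 ∧ A v ∧ A (f v)) := by
      have h4 : ({d, f c, c, f.symm c} : Finset W).card = 4 := by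
        rw [Finset.card_insert_of_notMem, three_card (h.f1 c h.rc) (h.f2' c h.rc) (h.f1' c h.rc).symm]
        simp [hdc, hda, hdb]
      rw [← h4]
      apply le_cnt_of
      intro v hv
      have hv : rel v = 0 := by
        simp at hv
        rcases hv with rfl | rfl | rfl | rfl
        · exact hd
        · exact ha
        · exact h.rc
        · exact hb
      exact ⟨hv, h.hA v hv, h.hA _ ((h.cl v).2 hv)⟩
    omega
end

section
variable {W : Type}

def PR (g : Equiv.Perm W) (rel : W → ℤ) (v : W) : Prop := rel (g v) < 0 ∧ rel (g.symm v) < 0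
def QS (g : Equiv.Perm W) (rel : W → ℤ) (v : W) : Prop := 0 < rel (g v) ∧ 0 < rel (g.symm v)
def NN (g : Equiv.Perm W) (rel : W → ℤ) (v : W) : Prop := rel (g v) = 0 ∧ rel (g.symm v) = 0

lemma pr_nn {g : Equiv.Perm W} {rel : W → ℤ} {v w : W} (h : PR g rel v) (h' : NN g rel w) :
    v ≠ w := by
  rintro rfl; have := h.1; have := h'.1; omega
lemma qs_nn {g : Equiv.Perm W} {rel : W → ℤ} {v w : W} (h : QS g rel v) (h' : NN g rel w) :
    v ≠ w := by
  rintro rfl; have := h.1; have := h'.1; omega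
lemma pr_qs {g : Equiv.Perm W} {rel : W → ℤ} {v w : W} (h : PR g rel v) (h' : QS g rel w) :
    v ≠ w := by
  rintro rfl; have := h.1; have := h'.1; omega

section
variable [Fintype W] {A : W → Prop} {f g : Equiv.Perm W} {rel : W → ℤ} {K : ℤ} {c : W} {k : ℤ}
    {ix : W → ℤ}

lemma alt1a (h : Blk A f g rel c k ix K) (hc : NN g rel c) (ha : PR g rel (f c))
    (hb : QS g rel (f.symm c)) (z : W) (hz : rel z = 0) (hzp : PR g rel z) (hzg : f z = g c)
    (hy : NN g rel (g c)) : ∃ D, LocalOK A f g rel K D := by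
  have ra : rel (f c) = 0 := (h.cl c).2 h.rc
  have rb : rel (f.symm c) = 0 := (h.cl' c).2 h.rc
  have ry : rel (f z) = 0 := (h.cl z).2 hz
  rw [← hzg] at hy
  have nzc := pr_nn hzp hc
  have nyc : f z ≠ c := by rw [hzg]; exact h.H.g1 c (h.hA c h.rc) (h.hA _ hc.1)
  have nac := pr_nn ha hc
  have nbc := qs_nn hb hc
  have nay := pr_nn ha hy
  have nby := qs_nn hb hy
  have nzb := pr_qs hzp hb
  have nab := pr_qs ha hb
  have rt : rel (g.symm c) = 0 := hc.2
  have ntc : g.symm c ≠ c := by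
    intro e
    have := h.H.g1 c (h.hA c h.rc) (h.hA _ hc.1)
    apply this; nth_rw 1 [← e]; simp
  have Pc : altP ix c z c = 2 * ix z + 3 := by simp [altP]
  have Pv : ∀ v, v ≠ c → altP ix c z v = 2 * ix v + 2 := by intro v hv; simp [altP, hv]
  have Pa := Pv _ nac
  have Pb := Pv _ nbc
  have Py := Pv _ nyc
  have Pz := Pv _ nzc
  have Pt := Pv _ ntc
  have ia := h.st c h.rc nac
  have ib := h.la
  have i0 := h.i0
  have iy := h.st z hz nyc
  have iz := h.pos z hz nzc
  have iyb : ix (f z) ≠ ix (f.symm c) := fun e => nby (h.inj _ _ ry rb e).symm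
  have ryy := h.rng _ ry
  have hyc : g.symm (f z) = c := by rw [hzg]; simp
  by_cases hq : altP ix c z (g.symm c) < altP ix c z c
  · refine ⟨_, alt_gen h z hz nzc nyc (f z) ry nyc nay.symm nby.symm c (f c) (f.symm c) c z (f z)
      (fun v => v = c) rfl rfl rfl ?_ ?_ ?_ ?_ ?_ ?_ ?_⟩
    · rintro v rfl; exact ⟨h.rc, by rw [hzg]⟩
    · refine ⟨fun e => absurd rfl e, fun _ => Or.inl ⟨ha.2, by omega⟩⟩
    · refine ⟨fun _ => Or.inr (Or.inl ⟨hb.1, by omega⟩), fun _ => Or.inr (Or.inr ⟨hc.2, ?_⟩)⟩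
      unfold Opp; omega
    · refine ⟨fun _ => Or.inl ⟨hzp.1, by omega⟩, fun e => absurd hyc e⟩
    · exact ⟨fun e => absurd e.symm nbc, fun e => absurd e nac⟩
    · exact ⟨fun e => absurd e.symm nzc, fun e => absurd e nay⟩
    · exact ⟨fun e => absurd e.symm nzb, fun e => absurd e.symm nyc⟩
  · refine ⟨_, alt_gen h z hz nzc nyc (f z) ry nyc nay.symm nby.symm c (f c) c (f.symm c) z (f z)
      (fun v => v = c) rfl Sym2.eq_swap rfl ?_ ?_ ?_ ?_ ?_ ?_ ?_⟩
    · rintro v rfl; exact ⟨h.rc, by rw [hzg]⟩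
    · refine ⟨fun e => absurd rfl e, fun _ => Or.inl ⟨ha.2, by omega⟩⟩
    · refine ⟨fun e => absurd rfl e, fun _ => Or.inr (Or.inl ⟨hb.2, by omega⟩)⟩
    · refine ⟨fun _ => Or.inl ⟨hzp.1, by omega⟩, fun e => absurd hyc e⟩
    · exact ⟨fun e => by unfold Opp; omega, fun e => absurd e nab⟩
    · exact ⟨fun e => absurd e.symm nzc, fun e => absurd e nay⟩
    · exact ⟨fun e => absurd e.symm nzc, fun e => absurd e nby⟩

lemma alt1b (h : Blk A f g rel c k ix K) (hc : NN g rel c) (ha : PR g rel (f c))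
    (hb : QS g rel (f.symm c)) (z : W) (hz : rel z = 0) (hzp : PR g rel z) (hzg : f z = g.symm c)
    (hy : NN g rel (g.symm c)) : ∃ D, LocalOK A f g rel K D := by
  have ra : rel (f c) = 0 := (h.cl c).2 h.rc
  have rb : rel (f.symm c) = 0 := (h.cl' c).2 h.rc
  have ry : rel (f z) = 0 := (h.cl z).2 hz
  have ntc : g.symm c ≠ c := by
    intro e
    have := h.H.g1 c (h.hA c h.rc) (h.hA _ hc.1)
    apply this; nth_rw 1 [← e]; simp
  rw [← hzg] at hy
  have nzc := pr_nn hzp hc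
  have nyc : f z ≠ c := by rw [hzg]; exact ntc
  have nac := pr_nn ha hc
  have nbc := qs_nn hb hc
  have nay := pr_nn ha hy
  have nby := qs_nn hb hy
  have nzb := pr_qs hzp hb
  have nab := pr_qs ha hb
  have Pc : altP ix c z c = 2 * ix z + 3 := by simp [altP]
  have Pv : ∀ v, v ≠ c → altP ix c z v = 2 * ix v + 2 := by intro v hv; simp [altP, hv]
  have Pa := Pv _ nac
  have Pb := Pv _ nbc
  have Py := Pv _ nyc
  have Pz := Pv _ nzc
  have ia := h.st c h.rc nac
  have ib := h.la
  have i0 := h.i0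
  have iy := h.st z hz nyc
  have iz := h.pos z hz nzc
  have iyb : ix (f z) ≠ ix (f.symm c) := fun e => nby (h.inj _ _ ry rb e).symm
  have ryy := h.rng _ ry
  refine ⟨_, alt_gen h z hz nzc nyc (f z) ry nyc nay.symm nby.symm (f c) c (f.symm c) c (f z) z
    (fun v => v = f z) Sym2.eq_swap rfl Sym2.eq_swap ?_ ?_ ?_ ?_ ?_ ?_ ?_⟩
  · rintro v rfl; exact ⟨ry, by rw [hzg]; simp [Sym2.eq_swap]⟩
  · refine ⟨fun _ => Or.inl ⟨ha.1, by omega⟩, fun e => absurd hzg.symm e⟩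
  · refine ⟨fun _ => Or.inr (Or.inl ⟨hb.1, by omega⟩), fun e => absurd hzg.symm e⟩
  · refine ⟨fun e => absurd rfl e, fun _ => Or.inl ⟨hzp.2, by omega⟩⟩
  · exact ⟨fun e => absurd e nab, fun e => by unfold Opp; omega⟩
  · exact ⟨fun e => absurd e nay, fun e => absurd e.symm nzc⟩
  · exact ⟨fun e => absurd e nby, fun e => absurd e.symm nzc⟩

/-- middle part of the second alternating configuration -/
lemma alt2 (h : Blk A f g rel c k ix K) (hc : NN g rel c) (ha : PR g rel (f c))
    (hb : QS g rel (f.symm c)) (e y u : W) (he : rel e = 0) (hep : PR g rel e) (hy : f e = y)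
    (hu : f y = u) (hyn : NN g rel y) (huq : QS g rel u) (nyc : y ≠ c)
    (nyt : y ≠ g.symm c) (hea : 1 < ix e) (hub : ix u < k - 1)
    (hst : (ix (g.symm c) < ix y ∧ ix y < ix (g c)) ∨ (ix (g c) < ix y ∧ ix y < ix (g.symm c))) :
    ∃ D, LocalOK A f g rel K D := by
  have ra : rel (f c) = 0 := (h.cl c).2 h.rc
  have rb : rel (f.symm c) = 0 := (h.cl' c).2 h.rc
  have ry : rel y = 0 := hy ▸ (h.cl e).2 he
  have ru : rel u = 0 := hu ▸ (h.cl y).2 ry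
  have nsc : g c ≠ c := h.H.g1 c (h.hA c h.rc) (h.hA _ hc.1)
  have ntc : g.symm c ≠ c := by
    intro e
    apply nsc; nth_rw 1 [← e]; simp
  have ngy : g y ≠ y := h.H.g1 y (h.hA y ry) (h.hA _ hyn.1)
  have ngyc : g y ≠ c := fun e => nyt (by rw [← e]; simp)
  have nec := pr_nn hep hc
  have nuc := qs_nn huq hc
  have nac := pr_nn ha hc
  have nbc := qs_nn hb hc
  have nay := pr_nn ha hyn
  have nby := qs_nn hb hyn
  have neb := pr_qs hep hb
  have nau := pr_qs ha huq
  have nab := pr_qs ha hb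
  have ia := h.st c h.rc nac
  have ib := h.la
  have i0 := h.i0
  have iy := h.st e he (by rw [hy]; exact nyc)
  have iu := h.st y ry (by rw [hu]; exact nuc)
  rw [hy] at iy
  rw [hu] at iu
  have nae : f c ≠ e := by rintro e'; rw [e'] at ia; omega
  have nbu : f.symm c ≠ u := by rintro e'; rw [e'] at ib; omega
  have igy : ix (g y) ≠ ix y := fun e => ngy (h.inj _ _ hyn.1 ry e)
  by_cases hg : ix y < ix (g y)
  · have Pc : altP ix c e c = 2 * ix e + 3 := by simp [altP]
    have Pv : ∀ v, v ≠ c → altP ix c e v = 2 * ix v + 2 := by intro v hv; simp [altP, hv]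
    have Pa := Pv _ nac
    have Pb := Pv _ nbc
    have Py := Pv _ nyc
    have Pe := Pv _ nec
    have Ps := Pv _ nsc
    have Pt := Pv _ ntc
    have Pg := Pv _ ngyc
    have k3 : Lk g rel (altP ix c e) (fun _ => False) y e := by
      refine ⟨fun _ => Or.inr (Or.inr ⟨hyn.1, ?_⟩), fun _ => Or.inl ⟨hep.2, by omega⟩⟩
      unfold Opp; omega
    rcases hst with ⟨q1, q2⟩ | ⟨q1, q2⟩
    · refine ⟨_, alt_gen h e he nec (hy ▸ nyc) y ry nyc nay.symm nby.symm c (f c) (f.symm c) c y e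
        (fun _ => False) rfl rfl (by rw [hy, Sym2.eq_swap]) (fun _ e => e.elim) ?_ ?_ k3 ?_ ?_ ?_⟩
      · refine ⟨fun _ => Or.inr (Or.inr ⟨hc.1, ?_⟩), fun _ => Or.inl ⟨ha.2, by omega⟩⟩
        unfold Opp; omega
      · refine ⟨fun _ => Or.inr (Or.inl ⟨hb.1, by omega⟩), fun _ => Or.inr (Or.inr ⟨hc.2, ?_⟩)⟩
        unfold Opp; omega
      · exact ⟨fun e => absurd e.symm nbc, fun e => absurd e nac⟩
      · exact ⟨fun e => absurd e.symm nyc, fun e => absurd e nae⟩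
      · exact ⟨fun e => absurd e nby, fun e => absurd e.symm nec⟩
    · refine ⟨_, alt_gen h e he nec (hy ▸ nyc) y ry nyc nay.symm nby.symm (f c) c c (f.symm c) y e
        (fun _ => False) Sym2.eq_swap Sym2.eq_swap (by rw [hy, Sym2.eq_swap]) (fun _ e => e.elim)
        ?_ ?_ k3 ?_ ?_ ?_⟩
      · refine ⟨fun _ => Or.inl ⟨ha.1, by omega⟩, fun _ => Or.inr (Or.inr ⟨hc.2, ?_⟩)⟩
        unfold Opp; omega
      · refine ⟨fun _ => Or.inr (Or.inr ⟨hc.1, ?_⟩), fun _ => Or.inr (Or.inl ⟨hb.2, by omega⟩)⟩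
        unfold Opp; omega
      · exact ⟨fun e => absurd e nac, fun e => absurd e.symm nbc⟩
      · exact ⟨fun e => absurd e nay, fun e => absurd e.symm nec⟩
      · exact ⟨fun e => absurd e.symm nyc, fun e => absurd e.symm neb⟩
  · have Pc : altP ix c y c = 2 * ix y + 3 := by simp [altP]
    have Pv : ∀ v, v ≠ c → altP ix c y v = 2 * ix v + 2 := by intro v hv; simp [altP, hv]
    have Pa := Pv _ nac
    have Pb := Pv _ nbc
    have Py := Pv _ nyc
    have Pu := Pv _ nuc
    have Ps := Pv _ nsc
    have Pt := Pv _ ntc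
    have Pg := Pv _ ngyc
    have k3 : Lk g rel (altP ix c y) (fun _ => False) y u := by
      refine ⟨fun _ => Or.inr (Or.inr ⟨hyn.1, ?_⟩), fun _ => Or.inr (Or.inl ⟨huq.2, by omega⟩)⟩
      unfold Opp; omega
    rcases hst with ⟨q1, q2⟩ | ⟨q1, q2⟩
    · refine ⟨_, alt_gen h y ry nyc (hu ▸ nuc) y ry nyc nay.symm nby.symm c (f c) (f.symm c) c y u
        (fun _ => False) rfl rfl (by rw [hu]) (fun _ e => e.elim) ?_ ?_ k3 ?_ ?_ ?_⟩
      · refine ⟨fun _ => Or.inr (Or.inr ⟨hc.1, ?_⟩), fun _ => Or.inl ⟨ha.2, by omega⟩⟩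
        unfold Opp; omega
      · refine ⟨fun _ => Or.inr (Or.inl ⟨hb.1, by omega⟩), fun _ => Or.inr (Or.inr ⟨hc.2, ?_⟩)⟩
        unfold Opp; omega
      · exact ⟨fun e => absurd e.symm nbc, fun e => absurd e nac⟩
      · exact ⟨fun e => absurd e.symm nyc, fun e => absurd e nau⟩
      · exact ⟨fun e => absurd e nby, fun e => absurd e.symm nuc⟩
    · refine ⟨_, alt_gen h y ry nyc (hu ▸ nuc) y ry nyc nay.symm nby.symm (f c) c c (f.symm c) y u
        (fun _ => False) Sym2.eq_swap Sym2.eq_swap (by rw [hu]) (fun _ e => e.elim)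
        ?_ ?_ k3 ?_ ?_ ?_⟩
      · refine ⟨fun _ => Or.inl ⟨ha.1, by omega⟩, fun _ => Or.inr (Or.inr ⟨hc.2, ?_⟩)⟩
        unfold Opp; omega
      · refine ⟨fun _ => Or.inr (Or.inr ⟨hc.1, ?_⟩), fun _ => Or.inr (Or.inl ⟨hb.2, by omega⟩)⟩
        unfold Opp; omega
      · exact ⟨fun e => absurd e nac, fun e => absurd e.symm nbc⟩
      · exact ⟨fun e => absurd e nay, fun e => absurd e.symm nuc⟩
      · exact ⟨fun e => absurd e.symm nyc, fun e => absurd e nbu⟩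

/-- the alternating case -/
lemma alt_ok (h : Blk A f g rel c k ix K) (hc : NN g rel c) (ha : PR g rel (f c))
    (hb : QS g rel (f.symm c))
    (a1 : ∀ v, rel v = 0 → PR g rel v → NN g rel (f v) ∧ QS g rel (f (f v)))
    (a3 : ∀ v, rel v = 0 → NN g rel v → (PR g rel (f.symm v) ∧ QS g rel (f v)) ∨
      (QS g rel (f.symm v) ∧ PR g rel (f v)))
    (a4 : ∀ v, rel v = 0 → rel (g v) = 0 → NN g rel v)
    (a5 : ∀ v, rel v = 0 → rel (g.symm v) = 0 → NN g rel v) :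
    ∃ D, LocalOK A f g rel K D := by
  have hs : NN g rel (g c) := a5 _ hc.1 (by simpa using h.rc)
  have ht : NN g rel (g.symm c) := a4 _ hc.2 (by simpa using h.rc)
  rcases a3 _ hc.1 hs with ⟨s1, s2⟩ | ⟨s1, s2⟩
  · exact alt1a h hc ha hb _ ((h.cl' _).2 hc.1) s1 (by simp) hs
  rcases a3 _ hc.2 ht with ⟨t1, t2⟩ | ⟨t1, t2⟩
  · exact alt1b h hc ha hb _ ((h.cl' _).2 hc.2) t1 (by simp) ht
  have nsc : g c ≠ c := h.H.g1 c (h.hA c h.rc) (h.hA _ hc.1)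
  have ntc : g.symm c ≠ c := by
    intro e
    apply nsc; nth_rw 1 [← e]; simp
  have nst : g c ≠ g.symm c := by
    intro e
    apply h.H.g2 c (h.hA c h.rc) (h.hA _ hc.1)
    rw [e]; simp
  have rb : rel (f.symm c) = 0 := (h.cl' c).2 h.rc
  have ra : rel (f c) = 0 := (h.cl c).2 h.rc
  have ist : ix (g c) ≠ ix (g.symm c) := fun e => nst (h.inj _ _ hc.1 hc.2 e)
  have nac := pr_nn ha hc
  have ia := h.st c h.rc nac
  have i0 := h.i0
  have ib := h.la
  -- generic step
  have key : ∀ y1 y2, rel y1 = 0 → rel y2 = 0 → NN g rel y1 → NN g rel y2 → PR g rel (f y1) →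
      QS g rel (f.symm y2) → y1 ≠ c → ix y1 < ix y2 → 
      NN g rel (f (f y1)) ∧ QS g rel (f (f (f y1))) ∧ f (f y1) ≠ c ∧ 1 < ix (f y1) ∧
      ix (f (f (f y1))) < k - 1 ∧ ix y1 < ix (f (f y1)) ∧ ix (f (f y1)) < ix y2 := by
    intro y1 y2 r1 r2 n1 n2 p1 q2 nyc hlt
    have re : rel (f y1) = 0 := (h.cl _).2 r1
    have ry : rel (f (f y1)) = 0 := (h.cl _).2 re
    have ru : rel (f (f (f y1))) = 0 := (h.cl _).2 ry
    obtain ⟨n3, q3⟩ := a1 _ re p1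
    have nyc' : f (f y1) ≠ c := by
      intro e
      rw [← e] at hb
      simp at hb
      exact pr_qs p1 hb rfl
    have j1 := h.st _ r1 (pr_nn p1 hc)
    have j2 := h.st _ re nyc'
    have j3 := h.st _ ry (qs_nn q3 hc)
    have := h.pos y1 r1 nyc
    have m1 : ix y2 ≠ ix (f y1) := fun e => pr_nn p1 n2 (h.inj _ _ r2 re e).symm
    have m2 : ix y2 ≠ ix (f (f y1)) := by
      intro e
      have := h.inj _ _ r2 ry e
      rw [this] at q2; simp at q2
      exact pr_qs p1 q2 rfl
    have m3 : ix y2 ≠ ix (f (f (f y1))) := fun e => qs_nn q3 n2 (h.inj _ _ r2 ru e).symm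
    have := h.rng _ r2
    exact ⟨n3, q3, nyc', by omega, by omega, by omega, by omega⟩
  rcases lt_or_gt_of_ne ist with q | q
  · obtain ⟨n3, q3, n4, l1, l2, l3, l4⟩ := key _ _ hc.1 hc.2 hs ht s2 t1 nsc q
    refine alt2 h hc ha hb _ _ _ ((h.cl _).2 hc.1) s2 rfl rfl n3 q3 n4 ?_ l1 l2 (Or.inr ⟨l3, l4⟩)
    intro e; rw [e] at l4; omega
  · obtain ⟨n3, q3, n4, l1, l2, l3, l4⟩ := key _ _ hc.2 hc.1 ht hs t2 s1 ntc q
    refine alt2 h hc ha hb _ _ _ ((h.cl _).2 hc.2) t2 rfl rfl n3 q3 n4 ?_ l1 l2 (Or.inl ⟨l3, l4⟩)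
    intro e; rw [e] at l3; omega
end
end

section
variable {W : Type}

structure NoCtx [Fintype W] (A : W → Prop) (f g : Equiv.Perm W) (rel : W → ℤ) (K : ℤ) : Prop where
  H : Hyp A f g
  hC : ∀ c, rel c = 0 → ∀ v, rel v = 0 ↔ f.SameCycle c v
  hA : ∀ v, rel v = 0 → A v
  hK : 2 * (Fintype.card W : ℤ) + 4 ≤ K
  no : ¬ ∃ D, LocalOK A f g rel K D

namespace NoCtx
variable [Fintype W] {A : W → Prop} {f g : Equiv.Perm W} {rel : W → ℤ} {K : ℤ}

lemma blk (h : NoCtx A f g rel K) (c : W) (hc : rel c = 0) : ∃ k ix, Blk A f g rel c k ix K := by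
  obtain ⟨k, ix, hk⟩ := exists_cyc f rel c (h.hC c hc)
  exact ⟨k, ix, ⟨hk, h.H, h.hA, by have := hk.kc; have := h.hK; omega⟩⟩

lemma cl (h : NoCtx A f g rel K) (v : W) : rel (f v) = 0 ↔ rel v = 0 := by
  constructor
  · intro e; exact (h.hC _ e v).2 (Equiv.Perm.sameCycle_apply_left.2 (Equiv.Perm.SameCycle.refl _ _))
  · intro e; exact (h.hC _ e _).2 (Equiv.Perm.sameCycle_apply_right.2 (Equiv.Perm.SameCycle.refl _ _))

lemma cl' (h : NoCtx A f g rel K) (v : W) : rel (f.symm v) = 0 ↔ rel v = 0 := by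
  rw [← h.cl (f.symm v)]; simp

lemma rev (h : NoCtx A f g rel K) : NoCtx A f.symm g rel K where
  H := h.H.rev
  hC := by
    intro c hc v
    rw [h.hC c hc v]
    exact (Equiv.Perm.sameCycle_inv (f := f)).symm
  hA := h.hA
  hK := h.hK
  no := by
    rintro ⟨D, hD⟩
    exact h.no ⟨_, hD.rev (fun v => h.cl v)⟩

lemma rot (h : NoCtx A f g rel K) : NoCtx A f g (fun v => - rel v) K where
  H := h.H
  hC := by
    intro c hc v
    have := h.hC c (by simpa using hc) v
    simpa using this
  hA := by
    intro v hv; exact h.hA v (by simpa using hv)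
  hK := h.hK
  no := by
    rintro ⟨D, hD⟩
    exact h.no ⟨_, hD.rot⟩

lemma lb1 (h : NoCtx A f g rel K) (c : W) (hc : rel c = 0) (h1 : rel (g c) < 0) :
    rel (g.symm (f.symm c)) ≤ 0 := by
  by_contra h2
  obtain ⟨k, ix, hb⟩ := h.blk c hc
  exact h.no ⟨_, lb1_ok hb h1 (by omega)⟩

lemma lb1' (h : NoCtx A f g rel K) (c : W) (hc : rel c = 0) (h1 : rel (g c) < 0) :
    rel (g.symm (f c)) ≤ 0 := by
  simpa using h.rev.lb1 c hc h1

lemma la (h : NoCtx A f g rel K) (c : W) (hc : rel c = 0) (h1 : rel (g c) < 0) :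
    rel (g.symm c) ≤ 0 := by
  by_contra h2
  obtain ⟨k, ix, hb⟩ := h.blk c hc
  exact h.no ⟨_, la_ok hb h1 (by omega)⟩

lemma far (h : NoCtx A f g rel K) (c : W) (hc : rel c = 0) (h1 : rel (g (f c)) < 0)
    (h2 : rel (g (f.symm c)) ≤ 0) (h3 : rel (g c) ≤ 0) (h4 : rel (g.symm c) ≤ 0) : False := by
  obtain ⟨k, ix, hb⟩ := h.blk c hc
  exact h.no ⟨_, far_ok hb h1 h2 h3 h4⟩

/-- after an early out-vertex there is a late one within two steps backwards -/
lemma pq (h : NoCtx A f g rel K) (a : W) (ha : rel a = 0) (h1 : rel (g a) < 0) :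
    0 < rel (g (f a)) ∨ 0 < rel (g (f (f a))) := by
  by_contra hh
  push Not at hh
  have h2 := h.rev.far (f a) ((h.cl a).2 ha)
  simp only [Equiv.symm_symm, Equiv.symm_apply_apply] at h2
  exact h2 h1 hh.2 hh.1 (h.lb1' a ha h1)

lemma qp (h : NoCtx A f g rel K) (a : W) (ha : rel a = 0) (h1 : 0 < rel (g a)) :
    rel (g (f a)) < 0 ∨ rel (g (f (f a))) < 0 := by
  have := h.rot.pq a (by simpa using ha) (by simpa using h1)
  simpa using this

lemma exO (h : NoCtx A f g rel K) (c : W) (hc : rel c = 0) : ∃ a, rel a = 0 ∧ rel (g a) ≠ 0 := by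
  by_contra hh
  push Not at hh
  obtain ⟨k, ix, hb⟩ := h.blk c hc
  refine h.no ⟨_, iso_ok hb hh ?_⟩
  have e : Finset.univ.filter (fun v => rel v = 0) = (Finset.univ.filter (fun v => rel v = 0)).map g.toEmbedding := by
    symm
    apply Finset.eq_of_subset_of_card_le
    · intro v hv
      simp only [Finset.mem_map, Finset.mem_filter, Finset.mem_univ, true_and] at hv ⊢
      obtain ⟨u, hu, rfl⟩ := hv
      exact hh u hu
    · simp
  intro v hv
  have : g v ∈ Finset.univ.filter (fun v => rel v = 0) := by simpa using hv
  rw [e] at this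
  simpa using this

lemma gap (h : NoCtx A f g rel K) (v : W) (hv : rel v = 0) : rel (g v) ≠ 0 ∨ rel (g (f v)) ≠ 0 := by
  obtain ⟨a, ha, ho⟩ := h.exO v hv
  have step : ∀ v, rel v = 0 → rel (g v) ≠ 0 → rel (g (f v)) ≠ 0 ∨ rel (g (f (f v))) ≠ 0 := by
    intro v hv hne
    rcases lt_or_gt_of_ne hne with q | q
    · have := h.pq v hv q; omega
    · have := h.qp v hv q; omega
  have ind : ∀ n : ℕ, rel ((f ^ n) a) = 0 ∧ (rel (g ((f ^ n) a)) ≠ 0 ∨ rel (g (f ((f ^ n) a))) ≠ 0) := by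
    intro n
    induction n with
    | zero => exact ⟨ha, Or.inl ho⟩
    | succ n ih =>
      rw [pow_succ', Equiv.Perm.mul_apply]
      refine ⟨(h.cl _).2 ih.1, ?_⟩
      by_cases q : rel (g (f ((f ^ n) a))) = 0
      · right
        rcases ih.2 with q' | q'
        · exact (step _ ih.1 q').resolve_left (by simpa using q)
        · exact absurd q q'
      · left; exact q
  obtain ⟨n, -, hn⟩ := ((h.hC a ha v).1 hv).exists_pow_eq'
  rw [← hn]; exact (ind n).2

lemma inE (h : NoCtx A f g rel K) (v : W) (hv : rel v = 0) (hi : rel (g.symm v) < 0) :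
    rel (g v) < 0 := by
  have hfv := (h.cl v).2 hv
  have hfv' := (h.cl' v).2 hv
  have q0 := h.rot.la v (by simpa using hv)
  have q1 := h.rot.lb1 (f v) (by simpa using hfv)
  have q2 := h.rot.lb1' (f.symm v) (by simpa using hfv')
  simp only [Equiv.symm_apply_apply, Equiv.apply_symm_apply] at q1 q2
  have g1 := h.gap v hv
  have g2 := h.gap _ hfv'
  simp only [Equiv.apply_symm_apply] at g2
  by_contra hh
  by_cases q : rel (g v) = 0
  · exact h.far v hv (by omega) (by omega) (by omega) (by omega)
  · omega

lemma inL (h : NoCtx A f g rel K) (v : W) (hv : rel v = 0) (hi : 0 < rel (g.symm v)) :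
    0 < rel (g v) := by
  have := h.rot.inE v (by simpa using hv) (by simpa using hi)
  simpa using this

lemma oi (h : NoCtx A f g rel K) (v : W) (hv : rel v = 0) :
    rel (g v) = 0 ↔ rel (g.symm v) = 0 := by
  have e : Finset.univ.filter (fun v => rel v = 0 ∧ rel (g v) = 0) =
      Finset.univ.filter (fun v => rel v = 0 ∧ rel (g.symm v) = 0) := by
    apply Finset.eq_of_subset_of_card_le
    · intro v hv
      simp only [Finset.mem_filter, Finset.mem_univ, true_and] at hv ⊢
      refine ⟨hv.1, ?_⟩
      by_contra hh
      rcases lt_or_gt_of_ne hh with q | q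
      · have := h.inE v hv.1 q; omega
      · have := h.inL v hv.1 q; omega
    · rw [← Finset.card_map g.symm.toEmbedding]
      apply Finset.card_le_card
      intro v hv
      simp only [Finset.mem_map, Finset.mem_filter, Finset.mem_univ, true_and] at hv ⊢
      obtain ⟨u, hu, rfl⟩ := hv
      exact ⟨hu.2, by simpa using hu.1⟩
  have := Finset.ext_iff.1 e v
  simpa [hv] using this

lemma lab (h : NoCtx A f g rel K) (v : W) (hv : rel v = 0) :
    (rel (g v) < 0 → PR g rel v) ∧ (0 < rel (g v) → QS g rel v) ∧ (rel (g v) = 0 → NN g rel v) := by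
  have q := h.oi v hv
  have q1 := h.la v hv
  have q2 := h.rot.la v (by simpa using hv)
  unfold PR QS NN
  refine ⟨?_, ?_, ?_⟩ <;> intro h' <;> omega

lemma a1 (h : NoCtx A f g rel K) (v : W) (hv : rel v = 0) (hp : PR g rel v) :
    NN g rel (f v) ∧ QS g rel (f (f v)) := by
  have hfv := (h.cl v).2 hv
  have hffv := (h.cl _).2 hfv
  have l1 := h.lab _ hfv
  have l2 := h.lab _ hffv
  have b1 := h.lb1' v hv hp.1
  have p1 := h.pq v hv hp.1
  rcases lt_trichotomy (rel (g (f v))) 0 with q | q | q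
  · have b2 := h.lb1' _ hfv q
    have := (l2.2.1 (by omega)).2
    omega
  · exact ⟨l1.2.2 q, l2.2.1 (by omega)⟩
  · have := (l1.2.1 q).2
    omega

lemma a2 (h : NoCtx A f g rel K) (v : W) (hv : rel v = 0) (hp : QS g rel v) :
    NN g rel (f v) ∧ PR g rel (f (f v)) := by
  have := h.rot.a1 v (by simpa using hv) (by unfold PR QS at *; simpa using hp)
  unfold PR QS NN at *; simpa using this

lemma a3 (h : NoCtx A f g rel K) (v : W) (hv : rel v = 0) (hn : NN g rel v) :
    (PR g rel (f.symm v) ∧ QS g rel (f v)) ∨ (QS g rel (f.symm v) ∧ PR g rel (f v)) := by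
  have hfv' := (h.cl' v).2 hv
  have g2 := h.gap _ hfv'
  simp only [Equiv.apply_symm_apply] at g2
  have g3 := g2.resolve_right (by simpa using hn.1)
  rcases lt_or_gt_of_ne g3 with q | q
  · left
    have := (h.lab _ hfv').1 q
    refine ⟨this, ?_⟩
    have := (h.a1 _ hfv' this).2
    simpa using this
  · right
    have := (h.lab _ hfv').2.1 q
    refine ⟨this, ?_⟩
    have := (h.a2 _ hfv' this).2
    simpa using this

lemma fin1 (h : NoCtx A f g rel K) (c : W) (hc : rel c = 0) (hn : NN g rel c)
    (ha : PR g rel (f c)) (hb : QS g rel (f.symm c)) : False := by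
  obtain ⟨k, ix, hblk⟩ := h.blk c hc
  refine h.no (alt_ok hblk hn ha hb h.a1 h.a3 (fun v hv => (h.lab v hv).2.2) ?_)
  intro v hv e
  exact (h.lab v hv).2.2 ((h.oi v hv).2 e)

lemma absurd' (h : NoCtx A f g rel K) (c : W) (hc : rel c = 0) : False := by
  obtain ⟨a, ha, ho⟩ := h.exO c hc
  have hn : NN g rel (f a) := by
    rcases lt_or_gt_of_ne ho with q | q
    · exact (h.a1 a ha ((h.lab a ha).1 q)).1
    · exact (h.a2 a ha ((h.lab a ha).2.1 q)).1
  have hfa := (h.cl a).2 ha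
  rcases h.a3 _ hfa hn with ⟨q1, q2⟩ | ⟨q1, q2⟩
  · exact h.rev.fin1 _ hfa hn q1 q2
  · exact h.fin1 _ hfa hn q2 q1
end NoCtx

theorem cover [Fintype W] {A : W → Prop} {f g : Equiv.Perm W} {rel : W → ℤ} {K : ℤ}
    (H : Hyp A f g) (c0 : W) (hc : rel c0 = 0) (hC : ∀ c, rel c = 0 → ∀ v, rel v = 0 ↔ f.SameCycle c v)
    (hK : 2 * (Fintype.card W : ℤ) + 4 ≤ K) : ∃ D, LocalOK A f g rel K D := by
  by_cases hA : ∀ v, rel v = 0 → A v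
  · by_contra no
    exact NoCtx.absurd' ⟨H, hC, hA, hK, no⟩ c0 hc
  · push Not at hA
    obtain ⟨c, hc, hcA⟩ := hA
    obtain ⟨k, ix, hk⟩ := exists_cyc f rel c (hC c hc)
    exact ⟨_, triv_ok H hk (by have := hk.kc; omega) hcA⟩
end

section
variable {W : Type}

/-- global key -/
def gkey (blk zone p : W → ℤ) (B : ℤ → ℤ) (BIG : ℤ) (w : W) : ℤ :=
  if zone w = 0 then B (blk w) + p w else if zone w = 1 then BIG - blk w else - BIG - blk w

structure Gl (g : Equiv.Perm W) (blk zone p : W → ℤ) (B : ℤ → ℤ) (K n BN BIG : ℤ) : Prop where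
  b0 : ∀ w, 0 ≤ blk w
  bn : ∀ w, blk w < n
  mono : ∀ i j, i < j → B i + K ≤ B j
  B0 : ∀ w, 0 ≤ B (blk w)
  BN' : ∀ w, B (blk w) + K ≤ BN
  big : BN + n < BIG
  K0 : 0 < K
  zv : ∀ w, zone w = 0 ∨ zone w = 1 ∨ zone w = -1
  pb : ∀ w, zone w = 0 → 0 < p w ∧ p w < K
  pi : ∀ u v, blk u = blk v → zone u = 0 → zone v = 0 → p u = p v → u = v
  zu : ∀ u v, blk u = blk v → zone u ≠ 0 → zone v ≠ 0 → u = v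
  z1 : ∀ w, zone w = 1 → blk (g w) ≤ blk w ∧ blk (g.symm w) ≤ blk w
  z2 : ∀ w, zone w = -1 → blk w ≤ blk (g w) ∧ blk w ≤ blk (g.symm w)

namespace Gl
variable {g : Equiv.Perm W} {blk zone p : W → ℤ} {B : ℤ → ℤ} {K n BN BIG : ℤ}

/-- the three cases of a key -/
lemma cs (h : Gl g blk zone p B K n BN BIG) (w : W) :
    (zone w = 0 ∧ B (blk w) < gkey blk zone p B BIG w ∧ gkey blk zone p B BIG w < B (blk w) + K ∧
      gkey blk zone p B BIG w = B (blk w) + p w) ∨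
    (zone w = 1 ∧ gkey blk zone p B BIG w = BIG - blk w) ∨
    (zone w = -1 ∧ gkey blk zone p B BIG w = - BIG - blk w) := by
  unfold gkey
  rcases h.zv w with e | e | e
  · left
    have := h.pb w e
    refine ⟨e, ?_⟩
    rw [if_pos e]
    omega
  · right; left; simp [e]
  · right; right; simp [e]

lemma tri (h : Gl g blk zone p B K n BN BIG) (u w : W) :
    (blk u < blk w ∧ B (blk u) + K ≤ B (blk w)) ∨ (blk u = blk w ∧ B (blk u) = B (blk w)) ∨
    (blk w < blk u ∧ B (blk w) + K ≤ B (blk u)) := by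
  rcases lt_trichotomy (blk u) (blk w) with e | e | e
  · left; exact ⟨e, h.mono _ _ e⟩
  · right; left; exact ⟨e, by rw [e]⟩
  · right; right; exact ⟨e, h.mono _ _ e⟩

lemma inj (h : Gl g blk zone p B K n BN BIG) : Function.Injective (gkey blk zone p B BIG) := by
  intro u w e
  have q1 := h.b0 u; have q2 := h.b0 w; have q3 := h.bn u; have q4 := h.bn w
  have q5 := h.B0 u; have q6 := h.B0 w; have q7 := h.BN' u; have q8 := h.BN' w
  have q9 := h.big; have q10 := h.K0
  have t := h.tri u w
  have pi := h.pi u w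
  have zu := h.zu u w
  rcases h.cs u with c | c | c <;> rcases h.cs w with d | d | d
  · exact pi (by omega) c.1 d.1 (by omega)
  · omega
  · omega
  · omega
  · exact zu (by omega) (by omega) (by omega)
  · omega
  · omega
  · omega
  · exact zu (by omega) (by omega) (by omega)

lemma co (h : Gl g blk zone p B K n BN BIG) {p' : W → ℤ} (h' : Gl g blk zone p' B K n BN BIG)
    (u w : W) (hne : blk u ≠ blk w) :
    gkey blk zone p B BIG u < gkey blk zone p B BIG w ↔
      gkey blk zone p' B BIG u < gkey blk zone p' B BIG w := by
  have q1 := h.b0 u; have q2 := h.b0 w; have q3 := h.bn u; have q4 := h.bn w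
  have q5 := h.B0 u; have q6 := h.B0 w; have q7 := h.BN' u; have q8 := h.BN' w
  have q9 := h.big; have q10 := h.K0
  have t := h.tri u w
  have c1 := h.cs u; have c2 := h.cs w; have c3 := h'.cs u; have c4 := h'.cs w
  generalize gkey blk zone p B BIG u = a1 at *
  generalize gkey blk zone p B BIG w = a2 at *
  generalize gkey blk zone p' B BIG u = a3 at *
  generalize gkey blk zone p' B BIG w = a4 at *
  rcases c1 with c | c | c <;> rcases c2 with d | d | d <;> omega

lemma env (h : Gl g blk zone p B K n BN BIG) (b : ℤ) (hb : ∃ c, blk c = b) (p' zone' : W → ℤ)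
    (hp : ∀ v, blk v = b → p' v = p v) (hz : ∀ v, blk v = b → zone' v = zone v) :
    Env1 g (fun w => blk w - b) p' zone' K (gkey blk zone p B BIG) (B b) := by
  obtain ⟨c, rfl⟩ := hb
  have q9 := h.big; have q10 := h.K0
  have q1 := h.b0 c; have q3 := h.bn c; have q5 := h.B0 c; have q7 := h.BN' c
  have F := fun w => And.intro (h.b0 w) (And.intro (h.bn w) (And.intro (h.B0 w) (And.intro (h.BN' w)
    (And.intro (h.tri w c) (h.cs w)))))
  have eq0 : ∀ v, blk v - blk c = 0 ↔ blk v = blk c := fun v => by omega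
  constructor
  · exact h.inj
  · intro v hv hzv
    simp only [eq0] at hv
    have := F v; rw [hz v hv] at hzv; rw [hp v hv]; omega
  · intro v hv
    simp only [ne_eq, eq0] at hv
    have := F v; omega
  · intro v hv hg
    simp only [eq0] at hv
    have := F (g v); have := h.z1 (g v); simp only [Equiv.symm_apply_apply] at this; omega
  · intro v hv hg
    simp only [eq0] at hv
    have := F (g v); have := h.z2 (g v); simp only [Equiv.symm_apply_apply] at this; omega
  · intro v hv hg
    simp only [eq0] at hv
    have := F v; have := h.z1 v; omega
  · intro v hv hg
    simp only [eq0] at hv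
    have := F v; have := h.z2 v; omega
  · intro v hv hzv
    simp only [eq0] at hv
    have := F v; rw [hz v hv] at hzv; omega
  · intro v hv hzv w hw
    simp only [eq0] at hv
    have := F v; have := F w; rw [hz v hv] at hzv; omega
  · intro v hv hzv w hw
    simp only [eq0] at hv
    have := F v; have := F w; rw [hz v hv] at hzv; omega
  · intro v hv hzv w hw
    simp only [eq0] at hv
    have := F v; have := F (g w); have := h.z1 (g w); simp only [Equiv.symm_apply_apply] at this
    rw [hz v hv] at hzv; omega
  · intro v hv hzv
    simp only [eq0] at hv
    have := F v; rw [hz v hv] at hzv; omega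
  · intro v hv hzv w hw
    simp only [eq0] at hv
    have := F v; have := F w; rw [hz v hv] at hzv; omega
  · intro v hv hzv w hw
    simp only [eq0] at hv
    have := F v; have := F w; rw [hz v hv] at hzv; omega
  · intro v hv hzv w hw
    simp only [eq0] at hv
    have := F v; have := F (g w); have := h.z2 (g w); simp only [Equiv.symm_apply_apply] at this
    rw [hz v hv] at hzv; omega
end Gl

/-! ends of parts -/
lemma Ed.hor_mem {e : Ed W} {c d : W} {δ : ℤ} (h : e.hor = some (c, d, δ)) :
    c ∈ e.ends ∧ d ∈ e.ends := by
  cases e <;> simp [Ed.hor, Ed.ends] at * <;> obtain ⟨rfl, rfl, rfl⟩ := h <;> simp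
lemma Ed.ver_mem {e : Ed W} {c d : W} {δ : ℤ} (h : e.ver = some (c, d, δ)) :
    c ∈ e.ends ∧ d ∈ e.ends := by
  cases e <;> simp [Ed.ver, Ed.ends] at * <;> obtain ⟨rfl, rfl, rfl⟩ := h <;> simp
lemma Ed.steep_mem {e : Ed W} {c d : W} {δ : ℤ} (h : e.steep = some (c, d, δ)) :
    c ∈ e.ends ∧ d ∈ e.ends := by
  cases e <;> simp [Ed.steep, Ed.ends] at * <;> obtain ⟨rfl, rfl, rfl⟩ := h <;> simp
lemma Ed.shal_mem {e : Ed W} {c d : W} {δ : ℤ} (h : e.shal = some (c, d, δ)) :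
    c ∈ e.ends ∧ d ∈ e.ends := by
  cases e <;> simp [Ed.shal, Ed.ends] at * <;> obtain ⟨rfl, rfl, rfl⟩ := h <;> simp
lemma Valid.hor_d {X Y : W → ℤ} {e : Ed W} (hv : Valid X Y e) {c d : W} {δ : ℤ}
    (h : e.hor = some (c, d, δ)) : -1 ≤ δ ∧ δ ≤ 1 := by
  cases e <;> simp [Ed.hor, Valid] at * <;> omega
lemma Valid.steep_d {X Y : W → ℤ} {e : Ed W} (hv : Valid X Y e) {c d : W} {δ : ℤ}
    (h : e.steep = some (c, d, δ)) : δ = 1 ∨ δ = -1 := by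
  cases e <;> simp [Ed.steep, Valid] at * <;> omega

lemma LocalOK.sp_rel [Fintype W] {A : W → Prop} {f g : Equiv.Perm W} {rel : W → ℤ} {K : ℤ}
    {D : Loc W} (h : LocalOK A f g rel K D) (cl : ∀ v, rel (f v) = 0 ↔ rel v = 0) {e : Ed W}
    (he : Sp A f g rel D e) : ∀ v ∈ e.ends, rel v = 0 := by
  rcases he with ⟨v, h1, h2, h3, rfl⟩ | ⟨v, h1, h2, h3, h4, rfl⟩
  · rw [h.ef v h1]
    intro w hw
    rcases Sym2.mem_iff.1 hw with rfl | rfl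
    · exact h1
    · exact (cl _).2 h1
  · rw [(h.eg v h1 h2).1]
    intro w hw
    rcases Sym2.mem_iff.1 hw with rfl | rfl
    · exact h1
    · exact (h.eg v h1 h2).2

/-- an arc of the block and an edge not touching the block -/
lemma LocalOK.cross [Fintype W] {A : W → Prop} {f g : Equiv.Perm W} {rel : W → ℤ} {K : ℤ}
    {D : Loc W} (h : LocalOK A f g rel K D) (cl : ∀ v, rel (f v) = 0 ↔ rel v = 0) {e e' : Ed W}
    (he : Sp A f g rel D e) {κx κy : W → ℤ} {lo : ℤ} (hE : Env g rel D K κx κy lo)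
    (h1 : ∀ v ∈ e'.ends, rel v ≠ 0)
    (h2 : ∀ c d δ, e'.hor = some (c, d, δ) → -1 ≤ δ ∧ δ ≤ 1 ∧ (0 < rel c → 0 < rel d ∨ d = g c) ∧
      (rel c < 0 → rel d < 0 ∨ d = g c))
    (h3 : ∀ u v ε, e'.shal = some (u, v, ε) → ∀ z, rel z = 0 → Out (κx z) (κx u) (κx v)) :
    Compat κx κy e e' := by
  have hr := h.sp_rel cl he
  have hv := h.val κx κy lo hE e he
  constructor
  · intro c d δ d' δ' q1 q2
    exact absurd (hr _ (Ed.hor_mem q1).1) (h1 _ (Ed.hor_mem q2).1)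
  · intro c d δ d' δ' q1 q2
    exact absurd (hr _ (Ed.ver_mem q1).1) (h1 _ (Ed.ver_mem q2).1)
  · intro u v ε c d δ q1 q2 hB
    have hε := hv.steep_d q1
    have ru := hr _ (Ed.steep_mem q1).1
    have rv := hr _ (Ed.steep_mem q1).2
    have rc := h1 _ (Ed.hor_mem q2).1
    obtain ⟨d1, d2, d3, d4⟩ := h2 _ _ _ q2
    have zu := h.sz e he _ _ _ q1
    have yu := hE.ey.z0 u ru zu
    have bu := h.by' u ru zu
    have yc := hE.ey.out c rc
    rcases h.zv v rv with zv | zv | zv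
    · have yv := hE.ey.z0 v rv zv
      have bv := h.by' v rv zv
      unfold Btwn at hB; omega
    · have yv := hE.ey.fR1 v rv zv
      have r3 : 0 < rel c := by
        by_contra hh
        have := hE.ey.fR3 v rv zv c (by omega)
        unfold Btwn at hB; omega
      have x1 := hE.ex.fR2 v rv zv c r3
      have x2 : κx d < κx v := by
        rcases d3 r3 with q | rfl
        · exact hE.ex.fR2 v rv zv d q
        · exact hE.ex.fR4 v rv zv c r3
      unfold Avoid; omega
    · have yv := hE.ey.fL1 v rv zv
      have r3 : rel c < 0 := by
        by_contra hh
        have := hE.ey.fL3 v rv zv c (by omega)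
        unfold Btwn at hB; omega
      have x1 := hE.ex.fL2 v rv zv c r3
      have x2 : κx v < κx d := by
        rcases d4 r3 with q | rfl
        · exact hE.ex.fL2 v rv zv d q
        · exact hE.ex.fL4 v rv zv c r3
      unfold Avoid; omega
  · intro u v ε c d δ q1 q2 hB
    exfalso
    have ru := hr _ (Ed.shal_mem q1).1
    have rv := hr _ (Ed.shal_mem q1).2
    have rc := h1 _ (Ed.ver_mem q2).1
    have zu := h.hz e he _ _ _ q1
    have := hE.ex.z0 u ru zu.1
    have := h.bx u ru zu.1
    have := hE.ex.z0 v rv zu.2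
    have := h.bx v rv zu.2
    have := hE.ex.out c rc
    unfold Btwn at hB; omega
  · intro u v ε u' v' ε' q1 q2 _
    left
    exact h3 _ _ _ q2 v (hr _ (Ed.steep_mem q1).2)
  · intro c d δ c' d' δ' ⟨w, w1, w2⟩
    exact absurd (hr _ w1) (h1 _ w2)

lemma compat_L_disj {X Y : W → ℤ} {a b : W} {e : Ed W} (h : ∀ v ∈ e.ends, v ≠ a ∧ v ≠ b) :
    Compat X Y (.L a b) e where
  c1 := by
    intro c d δ d' δ' q1 q2
    have := h _ (Ed.hor_mem q2).1
    simp [Ed.hor] at q1; exact absurd q1.1.symm this.1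
  c2 := by
    intro c d δ d' δ' q1 q2
    have := h _ (Ed.ver_mem q2).1
    simp [Ed.ver] at q1; exact absurd q1.1.symm this.2
  c3 := by intro u v ε c d δ q1; simp [Ed.steep] at q1
  c4 := by intro u v ε c d δ q1; simp [Ed.shal] at q1
  c5 := by intro u v ε c d δ q1; simp [Ed.steep] at q1
  c6 := by
    rintro c d δ c' d' δ' ⟨w, w1, w2⟩
    have := h w w2
    simp [Ed.ends] at w1; tauto
end

section
variable {W : Type}

/-- all data of the global layout -/
structure Set1 [Fintype W] (A : W → Prop) (f g : Equiv.Perm W) (blk : W → ℤ) (D : ℤ → Loc W) (K : ℤ)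
    (X Y : W → ℤ) (lo : ℤ → ℤ) : Prop where
  H : Hyp A f g
  ok : ∀ b, (∃ c, blk c = b) → LocalOK A f g (fun w => blk w - b) K (D b)
  en : ∀ b, (∃ c, blk c = b) → Env g (fun w => blk w - b) (D b) K X Y (lo b)
  co : ∀ u w, blk u ≠ blk w → (X u < X w ↔ Y u < Y w)
  cl : ∀ v, blk (f v) = blk v

namespace Set1
variable [Fintype W] {A : W → Prop} {f g : Equiv.Perm W} {blk : W → ℤ} {D : ℤ → Loc W} {K : ℤ}
    {X Y : W → ℤ} {lo : ℤ → ℤ}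

lemma cl' (h : Set1 A f g blk D K X Y lo) (b : ℤ) (v : W) :
    (fun w => blk w - b) (f v) = 0 ↔ (fun w => blk w - b) v = 0 := by
  simp only [h.cl]

/-- two special arcs -/
lemma spsp (h : Set1 A f g blk D K X Y lo) {b b' : ℤ} (hb : ∃ c, blk c = b) (hb' : ∃ c, blk c = b')
    {e e' : Ed W} (he : Sp A f g (fun w => blk w - b) (D b) e)
    (he' : Sp A f g (fun w => blk w - b') (D b') e') (hne : e.ends ≠ e'.ends) :
    Compat X Y e e' := by
  by_cases hbb : b = b'
  · subst hbb
    exact (h.ok b hb).ss _ _ _ (h.en b hb) e e' he he' hne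
  · have r' := (h.ok b' hb').sp_rel (h.cl' b') he'
    have v' := (h.ok b' hb').val _ _ _ (h.en b' hb') e' he'
    refine (h.ok b hb).cross (h.cl' b) he (h.en b hb) ?_ ?_ ?_
    · intro v hv
      have := r' v hv
      (try dsimp only at *); omega
    · intro c d δ hq
      have h1 := v'.hor_d hq
      have h2 := r' c (Ed.hor_mem hq).1
      have h3 := r' d (Ed.hor_mem hq).2
      (try dsimp only at *)
      refine ⟨h1.1, h1.2, ?_, ?_⟩ <;> intro _ <;> left <;> omega
    · intro u v ε hq z hz
      have h2 := r' u (Ed.shal_mem hq).1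
      have h3 := r' v (Ed.shal_mem hq).2
      have h4 := (h.ok b' hb').hz e' he' _ _ _ hq
      have h5 := (h.ok b' hb').bx u h2 h4.1
      have h6 := (h.ok b' hb').bx v h3 h4.2
      have h7 := (h.en b' hb').ex.z0 u h2 h4.1
      have h8 := (h.en b' hb').ex.z0 v h3 h4.2
      have h9 := (h.en b' hb').ex.out z (by (try dsimp only at *); omega)
      unfold Out; omega

/-- special and normal -/
lemma spn (h : Set1 A f g blk D K X Y lo) {b : ℤ} (hb : ∃ c, blk c = b)
    {e : Ed W} (he : Sp A f g (fun w => blk w - b) (D b) e) (w : W) (a1 : A w) (a2 : A (g w))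
    (hw : (D (blk w)).nm w) :
    Compat X Y e (.L w (g w)) ∧ Compat X Y (.L w (g w)) e := by
  by_cases t1 : blk w = b
  · refine (h.ok b hb).sn _ _ _ (h.en b hb) e w he ⟨a1, a2, Or.inl ⟨?_, ?_⟩⟩
    · (try dsimp only); omega
    · rw [← t1]; exact hw
  by_cases t2 : blk (g w) = b
  · refine (h.ok b hb).sn _ _ _ (h.en b hb) e w he ⟨a1, a2, Or.inr ⟨?_, ?_⟩⟩
    · (try dsimp only); omega
    · (try dsimp only); omega
  have r := (h.ok b hb).sp_rel (h.cl' b) he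
  constructor
  · refine (h.ok b hb).cross (h.cl' b) he (h.en b hb) ?_ ?_ ?_
    · intro v hv
      simp only [Ed.ends] at hv
      rcases Sym2.mem_iff.1 hv with rfl | rfl
      · (try dsimp only); omega
      · (try dsimp only); omega
    · intro c d δ hq
      simp only [Ed.hor, Option.some.injEq, Prod.mk.injEq] at hq
      obtain ⟨rfl, rfl, rfl⟩ := hq
      exact ⟨by omega, by omega, fun _ => Or.inr rfl, fun _ => Or.inr rfl⟩
    · intro u v ε hq
      simp [Ed.shal] at hq
  · refine compat_L_disj ?_
    intro v hv
    have := r v hv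
    (try dsimp only at this)
    constructor
    · rintro rfl; omega
    · rintro rfl; omega

/-- two normal arcs -/
lemma nn (h : Set1 A f g blk D K X Y lo) (w w' : W) (hne : w ≠ w') (a1 : A w) (a2 : A (g w))
    (a3 : A (g w')) : Compat X Y (.L w (g w)) (.L w' (g w')) where
  c1 := by
    intro c d δ d' δ' q1 q2
    simp only [Ed.hor, Option.some.injEq, Prod.mk.injEq] at q1 q2
    exact absurd (q1.1.trans q2.1.symm) hne
  c2 := by
    intro c d δ d' δ' q1 q2
    simp only [Ed.ver, Option.some.injEq, Prod.mk.injEq] at q1 q2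
    exact absurd (g.injective (q1.1.trans q2.1.symm)) hne
  c3 := by intro u v ε c d δ q1; simp [Ed.steep] at q1
  c4 := by intro u v ε c d δ q1; simp [Ed.shal] at q1
  c5 := by intro u v ε c d δ q1; simp [Ed.steep] at q1
  c6 := by
    rintro c d δ c' d' δ' ⟨z, z1, z2⟩ q1 q2 hcc
    simp only [Ed.hor, Ed.ver, Option.some.injEq, Prod.mk.injEq] at q1 q2
    obtain ⟨rfl, rfl, rfl⟩ := q1
    obtain ⟨rfl, rfl, rfl⟩ := q2
    simp only [Ed.ends] at z1 z2
    have key : g w = w' := by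
      rcases Sym2.mem_iff.1 z1 with rfl | rfl <;> rcases Sym2.mem_iff.1 z2 with e | e
      · exact absurd e hne
      · exact absurd e hcc
      · exact e
      · exact absurd (g.injective e) hne
    subst key
    have fin : Out (X (g (g w))) (X w) (X (g w)) ∨ Out (Y w) (Y (g (g w))) (Y (g w)) := by
      have go : ∀ b, (∃ c, blk c = b) → Two (fun z => blk z - b) w (g w) (g (g w)) → _ :=
        fun b hb => (h.ok b hb).ch _ _ _ (h.en b hb) w a1 a2 a3
      by_cases e1 : blk w = blk (g w)
      · exact go (blk w) ⟨w, rfl⟩ (by unfold Two; (try dsimp only); omega)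
      by_cases e2 : blk w = blk (g (g w))
      · exact go (blk w) ⟨w, rfl⟩ (by unfold Two; (try dsimp only); omega)
      by_cases e3 : blk (g w) = blk (g (g w))
      · exact go (blk (g w)) ⟨g w, rfl⟩ (by unfold Two; (try dsimp only); omega)
      have i := (h.en (blk w) ⟨w, rfl⟩).ex.inj
      have j := (h.en (blk w) ⟨w, rfl⟩).ey.inj
      have c1 := h.co _ _ e1
      have c2 := h.co _ _ e2
      have c3 := h.co _ _ e3
      have n1 : X w ≠ X (g w) := fun q => e1 (congrArg blk (i q))
      have n2 : X w ≠ X (g (g w)) := fun q => e2 (congrArg blk (i q))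
      have n3 : X (g w) ≠ X (g (g w)) := fun q => e3 (congrArg blk (i q))
      have m1 : Y w ≠ Y (g w) := fun q => e1 (congrArg blk (j q))
      have m2 : Y w ≠ Y (g (g w)) := fun q => e2 (congrArg blk (j q))
      have m3 : Y (g w) ≠ Y (g (g w)) := fun q => e3 (congrArg blk (j q))
      unfold Out; omega
    unfold Out at *; omega

/-- all arcs -/
def Arc (A : W → Prop) (f g : Equiv.Perm W) (blk : W → ℤ) (D : ℤ → Loc W) (e : Ed W) : Prop :=
  (∃ v, A v ∧ A (f v) ∧ e = (D (blk v)).df v) ∨ (∃ v, A v ∧ A (g v) ∧ e = (D (blk v)).dg v)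

lemma arc (h : Set1 A f g blk D K X Y lo) {e : Ed W} (he : Arc A f g blk D e) :
    (∃ b, (∃ c, blk c = b) ∧ Sp A f g (fun w => blk w - b) (D b) e) ∨
    (∃ w, A w ∧ A (g w) ∧ (D (blk w)).nm w ∧ e = .L w (g w)) := by
  rcases he with ⟨v, h1, h2, rfl⟩ | ⟨v, h1, h2, rfl⟩
  · left
    exact ⟨blk v, ⟨v, rfl⟩, Or.inl ⟨v, by (try dsimp only); omega, h1, h2, rfl⟩⟩
  · by_cases hn : (D (blk v)).nm v
    · right
      exact ⟨v, h1, h2, hn, (h.ok _ ⟨v, rfl⟩).en v (by (try dsimp only); omega) hn⟩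
    · left
      exact ⟨blk v, ⟨v, rfl⟩, Or.inr ⟨v, by (try dsimp only); omega, hn, h1, h2, rfl⟩⟩

lemma valid (h : Set1 A f g blk D K X Y lo) {e : Ed W} (he : Arc A f g blk D e) : Valid X Y e := by
  rcases h.arc he with ⟨b, hb, hs⟩ | ⟨w, a1, a2, _, rfl⟩
  · exact (h.ok b hb).val _ _ _ (h.en b hb) e hs
  · exact fun q => h.H.g1 w a1 a2 q.symm

lemma compat (h : Set1 A f g blk D K X Y lo) {e e' : Ed W} (he : Arc A f g blk D e)
    (he' : Arc A f g blk D e') (hne : e.ends ≠ e'.ends) : Compat X Y e e' := by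
  rcases h.arc he with ⟨b, hb, hs⟩ | ⟨w, a1, a2, a3, rfl⟩ <;>
  rcases h.arc he' with ⟨b', hb', hs'⟩ | ⟨w', a1', a2', a3', rfl⟩
  · exact h.spsp hb hb' hs hs' hne
  · exact (h.spn hb hs w' a1' a2' a3').1
  · exact (h.spn hb' hs' w a1 a2 a3).2
  · refine h.nn w w' ?_ a1 a2 a2'
    rintro rfl; exact hne rfl

lemma ends_f (h : Set1 A f g blk D K X Y lo) (v : W) : ((D (blk v)).df v).ends = s(v, f v) :=
  (h.ok _ ⟨v, rfl⟩).ef v (by (try dsimp only); omega)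

lemma ends_g (h : Set1 A f g blk D K X Y lo) (v : W) : ((D (blk v)).dg v).ends = s(v, g v) := by
  by_cases hn : (D (blk v)).nm v
  · rw [(h.ok _ ⟨v, rfl⟩).en v (by (try dsimp only); omega) hn]; rfl
  · exact ((h.ok _ ⟨v, rfl⟩).eg v (by (try dsimp only); omega) hn).1

lemma count (h : Set1 A f g blk D K X Y lo) :
    4 * cnt (fun v => A v ∧ A (f v) ∧ ¬ ((D (blk v)).df v).isS) ≤
    3 * cnt (fun v => A v ∧ A (f v)) := by
  have fib : ∀ P : W → Prop, cnt P =
      ∑ b ∈ Finset.univ.image blk, cnt (fun v => blk v - b = 0 ∧ P v) := by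
    intro P
    unfold cnt
    rw [Finset.card_eq_sum_card_fiberwise (f := blk) (t := Finset.univ.image blk)
      (fun x _ => by simp)]
    refine Finset.sum_congr rfl fun b _ => ?_
    congr 1
    ext v
    simp only [Finset.mem_filter, Finset.mem_univ, true_and, sub_eq_zero]
    tauto
  rw [fib, fib (fun v => A v ∧ A (f v)), Finset.mul_sum, Finset.mul_sum]
  refine Finset.sum_le_sum ?_
  intro b hb
  have hb' : ∃ c, blk c = b := by simpa using hb
  have := (h.ok b hb').ct
  have e1 : cnt (fun v => blk v - b = 0 ∧ A v ∧ A (f v) ∧ ¬ ((D (blk v)).df v).isS) =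
     cnt (fun v => blk v - b = 0 ∧ A v ∧ A (f v) ∧ ¬ ((D b).df v).isS) := by
    congr 1
    ext v
    constructor
    · rintro ⟨q, r⟩
      have : blk v = b := by omega
      rw [this] at r; exact ⟨q, r⟩
    · rintro ⟨q, r⟩
      have : blk v = b := by omega
      rw [this]; exact ⟨by omega, r⟩
  rw [e1]; exact this
end Set1
end

section
variable {W : Type}

theorem exists_set1 [Fintype W] {A : W → Prop} {f g : Equiv.Perm W} (H : Hyp A f g) :
    ∃ blk D K X Y lo, Set1 A f g blk D K X Y lo := by
  let Q := Quotient (Equiv.Perm.SameCycle.setoid f)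
  haveI : Fintype Q := Fintype.ofFinite Q
  let blk : W → ℤ := fun w => ((Fintype.equivFin Q (Quotient.mk _ w) : Fin _) : ℕ)
  have hblk : ∀ u v, blk u = blk v ↔ f.SameCycle u v := by
    intro u v
    have h1 : blk u = blk v ↔ (Quotient.mk (Equiv.Perm.SameCycle.setoid f) u) = Quotient.mk _ v := by
      simp only [blk, Nat.cast_inj, Fin.val_inj, EmbeddingLike.apply_eq_iff_eq]
    rw [h1, Quotient.eq]
    rfl
  let n : ℤ := Fintype.card Q
  have b0 : ∀ w, 0 ≤ blk w := fun w => Int.natCast_nonneg _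
  have bn : ∀ w, blk w < n := fun w => by
    have := (Fintype.equivFin Q (Quotient.mk _ w)).isLt
    simp only [blk, n]; exact_mod_cast this
  let K : ℤ := 2 * (Fintype.card W : ℤ) + 4
  have K0 : 0 < K := by simp only [K]; positivity
  have ex : ∀ b, ∃ D, (∃ c, blk c = b) → LocalOK A f g (fun w => blk w - b) K D := by
    intro b
    by_cases hb : ∃ c, blk c = b
    · obtain ⟨c, hc⟩ := hb
      obtain ⟨D, hD⟩ := cover (rel := fun w => blk w - b) H c (by simp [hc])
        (by
          intro c' hc' v
          have q : blk c' = b := by simpa [sub_eq_zero] using hc'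
          rw [← hblk, q]
          simp only [sub_eq_zero]; exact eq_comm)
        (le_refl K)
      exact ⟨D, fun _ => hD⟩
    · exact ⟨⟨0, 0, 0, fun w => .S w w, fun w => .S w w, fun _ => True⟩, fun h => absurd h hb⟩
  choose D hD using ex
  let B : ℤ → ℤ := fun i => K * i
  let BN := K * n
  let BIG := BN + n + 1
  let zone : W → ℤ := fun w => (D (blk w)).zone w
  let px : W → ℤ := fun w => (D (blk w)).px w
  let py : W → ℤ := fun w => (D (blk w)).py w
  have mono : ∀ i j, i < j → B i + K ≤ B j := by
    intro i j hij
    simp only [B]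
    nlinarith
  have B0 : ∀ w, 0 ≤ B (blk w) := fun w => mul_nonneg K0.le (b0 w)
  have BN' : ∀ w, B (blk w) + K ≤ BN := fun w => mono _ _ (bn w)
  have ok := fun w => hD (blk w) ⟨w, rfl⟩
  have self : ∀ w, (fun z => blk z - blk w) w = 0 := fun w => sub_self _
  have zu : ∀ u v, blk u = blk v → zone u ≠ 0 → zone v ≠ 0 → u = v := by
    intro u v huv h1 h2
    simp only [zone] at h1 h2
    rw [← huv] at h2
    exact (ok u).zu u v (self u) (by simp [huv]) h1 h2
  have z1 : ∀ w, zone w = 1 → blk (g w) ≤ blk w ∧ blk (g.symm w) ≤ blk w := by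
    intro w hw
    have := (ok w).z1 w (self w) hw
    (try dsimp only at this); omega
  have z2 : ∀ w, zone w = -1 → blk w ≤ blk (g w) ∧ blk w ≤ blk (g.symm w) := by
    intro w hw
    have := (ok w).z2 w (self w) hw
    (try dsimp only at this); omega
  have gx : Gl g blk zone px B K n BN BIG := by
    refine ⟨b0, bn, mono, B0, BN', by simp only [BIG]; omega, K0, fun w => (ok w).zv w (self w),
      fun w hw => (ok w).bx w (self w) hw, ?_, zu, z1, z2⟩
    intro u v huv h1 h2 h3
    simp only [zone, px] at h1 h2 h3
    rw [← huv] at h2 h3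
    exact (ok u).ix u v (self u) (by simp [huv]) h1 h2 h3
  have gy : Gl g blk zone py B K n BN BIG := by
    refine ⟨b0, bn, mono, B0, BN', by simp only [BIG]; omega, K0, fun w => (ok w).zv w (self w),
      fun w hw => (ok w).by' w (self w) hw, ?_, zu, z1, z2⟩
    intro u v huv h1 h2 h3
    simp only [zone, py] at h1 h2 h3
    rw [← huv] at h2 h3
    exact (ok u).iy u v (self u) (by simp [huv]) h1 h2 h3
  refine ⟨blk, D, K, gkey blk zone px B BIG, gkey blk zone py B BIG, B, ⟨H, hD, ?_, ?_, ?_⟩⟩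
  · intro b hb
    refine ⟨gx.env b hb _ _ ?_ ?_, gy.env b hb _ _ ?_ ?_, ?_⟩
    · intro v hv; simp only [px, hv]
    · intro v hv; simp only [zone, hv]
    · intro v hv; simp only [py, hv]
    · intro v hv; simp only [zone, hv]
    · intro u w hu hw
      exact gx.co gy u w (by (try dsimp only at *); omega)
  · intro u w huw
    exact gx.co gy u w huw
  · intro v
    rw [hblk]
    exact Equiv.Perm.SameCycle.symm ⟨1, by simp⟩
end

lemma card_filter_eq_cnt {W : Type} [Fintype W] (P : W → Prop) [DecidablePred P] :
    (Finset.univ.filter P).card = cnt P := by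
  unfold cnt
  congr

/-- There is an absolute constant `c` such that every graph with
maximum degree 4 on `n` vertices and `m` edges admits a 1-bend RAC drawing, on integer
grid points inside a square of side `c * n` (i.e. of `O(n²)` area), in which at least
`m / 8` edges are drawn as single straight-line segments (without a bend, i.e. their
polyline consists of exactly two points). -/
theorem stmt6 :
    ∃ c : ℝ, 0 < c ∧
      ∀ (V : Type) [Fintype V] (G : SimpleGraph V),
        (∀ v : V, vdeg G v ≤ 4) →
        ∃ (p : V → Pt) (poly : Sym2 V → List Pt),
          IsBendRACDrawing 1 G p poly ∧
          (G.edgeSet.ncard : ℝ) / 8 ≤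
            ({e ∈ G.edgeSet | (poly e).length = 2}.ncard : ℝ) ∧
          InGridSquare (c * (Fintype.card V : ℝ)) (drawingPoints G p poly) := by
  refine ⟨10, by norm_num, ?_⟩
  intro V _ G hdeg
  obtain ⟨φ, hφ1, hφ2, hφ3⟩ := decomp V G hdeg
  let A : V ⊕ V → Prop := fun w => ∃ v, w = Sum.inl v
  let pr : V ⊕ V → V := Sum.elim id id
  let ee : Bool → V ⊕ V → Sym2 V := fun b w => s(pr w, pr (φ b w))
  let R : Bool → V ⊕ V → Prop := fun b w => A w ∧ A (φ b w)
  have Rin : ∀ b w, R b w → ∃ v v', w = Sum.inl v ∧ φ b (Sum.inl v) = Sum.inl v' ∧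
      ee b w = s(v, v') := by
    rintro b w ⟨⟨v, rfl⟩, v', h⟩
    refine ⟨v, v', rfl, h, ?_⟩
    simp only [ee, h]; rfl
  have Rmap : ∀ b w, R b w → (ee b w).map Sum.inl = s(w, φ b w) := by
    intro b w hw
    obtain ⟨v, v', rfl, h1, h2⟩ := Rin b w hw
    rw [h2, h1]; rfl
  have Redge : ∀ b w, R b w → ee b w ∈ G.edgeSet := by
    intro b w hw
    obtain ⟨v, v', rfl, h1, h2⟩ := Rin b w hw
    rw [h2]; exact hφ1 b v v' h1
  have Runiq : ∀ b b' w w', R b w → R b' w' → ee b w = ee b' w' → b = b' ∧ w = w' := by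
    intro b b' w w' hw hw' h
    obtain ⟨v, x, rfl, h1, h2⟩ := Rin b w hw
    obtain ⟨v', x', rfl, h1', h2'⟩ := Rin b' w' hw'
    rw [h2, h2'] at h
    obtain ⟨q1, q2⟩ := hφ3 b b' v v' x x' h1 h1' h
    exact ⟨q1, by rw [q2]⟩
  have Rex : ∀ e, e ∈ G.edgeSet → ∃ b w, R b w ∧ ee b w = e := by
    intro e he
    induction e using Sym2.ind with
    | _ v w =>
      obtain ⟨b, h | h⟩ := hφ2 v w he
      · refine ⟨b, Sum.inl v, ⟨⟨v, rfl⟩, w, h⟩, ?_⟩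
        simp only [ee, h]; rfl
      · refine ⟨b, Sum.inl w, ⟨⟨w, rfl⟩, v, h⟩, ?_⟩
        simp only [ee, h]; exact Sym2.eq_swap
  have fine : G.edgeSet.Finite := Set.toFinite _
  -- choose the richer permutation
  have hm : G.edgeSet.ncard ≤ cnt (R true) + cnt (R false) := by
    have hsub : G.edgeSet ⊆ (((Finset.univ.filter (R true)).image (ee true) ∪
        (Finset.univ.filter (R false)).image (ee false) : Finset (Sym2 V)) : Set (Sym2 V)) := by
      intro e he
      obtain ⟨b, w, h1, h2⟩ := Rex e he
      simp only [Finset.coe_union, Finset.coe_image, Finset.coe_filter, Finset.mem_univ, true_and]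
      cases b
      · right; exact ⟨w, h1, h2⟩
      · left; exact ⟨w, h1, h2⟩
    have h1 := Set.ncard_le_ncard hsub (Finset.finite_toSet _)
    rw [Set.ncard_coe_finset] at h1
    exact h1.trans ((Finset.card_union_le _ _).trans
      (add_le_add (Finset.card_image_le.trans_eq (card_filter_eq_cnt _))
        (Finset.card_image_le.trans_eq (card_filter_eq_cnt _))))
  have hb0 : ∃ b0, G.edgeSet.ncard ≤ 2 * cnt (R b0) := by
    rcases le_total (cnt (R true)) (cnt (R false)) with h | h
    · exact ⟨false, by omega⟩
    · exact ⟨true, by omega⟩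
  obtain ⟨b0, hb0⟩ := hb0
  have self1 : ∀ b v, A v → A (φ b v) → φ b v ≠ v := by
    rintro b _ ⟨v, rfl⟩ ⟨w, h⟩ h'
    have := hφ1 b v w h
    rw [h] at h'
    rw [Sum.inl.inj h'] at this
    exact G.loopless.irrefl _ this
  have self2 : ∀ b b' v, A v → A (φ b v) → φ b' (φ b v) ≠ v := by
    rintro b b' _ ⟨v, rfl⟩ ⟨w, h⟩ h'
    rw [h] at h'
    have := (hφ3 b b' v w w v h h' Sym2.eq_swap).2
    subst this
    exact G.loopless.irrefl _ (hφ1 b _ _ h)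
  have H : Hyp A (φ b0) (φ (!b0)) := by
    refine ⟨self1 _, self2 _ _, self1 _, self2 _ _, ?_, self2 _ _⟩
    rintro _ ⟨v, rfl⟩ ⟨w, h⟩ h'
    rw [h] at h'
    have := (hφ3 b0 (!b0) v v w w h h' rfl).1
    cases b0 <;> simp at this
  obtain ⟨blk, D, K, X, Y, lo, hS⟩ := exists_set1 H
  let ar : Bool → V ⊕ V → Ed (V ⊕ V) := fun b w =>
    if b = b0 then (D (blk w)).df w else (D (blk w)).dg w
  have nb : ∀ b, b ≠ b0 → b = !b0 := fun b h => Bool.eq_not.2 h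
  have arArc : ∀ b w, R b w → Set1.Arc A (φ b0) (φ (!b0)) blk D (ar b w) := by
    intro b w hw
    by_cases hb : b = b0
    · subst hb
      left; exact ⟨w, hw.1, hw.2, if_pos rfl⟩
    · right
      refine ⟨w, hw.1, ?_, if_neg hb⟩
      rw [← nb b hb]; exact hw.2
  have arEnds : ∀ b w, (ar b w).ends = s(w, φ b w) := by
    intro b w
    by_cases hb : b = b0
    · subst hb
      simp only [ar, if_true]; exact hS.ends_f w
    · simp only [ar, if_neg hb]
      rw [nb b hb]; exact hS.ends_g w
  have edex : ∀ e, ∃ E : Ed (V ⊕ V), e ∈ G.edgeSet → ∃ b w, R b w ∧ ee b w = e ∧ E = ar b w := by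
    intro e
    by_cases he : e ∈ G.edgeSet
    · obtain ⟨b, w, h1, h2⟩ := Rex e he
      exact ⟨ar b w, fun _ => ⟨b, w, h1, h2, rfl⟩⟩
    · induction e using Sym2.ind with
      | _ v w => exact ⟨.S (Sum.inl v) (Sum.inl w), fun h => absurd h he⟩
  choose ed hed using edex
  have hends : ∀ e ∈ G.edgeSet, (ed e).ends = e.map Sum.inl := by
    intro e he
    obtain ⟨b, w, h1, h2, h3⟩ := hed e he
    rw [h3, arEnds, ← h2, Rmap b w h1]
  have hArc : ∀ e ∈ G.edgeSet, Set1.Arc A (φ b0) (φ (!b0)) blk D (ed e) := by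
    intro e he
    obtain ⟨b, w, h1, h2, h3⟩ := hed e he
    rw [h3]; exact arArc b w h1
  have edee : ∀ w, R b0 w → ed (ee b0 w) = (D (blk w)).df w := by
    intro w hw
    obtain ⟨b, w', h1, h2, h3⟩ := hed _ (Redge b0 w hw)
    obtain ⟨q1, q2⟩ := Runiq _ _ _ _ h1 hw h2
    subst q1; subst q2
    rw [h3]; exact if_pos rfl
  obtain ⟨p, poly, k1, k2, k3⟩ := keys_ok G (Sum.inl : V → V ⊕ V) Sum.inl_injective X Y
    (by
      intro u v huv
      exact (hS.en (blk u) ⟨u, rfl⟩).ex.inj huv)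
    (by
      intro u v huv
      exact (hS.en (blk u) ⟨u, rfl⟩).ey.inj huv)
    ed hends (fun e he => hS.valid (hArc e he))
    (by
      intro e he e' he' hne
      refine hS.compat (hArc e he) (hArc e' he') ?_
      rw [hends e he, hends e' he']
      intro h
      exact hne (Sym2.map.injective Sum.inl_injective h))
    (10 * (Fintype.card V : ℝ))
    (by
      by_cases hV : IsEmpty V
      · exact Or.inr hV
      · left
        rw [not_isEmpty_iff] at hV
        have : 1 ≤ Fintype.card V := Fintype.card_pos
        have h2 : (1 : ℝ) ≤ (Fintype.card V : ℝ) := by exact_mod_cast this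
        rw [Fintype.card_sum]
        push_cast
        linarith)
  refine ⟨p, poly, k1, ?_, k3⟩
  have hcount := hS.count
  have hgood : cnt (fun v => A v ∧ A (φ b0 v) ∧ ((D (blk v)).df v).isS) ≤
      {e ∈ G.edgeSet | (poly e).length = 2}.ncard := by
    have hsub : (((Finset.univ.filter
        (fun v => A v ∧ A (φ b0 v) ∧ ((D (blk v)).df v).isS)).image (ee b0) : Finset (Sym2 V)) :
        Set (Sym2 V)) ⊆ {e ∈ G.edgeSet | (poly e).length = 2} := by
      intro e he
      simp only [Finset.coe_image, Finset.coe_filter, Finset.mem_univ, true_and] at he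
      obtain ⟨w, ⟨h1, h2, h3⟩, rfl⟩ := he
      refine ⟨Redge b0 w ⟨h1, h2⟩, k2 _ ?_⟩
      rw [edee w ⟨h1, h2⟩]; exact h3
    have h1 := Set.ncard_le_ncard hsub (Set.toFinite _)
    rw [Set.ncard_coe_finset, Finset.card_image_of_injOn] at h1
    · exact (card_filter_eq_cnt _).symm.trans_le h1
    · intro w hw w' hw' h
      simp only [Finset.coe_filter, Finset.mem_univ, true_and, Set.mem_ofPred_eq] at hw hw'
      exact (Runiq b0 b0 w w' ⟨hw.1, hw.2.1⟩ ⟨hw'.1, hw'.2.1⟩ h).2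
  have hsplit : cnt (R b0) ≤ cnt (fun v => A v ∧ A (φ b0 v) ∧ ((D (blk v)).df v).isS) +
      cnt (fun v => A v ∧ A (φ b0 v) ∧ ¬ ((D (blk v)).df v).isS) := by
    unfold cnt
    refine le_trans (Finset.card_le_card ?_) (Finset.card_union_le _ _)
    intro v hv
    simp only [Finset.mem_union, Finset.mem_filter, Finset.mem_univ, true_and] at *
    by_cases hs : ((D (blk v)).df v).isS
    · left; exact ⟨hv.1, hv.2, hs⟩
    · right; exact ⟨hv.1, hv.2, hs⟩
  have hR : cnt (R b0) = cnt (fun v => A v ∧ A (φ b0 v)) := rfl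
  have final : G.edgeSet.ncard ≤ 8 * {e ∈ G.edgeSet | (poly e).length = 2}.ncard := by
    rw [← hR] at hcount
    omega
  have final' : (G.edgeSet.ncard : ℝ) ≤ 8 * ({e ∈ G.edgeSet | (poly e).length = 2}.ncard : ℝ) := by
    exact_mod_cast final
  linarith
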